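/- In the setting below, assume additionally that the closure of Per_H equals M and that δ ∈ (0, ν) is such that X_δ has finitely many maximal chains that are pairwise disjoint, each accumulating at x. Let p ∈ X_δ, write [p] for the maximal chain of X_δ containing p and S_{[p]} = closure(⋃_{q∈[p]} Ŝ_q). Then ∂S_{[p]} ∩ B_δ(x) is a topological manifold of dimension n−1: every point of ∂S_{[p]} ∩ B_δ(x) has an open neighborhood in the subspace ∂S_{[p]} ∩ B_δ(x) that is homeomorphic to an open subset of ℝ^{n−1}. Here ∂ denotes the topological frontier in M. -/

import Mathlib

open Metric Set

variable {M : Type*} [MetricSpace M]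

/-- Iterates of a homeomorphism, indexed by `ℤ`. -/
def iterZ (f : M ≃ₜ M) (k : ℤ) (x : M) : M := (f.toEquiv ^ k) x

/-- `f` is expansive with expansivity constant `α`. -/
def IsExpansive (f : M ≃ₜ M) (α : ℝ) : Prop :=
  ∀ x y : M, x ≠ y → ∃ k : ℤ, α < dist (iterZ f k x) (iterZ f k y)

/-- Stable set of `x`. -/
def Ws (f : M ≃ₜ M) (x : M) : Set M :=
  {y | Filter.Tendsto (fun k : ℤ => dist (iterZ f k x) (iterZ f k y)) Filter.atTop (nhds 0)}

/-- Unstable set of `x`. -/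
def Wu (f : M ≃ₜ M) (x : M) : Set M :=
  {y | Filter.Tendsto (fun k : ℤ => dist (iterZ f k x) (iterZ f k y)) Filter.atBot (nhds 0)}

/-- Local (`ε`-local) stable set of `x`. -/
def WsLoc (f : M ≃ₜ M) (ε : ℝ) (x : M) : Set M :=
  {y | ∀ k : ℤ, 0 ≤ k → dist (iterZ f k x) (iterZ f k y) ≤ ε}

/-- Local (`ε`-local) unstable set of `x`. -/
def WuLoc (f : M ≃ₜ M) (ε : ℝ) (x : M) : Set M :=
  {y | ∀ k : ℤ, k ≤ 0 → dist (iterZ f k x) (iterZ f k y) ≤ ε}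

/-- The model space `ℝ^r × ℝ^{n-r}`. -/
abbrev ModelSp (n r : ℕ) := (Fin r → ℝ) × (Fin (n - r) → ℝ)

/-- The model hyperbolic linear map `L(a,b) = (a/2, 2b)`. -/
noncomputable def modelL (n r : ℕ) : ModelSp n r → ModelSp n r :=
  fun q => (fun i => q.1 i / 2, fun i => 2 * q.2 i)

/-- Topologically hyperbolic periodic points of index `r` (`Per_H^r`). -/
def PerHr (f : M ≃ₜ M) (n r : ℕ) : Set M :=
  {p | ∃ l : ℕ, 1 ≤ l ∧ (f.toEquiv ^ l) p = p ∧
    ∃ (U : Set M) (V : Set (ModelSp n r)) (h : U ≃ₜ V),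
      IsOpen U ∧ IsOpen V ∧ (0 : ModelSp n r) ∈ V ∧
      ∃ hp : p ∈ U, ((h ⟨p, hp⟩ : V) : ModelSp n r) = 0 ∧
        ∀ z : M, ∀ hz : z ∈ U, ∀ hz' : (f.toEquiv ^ l) z ∈ U,
          ((h ⟨(f.toEquiv ^ l) z, hz'⟩ : V) : ModelSp n r) = modelL n r (h ⟨z, hz⟩)}

/-- All topologically hyperbolic periodic points (`Per_H`). -/
def PerH (f : M ≃ₜ M) (n : ℕ) : Set M := ⋃ r ∈ Finset.range (n + 1), PerHr f n r

/-- `p` admits a local product structure. -/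
def AdmitsLPS (f : M ≃ₜ M) (n : ℕ) (p : M) : Prop :=
  ∃ (k : ℕ) (h : (Fin k → ℝ) × (Fin (n - k) → ℝ) → M) (ε : ℝ),
    0 < ε ∧ Topology.IsEmbedding h ∧ p ∈ Set.range h ∧
    ∀ x : Fin k → ℝ, ∀ y : Fin (n - k) → ℝ,
      h '' ({x} ×ˢ univ) = WsLoc f ε (h (x, y)) ∩ Set.range h ∧
      h '' (univ ×ˢ {y}) = WuLoc f ε (h (x, y)) ∩ Set.range h

/-- `D` has exactly two connected components, namely `V₁` and `V₂`. -/
def TwoComponents {M : Type*} [TopologicalSpace M] (D V₁ V₂ : Set M) : Prop :=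
  V₁ ≠ V₂ ∧
  (∀ y ∈ D, connectedComponentIn D y = V₁ ∨ connectedComponentIn D y = V₂) ∧
  (∃ y ∈ D, connectedComponentIn D y = V₁) ∧ (∃ y ∈ D, connectedComponentIn D y = V₂)

variable {M : Type*} [MetricSpace M]

/-- `S_p = cc_p(W^s(p) ∩ B_ν(x))`. -/
def SpSet (f : M ≃ₜ M) (x : M) (ν : ℝ) (p : M) : Set M :=
  connectedComponentIn (Ws f p ∩ Metric.ball x ν) p

/-- `U_p = cc_p(W^u(p) ∩ B_ν(x))`. -/
def UpSet (f : M ≃ₜ M) (x : M) (ν : ℝ) (p : M) : Set M :=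
  connectedComponentIn (Wu f p ∩ Metric.ball x ν) p

/-- `Ŝ_p = B_ν(x) \ cc_x(B_ν(x) \ S_p)`. -/
def ShatSet (f : M ≃ₜ M) (x : M) (ν : ℝ) (p : M) : Set M :=
  Metric.ball x ν \ connectedComponentIn (Metric.ball x ν \ SpSet f x ν p) x

/-- `X_δ = Per_H^{n-1} ∩ B_δ(x)`. -/
def Xdelta (f : M ≃ₜ M) (n : ℕ) (x : M) (δ : ℝ) : Set M :=
  PerHr f n (n - 1) ∩ Metric.ball x δ

/-- `C` is a chain of `(X_δ, ≤)`, where `p ≤ q ↔ Ŝ_p ⊆ Ŝ_q`. -/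
def IsChainIn (f : M ≃ₜ M) (n : ℕ) (x : M) (ν δ : ℝ) (C : Set M) : Prop :=
  C ⊆ Xdelta f n x δ ∧
  ∀ p ∈ C, ∀ q ∈ C, ShatSet f x ν p ⊆ ShatSet f x ν q ∨ ShatSet f x ν q ⊆ ShatSet f x ν p

/-- `C` is a maximal chain of `(X_δ, ≤)`. -/
def IsMaxChainIn (f : M ≃ₜ M) (n : ℕ) (x : M) (ν δ : ℝ) (C : Set M) : Prop :=
  IsChainIn f n x ν δ C ∧ ∀ C' : Set M, IsChainIn f n x ν δ C' → C ⊆ C' → C' = C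


open Metric Set
/-! ### No retraction -/

lemma det_interp {E : Type*} [NormedAddCommGroup E] [NormedSpace ℝ E] [FiniteDimensional ℝ E]
    (s : Finset ℕ) (v : ℕ → ℝ) (hv : InjOn v s) (hs : Module.finrank ℝ E < s.card) :
    ∃ c : ℕ → ℝ, ∀ A : E →L[ℝ] E,
      (ContinuousLinearMap.id ℝ E + A).det =
        ∑ i ∈ s, c i * (ContinuousLinearMap.id ℝ E + v i • A).det := by
  classical
  refine ⟨fun i => (Lagrange.basis s v i).eval 1, fun A => ?_⟩
  set b := Module.finBasis ℝ E
  set B := LinearMap.toMatrix b b (A : E →ₗ[ℝ] E) with hB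
  set P : Polynomial ℝ := Matrix.det ((Polynomial.X : Polynomial ℝ) • B.map Polynomial.C +
    (1 : Matrix _ _ ℝ).map Polynomial.C) with hP
  have hev : ∀ t : ℝ, P.eval t = (ContinuousLinearMap.id ℝ E + t • A).det := by
    intro t
    have h1 : (ContinuousLinearMap.id ℝ E + t • A).det
        = Matrix.det (LinearMap.toMatrix b b ((ContinuousLinearMap.id ℝ E + t • A : E →L[ℝ] E) : E →ₗ[ℝ] E)) := by
      rw [LinearMap.det_toMatrix]
    have h2 : LinearMap.toMatrix b b ((ContinuousLinearMap.id ℝ E + t • A : E →L[ℝ] E) : E →ₗ[ℝ] E)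
        = t • B + 1 := by
      rw [hB, ContinuousLinearMap.toLinearMap_add, ContinuousLinearMap.toLinearMap_smul, map_add, map_smul,
        add_comm]
      congr 1
      exact LinearMap.toMatrix_id b
    rw [h1, h2, hP, ← Polynomial.coe_evalRingHom, RingHom.map_det]
    congr 1
    ext i j
    by_cases hij : i = j <;> (simp [hij]; exact mul_comm _ _)
  have hdeg : P.degree < s.card := by
    refine lt_of_le_of_lt Polynomial.degree_le_natDegree ?_
    refine WithBot.coe_lt_coe.2 (lt_of_le_of_lt (Polynomial.natDegree_det_X_add_C_le B 1) ?_)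
    simpa using hs
  have h := Lagrange.eq_interpolate hv hdeg
  have h' : P.eval 1 = ∑ i ∈ s, P.eval (v i) * (Lagrange.basis s v i).eval 1 := by
    conv_lhs => rw [h]
    rw [Lagrange.interpolate_apply, Polynomial.eval_finsetSum]
    simp
  rw [hev] at h'
  simp only [hev] at h'
  rw [one_smul] at h'
  rw [h']
  exact Finset.sum_congr rfl fun i _ => mul_comm _ _

lemma no_retraction_smooth {E : Type*} [NormedAddCommGroup E] [InnerProductSpace ℝ E]
    [FiniteDimensional ℝ E] [MeasurableSpace E] [BorelSpace E]
    (f : E → E) (hf : ContDiff ℝ 1 f) (h1 : ∀ y, ‖f y‖ = 1)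
    (h2 : ∀ y ∈ sphere (0 : E) 1, f y = y) : False := by
  classical
  set g : E → E := fun y => f y - y with hg
  have hgc : ContDiff ℝ 1 g := hf.sub contDiff_id
  have hgd : ∀ y, HasFDerivAt g (fderiv ℝ g y) y := fun y =>
    (hgc.differentiable (by norm_num)).differentiableAt.hasFDerivAt
  have hfd : ∀ y, HasFDerivAt f (fderiv ℝ f y) y := fun y =>
    (hf.differentiable (by norm_num)).differentiableAt.hasFDerivAt
  have hgcont : Continuous (fderiv ℝ g) := hgc.continuous_fderiv (by norm_num)
  obtain ⟨K, hK⟩ : ∃ K, ∀ y ∈ closedBall (0 : E) 1, ‖fderiv ℝ g y‖ ≤ K :=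
    (isCompact_closedBall (0 : E) 1).exists_bound_of_continuousOn hgcont.continuousOn
  have hK0 : 0 ≤ K := (norm_nonneg _).trans (hK 0 (by simp))
  -- the determinant is positive near the identity
  obtain ⟨r, hr, hdet⟩ : ∃ r > 0, ∀ B : E →L[ℝ] E, ‖B‖ < r → 0 < (ContinuousLinearMap.id ℝ E + B).det := by
    have hc : Continuous fun B : E →L[ℝ] E => (ContinuousLinearMap.id ℝ E + B).det :=
      ContinuousLinearMap.continuous_det.comp (continuous_const.add continuous_id)
    have h0 : 0 < (ContinuousLinearMap.id ℝ E + (0 : E →L[ℝ] E)).det := by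
      rw [add_zero]
      have : (ContinuousLinearMap.id ℝ E).det = 1 := LinearMap.det_id
      rw [this]; norm_num
    have := hc.continuousAt.preimage_mem_nhds (IsOpen.mem_nhds isOpen_Ioi h0)
    obtain ⟨r, hr, h⟩ := Metric.mem_nhds_iff.1 this
    exact ⟨r, hr, fun B hB => h (by simpa using hB)⟩
  -- for small `t`
  have key : ∀ t : ℝ, 0 < t → t < 1 → t * K < r → t * K < 1 →
      ∫ y in ball (0 : E) 1, (ContinuousLinearMap.id ℝ E + t • fderiv ℝ g y).det =
        (MeasureTheory.volume : MeasureTheory.Measure E).real (ball (0 : E) 1) := by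
    intro t ht0 ht1 htr htK
    set F : E → E := fun y => y + t • g y with hF
    have hFd : ∀ y, HasFDerivAt F (ContinuousLinearMap.id ℝ E + t • fderiv ℝ g y) y := fun y =>
      (hasFDerivAt_id y).add ((hgd y).const_smul t)
    have hFc : ContDiff ℝ 1 F := contDiff_id.add (contDiff_const.smul hgc)
    have hpos : ∀ y ∈ closedBall (0 : E) 1, 0 < (ContinuousLinearMap.id ℝ E + t • fderiv ℝ g y).det := by
      intro y hy
      apply hdet
      rw [norm_smul, Real.norm_of_nonneg ht0.le]
      exact lt_of_le_of_lt (mul_le_mul_of_nonneg_left (hK y hy) ht0.le) htr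
    have hlip : ∀ y ∈ closedBall (0 : E) 1, ∀ y' ∈ closedBall (0 : E) 1, ‖g y - g y'‖ ≤ K * ‖y - y'‖ := by
      intro y hy y' hy'
      exact (convex_closedBall (0 : E) 1).norm_image_sub_le_of_norm_hasFDerivWithin_le
        (fun z _ => (hgd z).hasFDerivWithinAt) hK hy' hy
    have hinj : InjOn F (closedBall (0 : E) 1) := by
      intro y hy y' hy' h
      by_contra hne
      have hne' : 0 < ‖y - y'‖ := norm_pos_iff.2 (sub_ne_zero.2 hne)
      have e : y - y' = t • (g y' - g y) := by
        simp only [hF] at h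
        rw [smul_sub]
        have : y = y' + t • g y' - t • g y := by rw [← h]; abel
        nth_rw 1 [this]; abel
      have : ‖y - y'‖ ≤ t * (K * ‖y - y'‖) := by
        calc ‖y - y'‖ = t * ‖g y' - g y‖ := by
              conv_lhs => rw [e]
              rw [norm_smul, Real.norm_of_nonneg ht0.le]
          _ ≤ _ := by
              rw [norm_sub_rev y y']
              exact mul_le_mul_of_nonneg_left (hlip y' hy' y hy) ht0.le
      nlinarith
    have himg : F '' ball (0 : E) 1 = ball (0 : E) 1 := by
      have hsub : F '' ball (0 : E) 1 ⊆ ball (0 : E) 1 := by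
        rintro _ ⟨y, hy, rfl⟩
        rw [mem_ball_zero_iff] at hy ⊢
        have : F y = (1 - t) • y + t • f y := by
          simp only [hF, hg, smul_sub, sub_smul, one_smul]; abel
        rw [this]
        calc ‖(1 - t) • y + t • f y‖ ≤ ‖(1 - t) • y‖ + ‖t • f y‖ := norm_add_le _ _
          _ = (1 - t) * ‖y‖ + t := by
            rw [norm_smul, norm_smul, h1, Real.norm_of_nonneg ht0.le,
              Real.norm_of_nonneg (by linarith), mul_one]
          _ < 1 := by nlinarith
      have hopen : IsOpen (F '' ball (0 : E) 1) := by
        rw [isOpen_iff_mem_nhds]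
        rintro _ ⟨y, hy, rfl⟩
        have hs : HasStrictFDerivAt F (ContinuousLinearMap.id ℝ E + t • fderiv ℝ g y) y :=
          (hFc.contDiffAt).hasStrictFDerivAt' (hFd y) (by norm_num)
        have hd := hpos y (ball_subset_closedBall hy)
        have hunit := LinearMap.range_eq_top.2 (LinearEquiv.ofIsUnitDet
          (v := Module.finBasis ℝ E) (v' := Module.finBasis ℝ E)
          (f := ((ContinuousLinearMap.id ℝ E + t • fderiv ℝ g y : E →L[ℝ] E) : E →ₗ[ℝ] E))
          (by rw [LinearMap.det_toMatrix]; exact (ne_of_gt hd).isUnit)).surjective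
        have hm := hs.map_nhds_eq_of_surj hunit
        rw [← hm]
        exact Filter.image_mem_map (isOpen_ball.mem_nhds hy)
      have hclosed : F '' ball (0 : E) 1 = F '' closedBall (0 : E) 1 ∩ ball (0 : E) 1 := by
        ext w
        constructor
        · intro hw
          exact ⟨image_mono ball_subset_closedBall hw, hsub hw⟩
        · rintro ⟨⟨y, hy, rfl⟩, hw⟩
          refine ⟨y, ?_, rfl⟩
          rw [mem_closedBall_zero_iff] at hy
          rcases hy.lt_or_eq with h | h
          · exact mem_ball_zero_iff.2 h
          · exfalso
            have : F y = y := by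
              simp [hF, hg, h2 y (by simpa using h)]
            rw [this, mem_ball_zero_iff, h] at hw
            exact lt_irrefl _ hw
      have hcomp : IsClosed (F '' closedBall (0 : E) 1) :=
        ((isCompact_closedBall (0 : E) 1).image hFc.continuous).isClosed
      refine hsub.antisymm ?_
      have hpre : IsPreconnected (ball (0 : E) 1) := (convex_ball (0 : E) 1).isPreconnected
      intro w hw
      by_contra hwn
      have := hpre _ _ hopen hcomp.isOpen_compl (by
        intro a ha
        by_cases h : a ∈ F '' ball (0 : E) 1
        · exact Or.inl h
        · right
          intro h'
          exact h (hclosed ▸ ⟨h', ha⟩))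
        ⟨F 0, hsub ⟨0, by simp, rfl⟩, ⟨0, by simp, rfl⟩⟩
        ⟨w, hw, fun h' => hwn (hclosed ▸ ⟨h', hw⟩)⟩
      obtain ⟨a, -, ha1, ha2⟩ := this
      exact ha2 (image_mono ball_subset_closedBall ha1)
    have hcv := MeasureTheory.integral_image_eq_integral_abs_det_fderiv_smul
      (MeasureTheory.volume : MeasureTheory.Measure E) (s := ball (0 : E) 1)
      measurableSet_ball (fun y _ => (hFd y).hasFDerivWithinAt)
      (hinj.mono ball_subset_closedBall) (fun _ => (1 : ℝ))
    rw [himg] at hcv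
    rw [MeasureTheory.setIntegral_const, smul_eq_mul, mul_one] at hcv
    rw [hcv]
    refine MeasureTheory.setIntegral_congr_fun measurableSet_ball fun y hy => ?_
    simp only [smul_eq_mul, mul_one]
    rw [abs_of_pos (hpos y (ball_subset_closedBall hy))]
  -- choose nodes
  set s := Finset.range (Module.finrank ℝ E + 1)
  obtain ⟨τ, hτ0, hτ1, hτ⟩ : ∃ τ : ℝ, 0 < τ ∧ τ < 1 ∧ τ * K < min r 1 := by
    refine ⟨min (1/2) (min r 1 / (2 * (K + 1))), by positivity, lt_of_le_of_lt (min_le_left _ _) (by norm_num), ?_⟩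
    have h := min_le_right (1/2 : ℝ) (min r 1 / (2 * (K + 1)))
    have hm : 0 < min r 1 := by positivity
    calc _ ≤ min r 1 / (2 * (K + 1)) * K := mul_le_mul_of_nonneg_right h hK0
      _ < min r 1 := by
        rw [div_mul_eq_mul_div, div_lt_iff₀ (by positivity)]
        nlinarith
  set v : ℕ → ℝ := fun i => τ / (i + 1) with hv
  have hvinj : InjOn v s := by
    intro i _ j _ h
    simp only [hv] at h
    rw [div_eq_div_iff (by positivity) (by positivity)] at h
    have := mul_left_cancel₀ hτ0.ne' h
    have h3 : (j : ℝ) = i := by linarith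
    exact_mod_cast h3.symm
  obtain ⟨c, hc⟩ := det_interp (E := E) s v hvinj (by simp [s])
  have hvle : ∀ i, 0 < v i ∧ v i ≤ τ := fun i =>
    ⟨by simp only [hv]; positivity, div_le_self hτ0.le (by simp)⟩
  have hkey : ∀ i, ∫ y in ball (0 : E) 1, (ContinuousLinearMap.id ℝ E + v i • fderiv ℝ g y).det =
        (MeasureTheory.volume : MeasureTheory.Measure E).real (ball (0 : E) 1) := fun i => by
    have h3 : v i * K ≤ τ * K := mul_le_mul_of_nonneg_right (hvle i).2 hK0
    exact key (v i) (hvle i).1 (lt_of_le_of_lt (hvle i).2 hτ1)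
      (lt_of_le_of_lt h3 (hτ.trans_le (min_le_left _ _)))
      (lt_of_le_of_lt h3 (hτ.trans_le (min_le_right _ _)))
  have hIntOn : ∀ t : ℝ, MeasureTheory.IntegrableOn (fun y => (ContinuousLinearMap.id ℝ E + t • fderiv ℝ g y).det)
      (ball (0 : E) 1) := by
    intro t
    have : Continuous fun y => (ContinuousLinearMap.id ℝ E + t • fderiv ℝ g y).det :=
      ContinuousLinearMap.continuous_det.comp (continuous_const.add (hgcont.const_smul t))
    exact (this.continuousOn.integrableOn_compact (isCompact_closedBall (0 : E) 1)).mono_set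
      ball_subset_closedBall
  have hsum : ∑ i ∈ s, c i = 1 := by
    have := hc 0
    simp only [smul_zero, add_zero] at this
    have hid : (ContinuousLinearMap.id ℝ E).det = 1 := LinearMap.det_id
    rw [hid] at this
    simpa using this.symm
  have hfinal : ∫ y in ball (0 : E) 1, (ContinuousLinearMap.id ℝ E + fderiv ℝ g y).det =
      (MeasureTheory.volume : MeasureTheory.Measure E).real (ball (0 : E) 1) := by
    rw [MeasureTheory.integral_congr_ae (Filter.Eventually.of_forall fun y => hc (fderiv ℝ g y))]
    rw [MeasureTheory.integral_finsetSum _ (fun i _ => (hIntOn (v i)).const_mul _)]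
    simp_rw [MeasureTheory.integral_const_mul, hkey]
    rw [← Finset.sum_mul, hsum, one_mul]
  have hzero : ∀ y, (ContinuousLinearMap.id ℝ E + fderiv ℝ g y).det = 0 := by
    intro y
    have e : ContinuousLinearMap.id ℝ E + fderiv ℝ g y = fderiv ℝ f y := by
      have : HasFDerivAt g (fderiv ℝ f y - ContinuousLinearMap.id ℝ E) y := (hfd y).sub (hasFDerivAt_id y)
      rw [this.fderiv]; abel
    rw [e]
    by_contra hne
    have hsurj : Function.Surjective (fderiv ℝ f y) := (LinearEquiv.ofIsUnitDet
          (v := Module.finBasis ℝ E) (v' := Module.finBasis ℝ E)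
          (f := ((fderiv ℝ f y : E →L[ℝ] E) : E →ₗ[ℝ] E))
          (by rw [LinearMap.det_toMatrix]; exact (Ne.isUnit hne))).surjective
    obtain ⟨w, hw⟩ := hsurj (f y)
    have hd := (hfd y).norm_sq
    have hconst : (fun z => ‖f z‖ ^ 2) = fun _ => (1 : ℝ) := by
      funext z; rw [h1]; norm_num
    rw [hconst] at hd
    have h0 := hd.unique (hasFDerivAt_const (1 : ℝ) y)
    have := congrArg (fun A : E →L[ℝ] ℝ => A w) h0
    simp [hw, h1] at this
  simp_rw [hzero] at hfinal
  rw [MeasureTheory.integral_zero] at hfinal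
  have hp : 0 < (MeasureTheory.volume : MeasureTheory.Measure E).real (ball (0 : E) 1) :=
    ENNReal.toReal_pos (measure_ball_pos _ _ one_pos).ne' MeasureTheory.measure_ball_lt_top.ne
  exact hp.ne hfinal

lemma no_retraction_euclid {E : Type*} [NormedAddCommGroup E] [InnerProductSpace ℝ E]
    [FiniteDimensional ℝ E]
    (R : E → E) (hR : Continuous R) (h0 : ∀ y, R y ≠ 0) (r : ℝ)
    (hr : ∀ y, r ≤ ‖y‖ → R y = y) : False := by
  borelize E
  have hr0 : 0 < r := by
    by_contra h
    exact h0 0 (hr 0 (by simpa using h))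
  set L := r + 1
  have hL : 0 < L := by positivity
  obtain ⟨m, hm, hmb⟩ : ∃ m > 0, ∀ y, m ≤ ‖R y‖ := by
    obtain ⟨y0, -, hy0⟩ := (isCompact_closedBall (0 : E) r).exists_isMinOn ⟨0, by simp [hr0.le]⟩
      hR.norm.continuousOn
    refine ⟨min ‖R y0‖ r, lt_min (norm_pos_iff.2 (h0 _)) hr0, fun y => ?_⟩
    by_cases h : ‖y‖ ≤ r
    · exact (min_le_left _ _).trans (hy0 (by simpa using h))
    · push Not at h
      rw [hr y h.le]
      exact (min_le_right _ _).trans h.le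
  obtain ⟨u, hu1, hu2, hu3, -⟩ := Continuous.exists_contDiff_approx_and_eqOn (f := fun y => R y - y)
    (ε := fun _ => m / 2) 1 (hR.sub continuous_id) continuous_const (fun _ => by positivity)
    (S := {y : E | L ≤ ‖y‖}) (U := {y : E | r < ‖y‖}) (isClosed_le continuous_const continuous_norm)
    (by
      rw [IsOpen.mem_nhdsSet (isOpen_lt continuous_const continuous_norm)]
      intro y hy
      exact lt_of_lt_of_le (lt_add_one r) hy)
    (by
      refine (contDiffOn_const (c := (0 : E))).congr fun y hy => ?_
      simp [hr y (le_of_lt hy)])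
  set R1 : E → E := fun y => L⁻¹ • (L • y + u (L • y)) with hR1
  have hR1c : ContDiff ℝ 1 R1 := by
    have h3 : ContDiff ℝ 1 (fun y : E => L • y) := contDiff_const.smul contDiff_id
    have hu1' : ContDiff ℝ 1 u := hu1
    exact contDiff_const.smul (h3.add (hu1'.comp h3))
  have hR1n : ∀ y, R1 y ≠ 0 := by
    intro y h
    simp only [hR1, smul_eq_zero, inv_eq_zero, hL.ne', false_or] at h
    have h3 := hu2 (L • y)
    rw [dist_eq_norm, eq_neg_of_add_eq_zero_right h] at h3
    have e : -(L • y) - (R (L • y) - L • y) = - R (L • y) := by abel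
    rw [e, norm_neg] at h3
    have := hmb (L • y)
    linarith
  refine no_retraction_smooth (fun y => ‖R1 y‖⁻¹ • R1 y) ?_ ?_ ?_
  · exact ((hR1c.norm ℝ hR1n).inv (fun y => norm_ne_zero_iff.2 (hR1n y))).smul hR1c
  · intro y
    rw [norm_smul, norm_inv, norm_norm, inv_mul_cancel₀ (norm_ne_zero_iff.2 (hR1n y))]
  · intro y hy
    rw [mem_sphere_zero_iff_norm] at hy
    have e : R1 y = y := by
      have h3 : ‖L • y‖ = L := by rw [norm_smul, hy, mul_one, Real.norm_of_nonneg hL.le]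
      simp only [hR1]
      rw [hu3 (show L ≤ ‖L • y‖ from h3.ge)]
      simp only
      rw [hr _ (by rw [h3]; simp [L])]
      rw [sub_self, add_zero, inv_smul_smul₀ hL.ne']
    simp only [e, hy, inv_one, one_smul]

lemma no_retraction {T : Type*} [NormedAddCommGroup T] [NormedSpace ℝ T]
    [FiniteDimensional ℝ T]
    (R : T → T) (hR : Continuous R) (h0 : ∀ y, R y ≠ 0) (r : ℝ)
    (hr : ∀ y, r ≤ ‖y‖ → R y = y) : False := by
  set φ : T ≃L[ℝ] EuclideanSpace ℝ (Fin (Module.finrank ℝ T)) := toEuclidean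
  set c := ‖(φ : T →L[ℝ] EuclideanSpace ℝ (Fin (Module.finrank ℝ T)))‖
  refine no_retraction_euclid (fun y => φ (R (φ.symm y)))
    (φ.continuous.comp (hR.comp φ.symm.continuous)) (fun y => ?_) (c * max r 0 + 1) (fun y hy => ?_)
  · simp only [ne_eq, map_eq_zero_iff φ φ.injective]; exact h0 _
  · rw [hr]
    · simp
    · by_contra h
      push Not at h
      have h3 := (φ : T →L[ℝ] EuclideanSpace ℝ (Fin (Module.finrank ℝ T))).le_opNorm (φ.symm y)
      simp only [ContinuousLinearEquiv.coe_coe, ContinuousLinearEquiv.apply_symm_apply] at h3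
      have h4 : c * ‖φ.symm y‖ ≤ c * max r 0 :=
        mul_le_mul_of_nonneg_left (h.le.trans (le_max_left _ _)) (norm_nonneg _)
      change ‖y‖ ≤ c * ‖φ.symm y‖ at h3
      linarith

open Metric Set
/-! ### A degree lemma -/

/-- `φ` on the unit sphere extends to a nonvanishing map of the unit ball. -/
def SphereFill {E T : Type*} [NormedAddCommGroup E] [NormedAddCommGroup T] (φ : E → T) : Prop :=
  ∃ Θ : E → T, ContinuousOn Θ (closedBall 0 1) ∧ (∀ y ∈ closedBall (0 : E) 1, Θ y ≠ 0) ∧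
    ∀ y ∈ sphere (0 : E) 1, Θ y = φ y

lemma sphereFill_homotopy {E T : Type*} [NormedAddCommGroup E] [NormedSpace ℝ E]
    [NormedAddCommGroup T] (h : ℝ × E → T)
    (hc : ContinuousOn h (Icc (0 : ℝ) 1 ×ˢ sphere (0 : E) 1))
    (hn : ∀ t ∈ Icc (0 : ℝ) 1, ∀ y ∈ sphere (0 : E) 1, h (t, y) ≠ 0)
    (h0 : SphereFill (fun y => h (0, y))) : SphereFill (fun y => h (1, y)) := by
  classical
  obtain ⟨Θ, hΘc, hΘn, hΘe⟩ := h0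
  set A := closedBall (0 : E) (1/2)
  set B := {y : E | 1/2 ≤ ‖y‖ ∧ ‖y‖ ≤ 1}
  set k : E → ℝ × E := fun y => (2 * ‖y‖ - 1, ‖y‖⁻¹ • y) with hk
  have hkB : ∀ y ∈ B, k y ∈ Icc (0 : ℝ) 1 ×ˢ sphere (0 : E) 1 := by
    rintro y ⟨h1, h2⟩
    refine ⟨⟨by simp only [hk]; linarith, by simp only [hk]; linarith⟩, ?_⟩
    rw [mem_sphere_zero_iff_norm]
    simp only [hk]
    rw [norm_smul, norm_inv, norm_norm, inv_mul_cancel₀]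
    linarith
  have hkc : ContinuousOn k B := by
    refine ContinuousOn.prodMk (by fun_prop) ?_
    refine ContinuousOn.smul (ContinuousOn.inv₀ (by fun_prop) ?_) continuousOn_id
    rintro y ⟨h1, _⟩ h
    rw [h] at h1; norm_num at h1
  have hBcl : IsClosed B := (isClosed_le continuous_const continuous_norm).inter
    (isClosed_le continuous_norm continuous_const)
  set Ξ : E → T := fun y => if ‖y‖ ≤ 1/2 then Θ ((2 : ℝ) • y) else h (k y) with hΞ
  have hΞA : EqOn Ξ (fun y => Θ ((2 : ℝ) • y)) A := by
    intro y hy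
    have : ‖y‖ ≤ 1/2 := by simpa [A] using hy
    simp only [hΞ]; rw [if_pos this]
  have hΞB : EqOn Ξ (fun y => h (k y)) B := by
    rintro y ⟨h1, h2⟩
    simp only [hΞ]
    split_ifs with h3
    · have h4 : ‖y‖ = 1/2 := le_antisymm h3 h1
      rw [hΘe]
      · simp only [hk, h4]; norm_num
      · rw [mem_sphere_zero_iff_norm, norm_smul, h4]; norm_num
    · rfl
  have h2A : ∀ y ∈ A, (2 : ℝ) • y ∈ closedBall (0 : E) 1 := by
    intro y hy
    have : ‖y‖ ≤ 1/2 := by simpa [A] using hy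
    rw [mem_closedBall_zero_iff, norm_smul]; norm_num; linarith
  have hcov : closedBall (0 : E) 1 ⊆ A ∪ B := by
    intro y hy
    rw [mem_closedBall_zero_iff] at hy
    by_cases h3 : ‖y‖ ≤ 1/2
    · left; simpa [A] using h3
    · right; exact ⟨(not_le.1 h3).le, hy⟩
  refine ⟨Ξ, ?_, ?_, ?_⟩
  · have hA : ContinuousOn Ξ A := (hΘc.comp (by fun_prop) h2A).congr hΞA
    have hB : ContinuousOn Ξ B := (hc.comp hkc hkB).congr hΞB
    exact (hA.union_of_isClosed hB isClosed_closedBall hBcl).mono hcov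
  · intro y hy
    rcases hcov hy with h3 | h3
    · rw [hΞA h3]; exact hΘn _ (h2A y h3)
    · rw [hΞB h3]; exact hn _ (hkB y h3).1 _ (hkB y h3).2
  · intro y hy
    rw [mem_sphere_zero_iff_norm] at hy
    rw [hΞB ⟨by rw [hy]; norm_num, hy.le⟩]
    simp only [hk, hy]; norm_num

lemma sphereFill_embedding {E T : Type*} [NormedAddCommGroup E] [NormedSpace ℝ E]
    [FiniteDimensional ℝ E]
    [NormedAddCommGroup T] [NormedSpace ℝ T] [FiniteDimensional ℝ T]
    (Ψ : OpenPartialHomeomorph E T) (hs : closedBall 0 1 ⊆ Ψ.source) (h0 : Ψ 0 = 0)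
    (h : SphereFill Ψ) : False := by
  classical
  obtain ⟨Θ, hΘc, hΘn, hΘe⟩ := h
  set B1 := Ψ '' closedBall 0 1
  set B2 := (Ψ '' ball 0 1)ᶜ
  have hB1c : IsCompact B1 := (isCompact_closedBall (0 : E) 1).image_of_continuousOn
    (Ψ.continuousOn.mono hs)
  have hB2 : IsClosed B2 :=
    (Ψ.isOpen_image_of_subset_source isOpen_ball (ball_subset_closedBall.trans hs)).isClosed_compl
  set R : T → T := fun w => if w ∈ B1 then Θ (Ψ.symm w) else w with hR
  have hR1 : EqOn R (fun w => Θ (Ψ.symm w)) B1 := fun w hw => by simp only [hR]; rw [if_pos hw]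
  have hR2 : EqOn R id B2 := by
    intro w hw
    simp only [hR]
    split_ifs with h3
    · obtain ⟨y, hy, rfl⟩ := h3
      rw [Ψ.left_inv (hs hy)]
      rw [hΘe]
      · rfl
      · rw [mem_sphere_zero_iff_norm]
        rw [mem_closedBall_zero_iff] at hy
        refine le_antisymm hy (not_lt.1 fun h4 => hw ⟨y, by simpa using h4, rfl⟩)
    · rfl
  have hmap : ∀ w ∈ B1, Ψ.symm w ∈ closedBall (0 : E) 1 := by
    rintro _ ⟨y, hy, rfl⟩
    rwa [Ψ.left_inv (hs hy)]
  have hc : Continuous R := by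
    rw [← continuousOn_univ]
    have c1 : ContinuousOn R B1 := by
      refine (hΘc.comp (Ψ.symm.continuousOn.mono ?_) hmap).congr hR1
      rintro _ ⟨y, hy, rfl⟩
      exact Ψ.map_source (hs hy)
    have c2 : ContinuousOn R B2 := continuousOn_id.congr hR2
    refine (c1.union_of_isClosed c2 hB1c.isClosed hB2).mono ?_
    intro w _
    by_cases h3 : w ∈ Ψ '' ball 0 1
    · exact Or.inl (image_mono ball_subset_closedBall h3)
    · exact Or.inr h3
  obtain ⟨r, hr⟩ := hB1c.isBounded.exists_norm_le
  refine no_retraction R hc (fun w => ?_) (r + 1) (fun w hw => ?_)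
  · by_cases h3 : w ∈ B1
    · rw [hR1 h3]; exact hΘn _ (hmap w h3)
    · simp only [hR]; rw [if_neg h3]
      rintro rfl
      exact h3 ⟨0, by simp, h0⟩
  · simp only [hR]; rw [if_neg]
    intro h3
    have := hr w h3
    linarith

lemma degree_lemma {E₁ E₂ T : Type*} [NormedAddCommGroup E₁] [NormedSpace ℝ E₁]
    [FiniteDimensional ℝ E₁] [NormedAddCommGroup E₂] [NormedSpace ℝ E₂] [FiniteDimensional ℝ E₂]
    [NormedAddCommGroup T] [NormedSpace ℝ T] [FiniteDimensional ℝ T]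
    (Φ : OpenPartialHomeomorph (E₁ × E₂) T) (hΦ : (0 : E₁ × E₂) ∈ Φ.source)
    (c : ℝ) (hc : 0 < c) (F : E₁ × E₂ → T) (hF : ContinuousOn F (closedBall 0 c))
    (hF0 : ∀ y ∈ closedBall (0 : E₁ × E₂) c, F y = 0 → y = 0)
    (hloc : ∃ c1 > 0, ∀ y : E₁ × E₂, ‖y‖ ≤ c1 → F y = Φ (0, y.2) - Φ (y.1, 0))
    (v : T) (hv1 : ∀ y : E₁ × E₂, ‖y‖ = c → ∀ t ∈ Icc (0 : ℝ) 1, F y + t • v ≠ 0)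
    (hv2 : ∀ y : E₁ × E₂, ‖y‖ ≤ c → F y + v ≠ 0) : False := by
  obtain ⟨c0, hc0, hloc⟩ := hloc
  obtain ⟨c2, hc2, hsrc⟩ := Metric.nhds_basis_closedBall.mem_iff.1 (Φ.open_source.mem_nhds hΦ)
  obtain ⟨c1, hc1, h10, h12, h1c⟩ : ∃ c1 > 0, c1 ≤ c0 ∧ c1 ≤ c2 ∧ c1 ≤ c :=
    ⟨min c0 (min c2 c), by positivity, min_le_left _ _, (min_le_right _ _).trans (min_le_left _ _),
      (min_le_right _ _).trans (min_le_right _ _)⟩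
  have hsrc1 : closedBall (0 : E₁ × E₂) c1 ⊆ Φ.source := (closedBall_subset_closedBall h12).trans hsrc
  have hsm : ∀ (s : ℝ), 0 ≤ s → ∀ y : E₁ × E₂, ‖s • y‖ = s * ‖y‖ := fun s hs y => by
    rw [norm_smul, Real.norm_of_nonneg hs]
  -- Step 1
  have s0 : SphereFill (fun y : E₁ × E₂ => F (c • y) + v) := by
    refine ⟨_, ?_, ?_, fun y _ => rfl⟩
    · refine (hF.comp (f := fun y : E₁ × E₂ => c • y) (by fun_prop) ?_).add continuousOn_const
      intro y hy
      rw [mem_closedBall_zero_iff] at hy ⊢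
      rw [hsm c hc.le]; nlinarith
    · intro y hy
      rw [mem_closedBall_zero_iff] at hy
      apply hv2
      rw [hsm c hc.le]; nlinarith
  have s1 : SphereFill (fun y : E₁ × E₂ => F (c • y)) := by
    have := sphereFill_homotopy (fun q : ℝ × (E₁ × E₂) => F (c • q.2) + (1 - q.1) • v) ?_ ?_ (by simpa using s0)
    · simpa using this
    · refine (hF.comp (f := fun q : ℝ × (E₁ × E₂) => c • q.2) (by fun_prop) ?_).add (by fun_prop)
      rintro ⟨t, y⟩ ⟨_, hy⟩
      rw [mem_sphere_zero_iff_norm] at hy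
      simp only at hy
      rw [mem_closedBall_zero_iff, hsm c hc.le, hy, mul_one]
    · intro t ht y hy
      rw [mem_sphere_zero_iff_norm] at hy
      exact hv1 _ (by rw [hsm c hc.le, hy, mul_one]) (1 - t) ⟨by linarith [ht.2], by linarith [ht.1]⟩
  have s2 : SphereFill (fun y : E₁ × E₂ => F (c1 • y)) := by
    have hbd : ∀ t ∈ Icc (0 : ℝ) 1, 0 < (1 - t) * c + t * c1 ∧ (1 - t) * c + t * c1 ≤ c := by
      intro t ht
      have := ht.1; have := ht.2
      constructor
      · rcases eq_or_lt_of_le ht.1 with h | h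
        · rw [← h]; simpa using hc
        · have := mul_pos h hc1
          have := mul_nonneg (sub_nonneg.2 ht.2) hc.le
          linarith
      · nlinarith
    have := sphereFill_homotopy (fun q : ℝ × (E₁ × E₂) => F (((1 - q.1) * c + q.1 * c1) • q.2)) ?_ ?_ (by simpa using s1)
    · simpa using this
    · refine (hF.comp (f := fun q : ℝ × (E₁ × E₂) => ((1 - q.1) * c + q.1 * c1) • q.2) (by fun_prop) ?_)
      rintro ⟨t, y⟩ ⟨ht, hy⟩
      rw [mem_sphere_zero_iff_norm] at hy
      simp only at hy
      rw [mem_closedBall_zero_iff, hsm _ (hbd t ht).1.le, hy, mul_one]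
      exact (hbd t ht).2
    · intro t ht y hy h
      rw [mem_sphere_zero_iff_norm] at hy
      have h3 : ((1 - t) * c + t * c1) • y = 0 := by
        refine hF0 _ ?_ h
        rw [mem_closedBall_zero_iff, hsm _ (hbd t ht).1.le, hy, mul_one]
        exact (hbd t ht).2
      rcases smul_eq_zero.1 h3 with h4 | h4
      · exact (hbd t ht).1.ne' h4
      · rw [h4] at hy; simp at hy
  have hy12 : ∀ y : E₁ × E₂, ‖y‖ = 1 → ‖y.1‖ ≤ 1 ∧ ‖y.2‖ ≤ 1 := fun y hy =>
    ⟨hy ▸ norm_fst_le y, hy ▸ norm_snd_le y⟩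
  have hA : ∀ t ∈ Icc (0 : ℝ) 1, ∀ y : E₁ × E₂, ‖y‖ = 1 →
      ((-(t * c1)) • y.1, c1 • y.2) ∈ Φ.source := by
    intro t ht y hy
    apply hsrc1
    rw [mem_closedBall_zero_iff, Prod.norm_def, max_le_iff]
    have := ht.1; have := ht.2; have := (hy12 y hy).1; have := (hy12 y hy).2
    have h5 : t * c1 ≤ c1 := by nlinarith
    constructor
    · rw [norm_smul, norm_neg, Real.norm_of_nonneg (by positivity)]
      nlinarith [norm_nonneg y.1]
    · rw [norm_smul, Real.norm_of_nonneg hc1.le]; nlinarith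
  have hB : ∀ t ∈ Icc (0 : ℝ) 1, ∀ y : E₁ × E₂, ‖y‖ = 1 →
      ((((1 - t) * c1) • y.1, (0 : E₂)) : E₁ × E₂) ∈ Φ.source := by
    intro t ht y hy
    apply hsrc1
    rw [mem_closedBall_zero_iff, Prod.norm_def, max_le_iff]
    have := ht.1; have := ht.2; have := (hy12 y hy).1
    have h5 : (1 - t) * c1 ≤ c1 := by nlinarith
    constructor
    · rw [norm_smul, Real.norm_of_nonneg (mul_nonneg (by linarith) hc1.le)]
      nlinarith [norm_nonneg y.1]
    · simpa using hc1.le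
  have s3 : SphereFill (fun y : E₁ × E₂ => Φ ((-c1) • y.1, c1 • y.2) - Φ (0, 0)) := by
    have := sphereFill_homotopy (fun q : ℝ × (E₁ × E₂) =>
      Φ ((-(q.1 * c1)) • q.2.1, c1 • q.2.2) - Φ (((1 - q.1) * c1) • q.2.1, 0)) ?_ ?_ ?_
    · simpa using this
    · refine ContinuousOn.sub ?_ ?_
      · refine Φ.continuousOn.comp (f := fun q : ℝ × (E₁ × E₂) => ((-(q.1 * c1)) • q.2.1, c1 • q.2.2))
          (by fun_prop) ?_
        rintro ⟨t, y⟩ ⟨ht, hy⟩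
        exact hA t ht y (by simpa using hy)
      · refine Φ.continuousOn.comp (f := fun q : ℝ × (E₁ × E₂) => (((1 - q.1) * c1) • q.2.1, (0 : E₂)))
          (by fun_prop) ?_
        rintro ⟨t, y⟩ ⟨ht, hy⟩
        exact hB t ht y (by simpa using hy)
    · intro t ht y hy h
      rw [mem_sphere_zero_iff_norm] at hy
      have h3 := Φ.injOn (hA t ht y hy) (hB t ht y hy) (sub_eq_zero.1 h)
      rw [Prod.mk.injEq] at h3
      have h4 : y.2 = 0 := (smul_eq_zero.1 h3.2).resolve_left hc1.ne'
      have h5 : c1 • y.1 = 0 := by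
        have : c1 • y.1 = ((1 - t) * c1) • y.1 - (-(t * c1)) • y.1 := by
          rw [← sub_smul]; congr 1; ring
        rw [this, h3.1, sub_self]
      have h6 : y.1 = 0 := (smul_eq_zero.1 h5).resolve_left hc1.ne'
      have : y = 0 := Prod.ext h6 h4
      rw [this] at hy; simp at hy
    · obtain ⟨Θ, t1, t2, t3⟩ := s2
      refine ⟨Θ, t1, t2, fun y hy => ?_⟩
      rw [t3 y hy]
      rw [mem_sphere_zero_iff_norm] at hy
      simp only
      rw [hloc _ (by rw [hsm _ hc1.le, hy, mul_one]; exact h10)]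
      simp
  -- final
  let A : (E₁ × E₂) ≃ₜ (E₁ × E₂) :=
    (Homeomorph.smulOfNeZero (-c1) (neg_ne_zero.2 hc1.ne')).prodCongr (Homeomorph.smulOfNeZero c1 hc1.ne')
  let Ψ : OpenPartialHomeomorph (E₁ × E₂) T :=
    A.toOpenPartialHomeomorph.trans (Φ.trans (Homeomorph.subRight (Φ (0, 0))).toOpenPartialHomeomorph)
  have hΨ : ∀ y, Ψ y = Φ ((-c1) • y.1, c1 • y.2) - Φ (0, 0) := fun y => rfl
  refine sphereFill_embedding Ψ ?_ ?_ ?_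
  · intro y hy
    have hy' : ‖y‖ ≤ 1 := by simpa using hy
    simp only [Ψ, OpenPartialHomeomorph.trans_source, Homeomorph.toOpenPartialHomeomorph_source,
      univ_inter, preimage_univ, inter_univ]
    refine hsrc1 ?_
    change (((-c1) • y.1, c1 • y.2) : E₁ × E₂) ∈ _
    rw [mem_closedBall_zero_iff, Prod.norm_def, max_le_iff]
    have := norm_fst_le y; have := norm_snd_le y
    constructor
    · rw [norm_smul, norm_neg, Real.norm_of_nonneg hc1.le]; nlinarith
    · rw [norm_smul, Real.norm_of_nonneg hc1.le]; nlinarith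
  · rw [hΨ]; simp
  · obtain ⟨Θ, t1, t2, t3⟩ := s3
    exact ⟨Θ, t1, t2, fun y hy => by rw [t3 y hy, hΨ]⟩

open Metric Set
/-! ### Iterates and expansivity -/

/-- The iterate as a homeomorphism. -/
def itH {M : Type*} [MetricSpace M] (f : M ≃ₜ M) (k : ℤ) : M ≃ₜ M := f ^ k

lemma pow_toEquiv {M : Type*} [MetricSpace M] (f : M ≃ₜ M) (l : ℕ) :
    (f ^ l).toEquiv = f.toEquiv ^ l := by
  induction l with
  | zero => rfl
  | succ l ih => rw [pow_succ, pow_succ, ← ih]; rfl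

lemma itH_apply {M : Type*} [MetricSpace M] (f : M ≃ₜ M) (k : ℤ) (x : M) :
    itH f k x = iterZ f k x := by
  unfold itH iterZ
  have : (f ^ k).toEquiv = f.toEquiv ^ k := by
    cases k with
    | ofNat l => simpa using pow_toEquiv f l
    | negSucc l =>
      rw [zpow_negSucc, zpow_negSucc, ← pow_toEquiv]; rfl
  rw [← this]; rfl

lemma iterZ_zero {M : Type*} [MetricSpace M] (f : M ≃ₜ M) (x : M) : iterZ f 0 x = x := by
  simp [iterZ]

lemma iterZ_add {M : Type*} [MetricSpace M] (f : M ≃ₜ M) (a b : ℤ) (x : M) :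
    iterZ f (a + b) x = iterZ f a (iterZ f b x) := by
  simp [iterZ, zpow_add]

lemma iterZ_natCast {M : Type*} [MetricSpace M] (f : M ≃ₜ M) (l : ℕ) (x : M) :
    iterZ f l x = (f.toEquiv ^ l) x := by
  simp [iterZ]

lemma iterZ_neg_cancel {M : Type*} [MetricSpace M] (f : M ≃ₜ M) (a : ℤ) (x : M) :
    iterZ f (-a) (iterZ f a x) = x := by
  rw [← iterZ_add]; simp [iterZ_zero]

lemma iterZ_cancel_neg {M : Type*} [MetricSpace M] (f : M ≃ₜ M) (a : ℤ) (x : M) :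
    iterZ f a (iterZ f (-a) x) = x := by
  rw [← iterZ_add]; simp [iterZ_zero]

lemma iterZ_continuous {M : Type*} [MetricSpace M] (f : M ≃ₜ M) (k : ℤ) :
    Continuous (iterZ f k) := by
  have : iterZ f k = itH f k := by funext x; rw [itH_apply]
  rw [this]; exact (itH f k).continuous

lemma iterZ_symm {M : Type*} [MetricSpace M] (f : M ≃ₜ M) (k : ℤ) (x : M) :
    iterZ f.symm k x = iterZ f (-k) x := by
  rw [← itH_apply, ← itH_apply]
  unfold itH
  have : f.symm = f⁻¹ := rfl
  rw [this, inv_zpow, zpow_neg]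

lemma iterZ_isOpen_image {M : Type*} [MetricSpace M] (f : M ≃ₜ M) (k : ℤ) {U : Set M}
    (h : IsOpen U) : IsOpen (iterZ f k ⁻¹' U) := h.preimage (iterZ_continuous f k)

/-- `p` has period `l`: general multiples. -/
lemma iterZ_period {M : Type*} [MetricSpace M] (f : M ≃ₜ M) {l : ℤ} {p : M}
    (hp : iterZ f l p = p) (j : ℤ) : iterZ f (j * l) p = p := by
  have hpos : ∀ j : ℕ, iterZ f ((j : ℤ) * l) p = p := by
    intro j
    induction j with
    | zero => simp [iterZ_zero]
    | succ j ih =>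
      have : ((j + 1 : ℕ) : ℤ) * l = j * l + l := by push_cast; ring
      rw [this, iterZ_add, hp, ih]
  cases j with
  | ofNat j => exact hpos j
  | negSucc j =>
    have h := hpos (j + 1)
    have e : Int.negSucc j * l = -(((j + 1 : ℕ) : ℤ) * l) := by
      rw [Int.negSucc_eq]; push_cast; ring
    rw [e]
    conv_lhs => rw [← h]
    rw [iterZ_neg_cancel]

lemma WsLoc_symm_homeo {M : Type*} [MetricSpace M] (f : M ≃ₜ M) (ε : ℝ) (x : M) :
    WsLoc f.symm ε x = WuLoc f ε x := by
  ext y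
  simp only [WsLoc, WuLoc, mem_ofPred_eq, iterZ_symm]
  exact ⟨fun h k hk => by simpa using h (-k) (by omega), fun h k hk => h (-k) (by omega)⟩

lemma WuLoc_symm_homeo {M : Type*} [MetricSpace M] (f : M ≃ₜ M) (ε : ℝ) (x : M) :
    WuLoc f.symm ε x = WsLoc f ε x := by
  ext y
  simp only [WsLoc, WuLoc, mem_ofPred_eq, iterZ_symm]
  exact ⟨fun h k hk => by simpa using h (-k) (by omega), fun h k hk => h (-k) (by omega)⟩

lemma Ws_symm_homeo {M : Type*} [MetricSpace M] (f : M ≃ₜ M) (x : M) :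
    Ws f.symm x = Wu f x := by
  ext y
  simp only [Ws, Wu, mem_ofPred_eq, iterZ_symm]
  constructor
  · intro h
    have := h.comp Filter.tendsto_neg_atBot_atTop
    simpa [Function.comp_def] using this
  · intro h
    exact h.comp Filter.tendsto_neg_atTop_atBot

lemma IsExpansive.symm {M : Type*} [MetricSpace M] {f : M ≃ₜ M} {α : ℝ} (h : IsExpansive f α) :
    IsExpansive f.symm α := by
  intro x y hxy
  obtain ⟨k, hk⟩ := h x y hxy
  exact ⟨-k, by simpa [iterZ_symm] using hk⟩

lemma WsLoc_mono {M : Type*} [MetricSpace M] {f : M ≃ₜ M} {a b : ℝ} (h : a ≤ b) (x : M) :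
    WsLoc f a x ⊆ WsLoc f b x := fun _ hy k hk => (hy k hk).trans h

lemma WuLoc_mono {M : Type*} [MetricSpace M] {f : M ≃ₜ M} {a b : ℝ} (h : a ≤ b) (x : M) :
    WuLoc f a x ⊆ WuLoc f b x := fun _ hy k hk => (hy k hk).trans h

lemma WsLoc_comm {M : Type*} [MetricSpace M] {f : M ≃ₜ M} {a : ℝ} {x y : M}
    (h : y ∈ WsLoc f a x) : x ∈ WsLoc f a y := fun k hk => by rw [dist_comm]; exact h k hk

lemma WuLoc_comm {M : Type*} [MetricSpace M] {f : M ≃ₜ M} {a : ℝ} {x y : M}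
    (h : y ∈ WuLoc f a x) : x ∈ WuLoc f a y := fun k hk => by rw [dist_comm]; exact h k hk

lemma WsLoc_tri {M : Type*} [MetricSpace M] {f : M ≃ₜ M} {a b : ℝ} {x y z : M}
    (h : y ∈ WsLoc f a x) (h' : z ∈ WsLoc f b y) : z ∈ WsLoc f (a + b) x := fun k hk =>
  (dist_triangle _ _ _).trans (add_le_add (h k hk) (h' k hk))

lemma WuLoc_tri {M : Type*} [MetricSpace M] {f : M ≃ₜ M} {a b : ℝ} {x y z : M}
    (h : y ∈ WuLoc f a x) (h' : z ∈ WuLoc f b y) : z ∈ WuLoc f (a + b) x := fun k hk =>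
  (dist_triangle _ _ _).trans (add_le_add (h k hk) (h' k hk))

lemma WsLoc_dist {M : Type*} [MetricSpace M] {f : M ≃ₜ M} {a : ℝ} {x y : M}
    (h : y ∈ WsLoc f a x) : dist x y ≤ a := by simpa [iterZ_zero] using h 0 le_rfl

lemma isClosed_WsLoc {M : Type*} [MetricSpace M] (f : M ≃ₜ M) (a : ℝ) :
    IsClosed {q : M × M | q.2 ∈ WsLoc f a q.1} := by
  change IsClosed {q : M × M | ∀ k : ℤ, 0 ≤ k → dist (iterZ f k q.1) (iterZ f k q.2) ≤ a}
  simp only [ofPred_forall]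
  refine isClosed_iInter fun k => isClosed_iInter fun _ => ?_
  exact isClosed_le (((iterZ_continuous f k).comp continuous_fst).dist
    ((iterZ_continuous f k).comp continuous_snd)) continuous_const

lemma isClosed_WuLoc {M : Type*} [MetricSpace M] (f : M ≃ₜ M) (a : ℝ) :
    IsClosed {q : M × M | q.2 ∈ WuLoc f a q.1} := by
  change IsClosed {q : M × M | ∀ k : ℤ, k ≤ 0 → dist (iterZ f k q.1) (iterZ f k q.2) ≤ a}
  simp only [ofPred_forall]
  refine isClosed_iInter fun k => isClosed_iInter fun _ => ?_
  exact isClosed_le (((iterZ_continuous f k).comp continuous_fst).dist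
    ((iterZ_continuous f k).comp continuous_snd)) continuous_const

lemma WsLoc_lim {M : Type*} [MetricSpace M] {f : M ≃ₜ M} {a : ℝ} {ι : Type*} {F : Filter ι}
    [F.NeBot] {u v : ι → M} {x y : M} (hu : Filter.Tendsto u F (nhds x))
    (hv : Filter.Tendsto v F (nhds y)) (h : ∀ i, v i ∈ WsLoc f a (u i)) : y ∈ WsLoc f a x :=
  (isClosed_WsLoc f a).mem_of_tendsto (hu.prodMk_nhds hv) (Filter.Eventually.of_forall h)

lemma WuLoc_lim {M : Type*} [MetricSpace M] {f : M ≃ₜ M} {a : ℝ} {ι : Type*} {F : Filter ι}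
    [F.NeBot] {u v : ι → M} {x y : M} (hu : Filter.Tendsto u F (nhds x))
    (hv : Filter.Tendsto v F (nhds y)) (h : ∀ i, v i ∈ WuLoc f a (u i)) : y ∈ WuLoc f a x :=
  (isClosed_WuLoc f a).mem_of_tendsto (hu.prodMk_nhds hv) (Filter.Eventually.of_forall h)

lemma IsExpansive.eq {M : Type*} [MetricSpace M] {f : M ≃ₜ M} {α : ℝ} (h : IsExpansive f α)
    {a b : ℝ} (ha : a ≤ α) (hb : b ≤ α) {x y : M} (h1 : y ∈ WsLoc f a x) (h2 : y ∈ WuLoc f b x) :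
    x = y := by
  by_contra hne
  obtain ⟨k, hk⟩ := h x y hne
  rcases le_total 0 k with h3 | h3
  · exact absurd ((h1 k h3).trans ha) (not_le.2 hk)
  · exact absurd ((h2 k h3).trans hb) (not_le.2 hk)

lemma IsExpansive.periodic_eq {M : Type*} [MetricSpace M] {f : M ≃ₜ M} {α : ℝ}
    (h : IsExpansive f α) {x y : M} {l m : ℕ} (hl : 1 ≤ l) (hm : 1 ≤ m)
    (hx : iterZ f l x = x) (hy : iterZ f m y = y) (hxy : y ∈ WsLoc f α x) : x = y := by
  refine h.eq le_rfl le_rfl hxy ?_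
  intro k hk
  have e1 := iterZ_period f hx (-k * m)
  have e2 := iterZ_period f hy (-k * l)
  have h3 := hxy (k + -k * m * l) (by
    have h1 : (1 : ℤ) ≤ (m : ℤ) * l := by exact_mod_cast Nat.one_le_iff_ne_zero.2 (by positivity)
    nlinarith)
  rw [iterZ_add, e1] at h3
  have : -k * m * l = -k * l * m := by ring
  rwa [this, iterZ_add, e2] at h3

lemma iterZ_unif {M : Type*} [MetricSpace M] [CompactSpace M] (f : M ≃ₜ M) (N : ℕ) {θ : ℝ}
    (hθ : 0 < θ) : ∃ γ > 0, ∀ y y' : M, dist y y' < γ → ∀ k : ℤ, |k| ≤ N →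
      dist (iterZ f k y) (iterZ f k y') < θ := by
  have h1 : ∀ k : ℤ, ∃ γ > 0, ∀ y y' : M, dist y y' < γ → dist (iterZ f k y) (iterZ f k y') < θ := by
    intro k
    have := CompactSpace.uniformContinuous_of_continuous (iterZ_continuous f k)
    rw [Metric.uniformContinuous_iff] at this
    obtain ⟨γ, h, h'⟩ := this θ hθ
    exact ⟨γ, h, fun y y' hy => h' hy⟩
  choose γ hγ hγ' using h1
  have hne : (Finset.Icc (-(N : ℤ)) N).Nonempty := ⟨0, by simp⟩
  refine ⟨(Finset.Icc (-(N : ℤ)) N).inf' hne γ, ?_, ?_⟩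
  · rw [gt_iff_lt, Finset.lt_inf'_iff]; exact fun k _ => hγ k
  · intro y y' hy k hk
    refine hγ' k y y' (lt_of_lt_of_le hy (Finset.inf'_le _ ?_))
    rw [Finset.mem_Icc]; exact abs_le.1 hk

lemma IsExpansive.unif {M : Type*} [MetricSpace M] [CompactSpace M] {f : M ≃ₜ M} {α : ℝ}
    (h : IsExpansive f α) {θ : ℝ} (hθ : 0 < θ) : ∃ N : ℕ, ∀ y y' : M,
      (∀ k : ℤ, |k| ≤ N → dist (iterZ f k y) (iterZ f k y') ≤ α) → dist y y' < θ := by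
  by_contra hcon
  push Not at hcon
  let K : ℕ → Set (M × M) := fun N => {q | θ ≤ dist q.1 q.2 ∧ ∀ k : ℤ, |k| ≤ N →
    dist (iterZ f k q.1) (iterZ f k q.2) ≤ α}
  have hcl : ∀ N, IsClosed (K N) := by
    intro N
    refine (isClosed_le continuous_const continuous_dist).inter ?_
    change IsClosed {q : M × M | ∀ k : ℤ, |k| ≤ N → dist (iterZ f k q.1) (iterZ f k q.2) ≤ α}
    simp only [ofPred_forall]
    refine isClosed_iInter fun k => isClosed_iInter fun _ => ?_
    exact isClosed_le (((iterZ_continuous f k).comp continuous_fst).dist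
      ((iterZ_continuous f k).comp continuous_snd)) continuous_const
  obtain ⟨q, hq⟩ := IsCompact.nonempty_iInter_of_sequence_nonempty_isCompact_isClosed K
    (fun N q hq => ⟨hq.1, fun k hk => hq.2 k (hk.trans (by push_cast; linarith))⟩)
    (fun N => by
      obtain ⟨y, y', h1, h2⟩ := hcon N
      exact ⟨(y, y'), h2, h1⟩) (hcl 0).isCompact hcl
  rw [mem_iInter] at hq
  have h1 : q.1 ≠ q.2 := by
    intro h2
    have := (hq 0).1
    rw [h2, dist_self] at this
    linarith
  obtain ⟨k, hk⟩ := h _ _ h1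
  have := (hq k.natAbs).2 k (by simp)
  linarith

lemma IsExpansive.unif_s {M : Type*} [MetricSpace M] [CompactSpace M] {f : M ≃ₜ M} {α : ℝ}
    (h : IsExpansive f α) {θ : ℝ} (hθ : 0 < θ) : ∃ N : ℕ, ∀ y y' : M, y' ∈ WsLoc f α y →
      ∀ k : ℤ, N ≤ k → dist (iterZ f k y) (iterZ f k y') < θ := by
  obtain ⟨N, hN⟩ := h.unif hθ
  refine ⟨N, fun y y' hy k hk => hN _ _ fun j hj => ?_⟩
  rw [← iterZ_add, ← iterZ_add]
  refine hy _ ?_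
  have := (abs_le.1 hj).1
  linarith

lemma IsExpansive.local_s {M : Type*} [MetricSpace M] [CompactSpace M] {f : M ≃ₜ M} {α : ℝ}
    (h : IsExpansive f α) {θ : ℝ} (hθ : 0 < θ) : ∃ γ > 0, ∀ y y' : M, y' ∈ WsLoc f α y →
      dist y y' < γ → y' ∈ WsLoc f θ y := by
  obtain ⟨N, hN⟩ := h.unif_s hθ
  obtain ⟨γ, hγ, hγ'⟩ := iterZ_unif f N hθ
  refine ⟨γ, hγ, fun y y' hy hd k hk => ?_⟩
  rcases le_total (N : ℤ) k with h1 | h1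
  · exact (hN y y' hy k h1).le
  · exact (hγ' y y' hd k (by rwa [abs_of_nonneg hk])).le

lemma IsExpansive.local_u {M : Type*} [MetricSpace M] [CompactSpace M] {f : M ≃ₜ M} {α : ℝ}
    (h : IsExpansive f α) {θ : ℝ} (hθ : 0 < θ) : ∃ γ > 0, ∀ y y' : M, y' ∈ WuLoc f α y →
      dist y y' < γ → y' ∈ WuLoc f θ y := by
  have := h.symm.local_s hθ
  simpa only [WsLoc_symm_homeo] using this

lemma IsExpansive.WsLoc_subset {M : Type*} [MetricSpace M] [CompactSpace M] {f : M ≃ₜ M} {α : ℝ}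
    (h : IsExpansive f α) (y : M) : WsLoc f α y ⊆ Ws f y := by
  intro y' hy
  change Filter.Tendsto _ _ _
  rw [Metric.tendsto_atTop]
  intro θ hθ
  obtain ⟨N, hN⟩ := h.unif_s hθ
  refine ⟨N, fun k hk => ?_⟩
  rw [Real.dist_0_eq_abs, abs_of_nonneg dist_nonneg]
  exact hN y y' hy k hk

lemma Ws_of_mul {M : Type*} [MetricSpace M] [CompactSpace M] (f : M ≃ₜ M) {l : ℕ} (hl : 1 ≤ l)
    {y y' : M} (h : Filter.Tendsto (fun j : ℕ => dist (iterZ f (j * l) y) (iterZ f (j * l) y'))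
      Filter.atTop (nhds 0)) : y' ∈ Ws f y := by
  change Filter.Tendsto _ _ _
  rw [Metric.tendsto_atTop] at h ⊢
  intro θ hθ
  obtain ⟨γ, hγ, hγ'⟩ := iterZ_unif f l hθ
  obtain ⟨J, hJ⟩ := h γ hγ
  refine ⟨J * l, fun k hk => ?_⟩
  have hl' : (0 : ℤ) < l := by exact_mod_cast hl
  have h1 : (J : ℤ) ≤ k / l := by rwa [Int.le_ediv_iff_mul_le hl']
  have h2 := hJ (k / l).toNat (by omega)
  rw [Real.dist_0_eq_abs, abs_of_nonneg dist_nonneg] at h2 ⊢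
  have h3 : ((k / l).toNat : ℤ) = k / l := Int.toNat_of_nonneg (by omega)
  rw [h3] at h2
  have h4 := hγ' _ _ h2 (k % l) (by
    rw [abs_of_nonneg (Int.emod_nonneg _ hl'.ne')]; exact (Int.emod_lt_of_pos _ hl').le)
  rw [← iterZ_add, ← iterZ_add] at h4
  have e : k % l + k / l * l = k := by rw [mul_comm]; exact Int.emod_add_mul_ediv k l
  rwa [e] at h4

lemma Ws_trans {M : Type*} [MetricSpace M] {f : M ≃ₜ M} {x y z : M}
    (h : y ∈ Ws f x) (h' : z ∈ Ws f y) : z ∈ Ws f x := by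
  change Filter.Tendsto _ _ _ at h h' ⊢
  refine squeeze_zero (fun _ => dist_nonneg) (fun k => dist_triangle _ (iterZ f k y) _) ?_
  simpa using h.add h'

lemma Ws_comm {M : Type*} [MetricSpace M] {f : M ≃ₜ M} {x y : M}
    (h : y ∈ Ws f x) : x ∈ Ws f y := by
  change Filter.Tendsto _ _ _ at h ⊢
  simpa [dist_comm] using h

lemma Ws_refl {M : Type*} [MetricSpace M] (f : M ≃ₜ M) (x : M) : x ∈ Ws f x := by
  change Filter.Tendsto _ _ _
  simp

lemma WsLoc_refl {M : Type*} [MetricSpace M] (f : M ≃ₜ M) {a : ℝ} (ha : 0 ≤ a) (x : M) :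
    x ∈ WsLoc f a x := fun k _ => by simpa using ha

lemma WuLoc_refl {M : Type*} [MetricSpace M] (f : M ≃ₜ M) {a : ℝ} (ha : 0 ≤ a) (x : M) :
    x ∈ WuLoc f a x := fun k _ => by simpa using ha

open Metric Set
/-! ### Hyperbolic charts -/

/-- A hyperbolic box around a periodic point. -/
structure HypBox {M : Type*} [MetricSpace M] (f : M ≃ₜ M) (E₁ E₂ : Type*)
    [NormedAddCommGroup E₁] [NormedSpace ℝ E₁] [NormedAddCommGroup E₂] [NormedSpace ℝ E₂]
    (p : M) where
  e : OpenPartialHomeomorph M (E₁ × E₂)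
  l : ℕ
  hl : 1 ≤ l
  hp : iterZ f l p = p
  hsrc : p ∈ e.source
  e0 : e p = 0
  ρ : ℝ
  hρ : 0 < ρ
  htgt : closedBall 0 ρ ⊆ e.target
  step : ∀ (a : E₁) (b : E₂), ‖a‖ ≤ ρ → ‖(2 : ℝ) • b‖ ≤ ρ →
    iterZ f l (e.symm (a, b)) = e.symm ((1/2 : ℝ) • a, (2 : ℝ) • b)

namespace HypBox

variable {M : Type*} [MetricSpace M] {f : M ≃ₜ M} {E₁ E₂ : Type*}
    [NormedAddCommGroup E₁] [NormedSpace ℝ E₁] [NormedAddCommGroup E₂] [NormedSpace ℝ E₂]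
    {p : M}

/-- Time reversal of a hyperbolic box. -/
def flip (B : HypBox f E₁ E₂ p) : HypBox f.symm E₂ E₁ p where
  e := B.e.trans (Homeomorph.prodComm E₁ E₂).toOpenPartialHomeomorph
  l := B.l
  hl := B.hl
  hp := by
    rw [iterZ_symm]
    have h := iterZ_neg_cancel f B.l p
    rwa [B.hp] at h
  hsrc := by simpa using B.hsrc
  e0 := by
    change Prod.swap (B.e p) = 0
    rw [B.e0]; rfl
  ρ := B.ρ
  hρ := B.hρ
  htgt := by
    intro y hy
    have : Prod.swap y ∈ B.e.target := B.htgt (by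
      rw [mem_closedBall_zero_iff] at hy ⊢
      rwa [Prod.norm_def, Prod.fst_swap, Prod.snd_swap, max_comm, ← Prod.norm_def])
    simpa using this
  step := by
    intro a b ha hb
    change iterZ f.symm B.l (B.e.symm (b, a)) = B.e.symm ((2 : ℝ) • b, (1/2 : ℝ) • a)
    have e1 : (2 : ℝ) • (1/2 : ℝ) • a = a := by rw [smul_smul]; norm_num
    have e2 : (1/2 : ℝ) • (2 : ℝ) • b = b := by rw [smul_smul]; norm_num
    have := B.step ((2 : ℝ) • b) ((1/2 : ℝ) • a) hb (by rwa [e1])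
    rw [e1, e2] at this
    rw [iterZ_symm, ← this, iterZ_neg_cancel]

lemma mem_tgt (B : HypBox f E₁ E₂ p) {a : E₁} {b : E₂} (ha : ‖a‖ ≤ B.ρ) (hb : ‖b‖ ≤ B.ρ) :
    (a, b) ∈ B.e.target := B.htgt (by
      rw [mem_closedBall_zero_iff, Prod.norm_def]; exact max_le ha hb)

lemma symm0 (B : HypBox f E₁ E₂ p) : B.e.symm (0, 0) = p := by
  have := B.e.left_inv B.hsrc
  rw [B.e0] at this
  exact this

lemma iter_s (B : HypBox f E₁ E₂ p) {a : E₁} (ha : ‖a‖ ≤ B.ρ) (j : ℕ) :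
    iterZ f (j * B.l) (B.e.symm (a, 0)) = B.e.symm ((1/2 : ℝ)^j • a, 0) := by
  induction j with
  | zero => simp [iterZ_zero]
  | succ j ih =>
    have e1 : ((j + 1 : ℕ) : ℤ) * B.l = B.l + j * B.l := by push_cast; ring
    rw [e1, iterZ_add, ih, B.step _ _ _ (by simpa using B.hρ.le)]
    · rw [smul_smul, smul_zero, pow_succ']
    · rw [norm_smul, norm_pow]
      have : ‖(1/2 : ℝ)‖ ^ j ≤ 1 := pow_le_one₀ (norm_nonneg _) (by norm_num)
      nlinarith [norm_nonneg a]

lemma iter_s_gen (B : HypBox f E₁ E₂ p) (j : ℕ) {a : E₁} {b : E₂} (ha : ‖a‖ ≤ B.ρ)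
    (hb : ‖(2 : ℝ)^j • b‖ ≤ B.ρ) :
    iterZ f (j * B.l) (B.e.symm (a, b)) = B.e.symm ((1/2 : ℝ)^j • a, (2 : ℝ)^j • b) := by
  induction j with
  | zero => simp [iterZ_zero]
  | succ j ih =>
    have e1 : ((j + 1 : ℕ) : ℤ) * B.l = B.l + j * B.l := by push_cast; ring
    have hb' : ‖(2 : ℝ) • (2 : ℝ)^j • b‖ ≤ B.ρ := by rwa [smul_smul, ← pow_succ']
    have hb2 : ‖(2 : ℝ)^j • b‖ ≤ B.ρ := by
      rw [norm_smul] at hb'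
      have : ‖(2 : ℝ)‖ = 2 := by norm_num
      rw [this] at hb'
      nlinarith [norm_nonneg ((2 : ℝ)^j • b)]
    rw [e1, iterZ_add, ih hb2, B.step _ _ _ hb']
    · rw [smul_smul, smul_smul, pow_succ', pow_succ']
    · rw [norm_smul, norm_pow]
      have : ‖(1/2 : ℝ)‖ ^ j ≤ 1 := pow_le_one₀ (norm_nonneg _) (by norm_num)
      nlinarith [norm_nonneg a]

lemma iter_u (B : HypBox f E₁ E₂ p) {b : E₂} (hb : ‖b‖ ≤ B.ρ) (j : ℕ) :
    iterZ f (-(j * B.l)) (B.e.symm (0, b)) = B.e.symm (0, (1/2 : ℝ)^j • b) := by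
  have := B.flip.iter_s hb j
  rw [iterZ_symm] at this
  exact this

lemma mem_Ws [CompactSpace M] (B : HypBox f E₁ E₂ p) {a : E₁} (ha : ‖a‖ ≤ B.ρ) :
    B.e.symm (a, 0) ∈ Ws f p := by
  refine Ws_of_mul f B.hl ?_
  have h1 : ∀ j : ℕ, dist (iterZ f (j * B.l) p) (iterZ f (j * B.l) (B.e.symm (a, 0)))
      = dist p (B.e.symm ((1/2 : ℝ)^j • a, 0)) := fun j => by
    rw [iterZ_period f B.hp, B.iter_s ha]
  simp_rw [h1]
  have h2 : Filter.Tendsto (fun j : ℕ => ((1/2 : ℝ)^j • a, (0 : E₂))) Filter.atTop (nhds 0) := by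
    have : Filter.Tendsto (fun j : ℕ => (1/2 : ℝ)^j • a) Filter.atTop (nhds ((0 : ℝ) • a)) :=
      (tendsto_pow_atTop_nhds_zero_of_lt_one (by norm_num) (by norm_num)).smul_const a
    rw [zero_smul] at this
    exact this.prodMk_nhds tendsto_const_nhds
  have h3 : ContinuousAt B.e.symm 0 := B.e.symm.continuousAt (B.htgt (by simpa using B.hρ.le))
  have h4 := (h3.tendsto.comp h2)
  have h5 : B.e.symm 0 = p := B.symm0
  rw [h5] at h4
  have := (tendsto_const_nhds (x := p)).dist h4
  rwa [dist_self] at this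

lemma mem_Wu [CompactSpace M] (B : HypBox f E₁ E₂ p) {b : E₂} (hb : ‖b‖ ≤ B.ρ) :
    B.e.symm (0, b) ∈ Wu f p := by
  rw [← Ws_symm_homeo]
  exact B.flip.mem_Ws hb

/-- a small ball around `p` inside the half box. -/
lemma exists_ball (B : HypBox f E₁ E₂ p) {s : ℝ} (hs : 0 < s) :
    ∃ θ > 0, ∀ y, dist p y < θ → y ∈ B.e.source ∧ ‖B.e y‖ < s := by
  have h1 : B.e.source ∩ B.e ⁻¹' (ball 0 s) ∈ nhds p := by
    refine Filter.inter_mem (B.e.open_source.mem_nhds B.hsrc) ?_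
    refine (B.e.continuousAt B.hsrc).preimage_mem_nhds ?_
    rw [B.e0]; exact ball_mem_nhds _ hs
  obtain ⟨θ, hθ, h⟩ := Metric.mem_nhds_iff.1 h1
  refine ⟨θ, hθ, fun y hy => ?_⟩
  have := h (mem_ball'.2 hy)
  exact ⟨this.1, by simpa using this.2⟩

/-- staying in the box forward forces the unstable coordinate to vanish. -/
lemma stay (B : HypBox f E₁ E₂ p) {y : M}
    (h : ∀ j : ℕ, iterZ f (j * B.l) y ∈ B.e.source ∧ ‖B.e (iterZ f (j * B.l) y)‖ ≤ B.ρ / 2) :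
    (B.e y).2 = 0 := by
  have key : ∀ j : ℕ, (B.e (iterZ f (j * B.l) y)).2 = (2 : ℝ)^j • (B.e y).2 := by
    intro j
    induction j with
    | zero => simp [iterZ_zero]
    | succ j ih =>
      have e1 : ((j + 1 : ℕ) : ℤ) * B.l = B.l + j * B.l := by push_cast; ring
      obtain ⟨hs, hn⟩ := h j
      set w := iterZ f (j * B.l) y
      have h1 := norm_fst_le (B.e w)
      have h2 := norm_snd_le (B.e w)
      have hρ := B.hρ
      have h3 := B.step (B.e w).1 (B.e w).2 (by linarith) (by
        rw [norm_smul]; norm_num; linarith)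
      rw [Prod.mk.eta, B.e.left_inv hs] at h3
      rw [e1, iterZ_add, h3, B.e.right_inv, ih, smul_smul, pow_succ']
      refine B.mem_tgt ?_ ?_
      · rw [norm_smul]; norm_num; linarith
      · rw [norm_smul]; norm_num; linarith
  by_contra hne
  have hpos : 0 < ‖(B.e y).2‖ := norm_pos_iff.2 hne
  obtain ⟨j, hj⟩ := pow_unbounded_of_one_lt (B.ρ / ‖(B.e y).2‖) (one_lt_two)
  rw [div_lt_iff₀ hpos] at hj
  have h1 := (norm_snd_le _).trans (h j).2
  rw [key, norm_smul, norm_pow] at h1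
  norm_num at h1
  linarith [B.hρ]

lemma exists_uniform [CompactSpace M] (B : HypBox f E₁ E₂ p) {α : ℝ} (hexp : IsExpansive f α) :
    ∃ J : ℕ, ∀ y ∈ WsLoc f α p, iterZ f (J * B.l) y ∈ B.e.source ∧
      ‖B.e (iterZ f (J * B.l) y)‖ ≤ B.ρ / 2 ∧ (B.e (iterZ f (J * B.l) y)).2 = 0 := by
  obtain ⟨θ, hθ, h⟩ := B.exists_ball (half_pos B.hρ)
  obtain ⟨N, hN⟩ := hexp.unif_s hθ
  have hl := B.hl
  have main : ∀ y ∈ WsLoc f α p, ∀ j : ℕ, N ≤ j → iterZ f (j * B.l) y ∈ B.e.source ∧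
      ‖B.e (iterZ f (j * B.l) y)‖ ≤ B.ρ / 2 := by
    intro y hy j hj
    have h1 := hN p y hy (j * B.l) (by
      exact_mod_cast hj.trans (Nat.le_mul_of_pos_right _ hl))
    rw [iterZ_period f B.hp] at h1
    exact ⟨(h _ h1).1, (h _ h1).2.le⟩
  refine ⟨N, fun y hy => ⟨(main y hy N le_rfl).1, (main y hy N le_rfl).2, B.stay fun j => ?_⟩⟩
  rw [← iterZ_add]
  have := main y hy (j + N) (by omega)
  have e1 : (j : ℤ) * B.l + N * B.l = (j + N : ℕ) * B.l := by push_cast; ring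
  rwa [e1]

lemma local_flat [CompactSpace M] (B : HypBox f E₁ E₂ p) {α : ℝ} (hexp : IsExpansive f α) :
    ∃ γ > 0, ∀ y ∈ WsLoc f α p, dist p y < γ → y ∈ B.e.source ∧ (B.e y).2 = 0 := by
  obtain ⟨θ, hθ, h⟩ := B.exists_ball (half_pos B.hρ)
  obtain ⟨γ, hγ, h'⟩ := hexp.local_s (half_pos hθ)
  have main : ∀ y ∈ WsLoc f α p, dist p y < γ → ∀ j : ℕ, iterZ f (j * B.l) y ∈ B.e.source ∧
      ‖B.e (iterZ f (j * B.l) y)‖ ≤ B.ρ / 2 := by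
    intro y hy hd j
    have h1 := h' p y hy hd (j * B.l) (by positivity)
    rw [iterZ_period f B.hp] at h1
    exact ⟨(h _ (by linarith)).1, (h _ (by linarith)).2.le⟩
  refine ⟨γ, hγ, fun y hy hd => ⟨?_, B.stay (main y hy hd)⟩⟩
  have := (main y hy hd 0).1
  simpa [iterZ_zero] using this

lemma periodic_eq_of_Ws {y : M} {l m : ℕ} (hl : 1 ≤ l) (hm : 1 ≤ m) (hp : iterZ f l p = p)
    (hy : iterZ f m y = y) (h : y ∈ Ws f p) : y = p := by
  change Filter.Tendsto _ _ _ at h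
  have h1 : Filter.Tendsto (fun j : ℕ => ((j * m * l : ℕ) : ℤ)) Filter.atTop Filter.atTop := by
    refine tendsto_natCast_atTop_atTop.comp ?_
    have : Filter.Tendsto (fun j : ℕ => j * (m * l)) Filter.atTop Filter.atTop :=
      Filter.tendsto_id.atTop_mul_const' (by positivity)
    simpa [mul_assoc] using this
  have h2 := h.comp h1
  have h3 : ∀ j : ℕ, dist (iterZ f ((j * m * l : ℕ) : ℤ) p) (iterZ f ((j * m * l : ℕ) : ℤ) y) = dist p y := by
    intro j
    have e1 : ((j * m * l : ℕ) : ℤ) = (j * m) * l := by push_cast; ring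
    have e2 : ((j * m : ℕ) : ℤ) * l = (j * l) * m := by push_cast; ring
    rw [e1, iterZ_period f hp]
    have e3 : (j * m : ℤ) * l = (j * l) * m := by ring
    rw [e3, iterZ_period f hy]
  simp only [Function.comp_def, h3] at h2
  have := tendsto_nhds_unique h2 tendsto_const_nhds
  exact (dist_eq_zero.1 this.symm).symm

/-- sinks are isolated among periodic points -/
lemma sink_isolated [CompactSpace M] (B : HypBox f E₁ E₂ p) [Subsingleton E₂] :
    ∃ U : Set M, IsOpen U ∧ p ∈ U ∧ ∀ y ∈ U, ∀ m : ℕ, 1 ≤ m → iterZ f m y = y → y = p := by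
  obtain ⟨θ, hθ, h⟩ := B.exists_ball B.hρ
  refine ⟨ball p θ, isOpen_ball, mem_ball_self hθ, fun y hy m hm hym => ?_⟩
  obtain ⟨h1, h2⟩ := h y (mem_ball'.1 hy)
  refine periodic_eq_of_Ws B.hl hm B.hp hym ?_
  have h3 : y = B.e.symm ((B.e y).1, 0) := by
    rw [Subsingleton.elim (0 : E₂) (B.e y).2, Prod.mk.eta, B.e.left_inv h1]
  rw [h3]
  exact B.mem_Ws ((norm_fst_le _).trans h2.le)

end HypBox

lemma PerHr.hypBox {M : Type*} [MetricSpace M] {f : M ≃ₜ M} {n r : ℕ} {p : M} (hp : p ∈ PerHr f n r)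
    {E₁ E₂ : Type*} [NormedAddCommGroup E₁] [NormedSpace ℝ E₁] [NormedAddCommGroup E₂]
    [NormedSpace ℝ E₂] (φ₁ : (Fin r → ℝ) ≃L[ℝ] E₁) (φ₂ : (Fin (n - r) → ℝ) ≃L[ℝ] E₂) :
    Nonempty (HypBox f E₁ E₂ p) := by
  obtain ⟨l, hl, hlp, U, V, h, hU, hV, h0V, hpU, hp0, hconj⟩ := hp
  have : Nonempty U := ⟨⟨p, hpU⟩⟩
  have : Nonempty V := ⟨⟨0, h0V⟩⟩
  let e₀ : OpenPartialHomeomorph M (ModelSp n r) :=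
    ((hU.isOpenEmbedding_subtypeVal.toOpenPartialHomeomorph Subtype.val).symm.trans
      h.toOpenPartialHomeomorph).trans (hV.isOpenEmbedding_subtypeVal.toOpenPartialHomeomorph Subtype.val)
  have hes : e₀.source = U := by
    simp [e₀]
  have hea : ∀ z (hz : z ∈ U), e₀ z = (h ⟨z, hz⟩ : V) := by
    intro z hz
    simp only [e₀, OpenPartialHomeomorph.coe_trans, Function.comp_apply,
      Homeomorph.toOpenPartialHomeomorph_apply, Topology.IsOpenEmbedding.toOpenPartialHomeomorph_apply]
    congr 2
    exact (hU.isOpenEmbedding_subtypeVal.toOpenPartialHomeomorph_left_inv (f := Subtype.val) (x := ⟨z, hz⟩))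
  let e : OpenPartialHomeomorph M (E₁ × E₂) :=
    e₀.trans (φ₁.toHomeomorph.prodCongr φ₂.toHomeomorph).toOpenPartialHomeomorph
  have hs : e.source = U := by simp [e, hes]
  have happ : ∀ z, e z = (φ₁ (e₀ z).1, φ₂ (e₀ z).2) := fun z => rfl
  have hconj' : ∀ z ∈ U, iterZ f l z ∈ U → e (iterZ f l z) = ((1/2 : ℝ) • (e z).1, (2 : ℝ) • (e z).2) := by
    intro z hz hz'
    rw [iterZ_natCast] at hz' ⊢
    rw [happ, happ, hea _ hz', hea _ hz, hconj z hz hz']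
    simp only [← map_smul]
    congr 2
    funext i
    simp [modelL]; ring
  have hesrc : p ∈ e.source := hs ▸ hpU
  have he0 : e p = 0 := by
    rw [happ, hea p hpU, hp0]; simp
  have hmem : e.target ∩ e.symm ⁻¹' (U ∩ iterZ f l ⁻¹' U) ∈ nhds (0 : E₁ × E₂) := by
    have h0t : (0 : E₁ × E₂) ∈ e.target := he0 ▸ e.map_source hesrc
    refine Filter.inter_mem (e.open_target.mem_nhds h0t) ?_
    refine (e.symm.continuousAt h0t).preimage_mem_nhds ?_
    have : e.symm 0 = p := by rw [← he0, e.left_inv hesrc]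
    rw [this]
    refine (hU.inter (hU.preimage (iterZ_continuous f l))).mem_nhds ⟨hpU, ?_⟩
    rw [mem_preimage, iterZ_natCast, hlp]; exact hpU
  obtain ⟨ρ, hρ, hρb⟩ := Metric.nhds_basis_closedBall.mem_iff.1 hmem
  refine ⟨⟨e, l, hl, by rw [iterZ_natCast, hlp], hesrc, he0, ρ, hρ, fun y hy => (hρb hy).1, ?_⟩⟩
  intro a b ha hb
  have hb2 : ‖b‖ ≤ ρ := by
    rw [norm_smul] at hb; norm_num at hb; nlinarith [norm_nonneg b]
  have hy := hρb (show (a, b) ∈ closedBall 0 ρ by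
    rw [mem_closedBall_zero_iff, Prod.norm_def]; exact max_le ha hb2)
  have h1 := hconj' _ hy.2.1 hy.2.2
  rw [e.right_inv hy.1] at h1
  rw [← h1, e.left_inv]
  rw [hs]; exact hy.2.2

lemma PerHr.periodic {M : Type*} [MetricSpace M] {f : M ≃ₜ M} {n r : ℕ} {p : M} (hp : p ∈ PerHr f n r) :
    ∃ l : ℕ, 1 ≤ l ∧ iterZ f l p = p := by
  obtain ⟨l, hl, hlp, -⟩ := hp
  exact ⟨l, hl, by rw [iterZ_natCast, hlp]⟩

lemma PerH.periodic {M : Type*} [MetricSpace M] {f : M ≃ₜ M} {n : ℕ} {p : M} (hp : p ∈ PerH f n) :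
    ∃ l : ℕ, 1 ≤ l ∧ iterZ f l p = p := by
  simp only [PerH, mem_iUnion] at hp
  obtain ⟨r, _, h⟩ := hp
  exact PerHr.periodic h

lemma PerHr.subset_PerH {M : Type*} [MetricSpace M] {f : M ≃ₜ M} {n r : ℕ} (hr : r ≤ n) :
    PerHr f n r ⊆ PerH f n := by
  intro p hp
  simp only [PerH, mem_iUnion]
  exact ⟨r, by simpa using hr, hp⟩

open Metric Set

lemma Ws_iter {M : Type*} [MetricSpace M] {f : M ≃ₜ M} {p y : M} {l : ℤ}
    (hp : iterZ f l p = p) (h : y ∈ Ws f p) (j : ℤ) : iterZ f (j * l) y ∈ Ws f p := by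
  change Filter.Tendsto _ _ _ at h ⊢
  have h1 : Filter.Tendsto (fun k : ℤ => k + j * l) Filter.atTop Filter.atTop :=
    Filter.tendsto_atTop_add_const_right _ _ Filter.tendsto_id
  have h2 := h.comp h1
  refine h2.congr fun k => ?_
  simp only [Function.comp_apply]
  rw [iterZ_add, iterZ_add, iterZ_period f hp]

lemma Wu_iter {M : Type*} [MetricSpace M] {f : M ≃ₜ M} {p y : M} {l : ℤ}
    (hp : iterZ f l p = p) (h : y ∈ Wu f p) (j : ℤ) : iterZ f (j * l) y ∈ Wu f p := by
  rw [← Ws_symm_homeo] at h ⊢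
  have hp' : iterZ f.symm l p = p := by
    rw [iterZ_symm]
    simpa using iterZ_period f hp (-1)
  have := Ws_iter hp' h (-j)
  rwa [iterZ_symm, neg_mul, neg_neg] at this

namespace HypBox

variable {M : Type*} [MetricSpace M] {f : M ≃ₜ M} {E₁ E₂ : Type*}
    [NormedAddCommGroup E₁] [NormedSpace ℝ E₁] [NormedAddCommGroup E₂] [NormedSpace ℝ E₂]
    {p : M}

lemma not_isolated (B : HypBox f E₁ E₂ p) [Nontrivial (E₁ × E₂)] : ¬ IsOpen ({p} : Set M) := by
  intro h
  have h0 : (0 : E₁ × E₂) ∈ B.e.target := B.htgt (by simpa using B.hρ.le)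
  have h1 : B.e.symm ⁻¹' {p} ∈ nhds (0 : E₁ × E₂) := by
    refine (B.e.symm.continuousAt h0).preimage_mem_nhds ?_
    have : B.e.symm 0 = p := B.symm0
    rw [this]; exact h.mem_nhds rfl
  obtain ⟨s, hs, h2⟩ := Metric.nhds_basis_closedBall.mem_iff.1 h1
  have hpos : 0 < min s B.ρ := lt_min hs B.hρ
  obtain ⟨a, ha⟩ := _root_.exists_norm_eq (E₁ × E₂) hpos.le
  have h3 : B.e.symm a = p := h2 (by rw [mem_closedBall_zero_iff, ha]; exact min_le_left _ _)
  have h4 : a ∈ B.e.target := B.htgt (by rw [mem_closedBall_zero_iff, ha]; exact min_le_right _ _)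
  have h5 := B.e.right_inv h4
  rw [h3, B.e0] at h5
  rw [← h5, norm_zero] at ha
  exact hpos.ne ha

/-- the big unstable disc -/
def gu (B : HypBox f E₁ E₂ p) (K : ℕ) (u : E₂) : M := iterZ f (K * B.l) (B.e.symm (0, u))

lemma gu_zero (B : HypBox f E₁ E₂ p) (K : ℕ) : B.gu K 0 = p := by
  rw [gu, B.symm0, iterZ_period f B.hp]

lemma gu_cont (B : HypBox f E₁ E₂ p) (K : ℕ) : ContinuousOn (B.gu K) (closedBall 0 B.ρ) := by
  refine (iterZ_continuous f _).comp_continuousOn ?_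
  refine B.e.symm.continuousOn.comp (f := fun u : E₂ => ((0 : E₁), u)) (by fun_prop) ?_
  intro u hu
  exact B.mem_tgt (by simpa using B.hρ.le) (by simpa using hu)

lemma gu_inj (B : HypBox f E₁ E₂ p) (K : ℕ) : InjOn (B.gu K) (closedBall 0 B.ρ) := by
  intro u hu u' hu' h
  have h1 : B.e.symm (0, u) = B.e.symm (0, u') := by
    have := congrArg (iterZ f (-(K * B.l))) h
    simpa only [gu, iterZ_neg_cancel] using this
  have h2 := B.e.symm.injOn (B.mem_tgt (by simpa using B.hρ.le) (by simpa using hu))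
    (B.mem_tgt (by simpa using B.hρ.le) (by simpa using hu')) h1
  exact (Prod.mk.inj h2).2

lemma gu_mem [CompactSpace M] (B : HypBox f E₁ E₂ p) (K : ℕ) {u : E₂} (hu : ‖u‖ ≤ B.ρ) : B.gu K u ∈ Wu f p :=
  Wu_iter B.hp (B.mem_Wu hu) _

lemma gu_small (B : HypBox f E₁ E₂ p) (K : ℕ) {u : E₂} (hu : ‖(2 : ℝ)^K • u‖ ≤ B.ρ) :
    B.gu K u = B.e.symm (0, (2 : ℝ)^K • u) := by
  rw [gu, B.iter_s_gen K (by simpa using B.hρ.le) hu, smul_zero]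

lemma gu_exit [CompactSpace M] (B : HypBox f E₁ E₂ p) {α : ℝ} (hexp : IsExpansive f α) :
    ∃ K : ℕ, ∀ u : E₂, ‖u‖ = B.ρ → B.gu K u ∉ WuLoc f α p := by
  obtain ⟨θ, hθ, h⟩ := B.exists_ball B.hρ
  obtain ⟨N, hN⟩ := hexp.symm.unif_s hθ
  refine ⟨N, fun u hu hc => ?_⟩
  rw [← WsLoc_symm_homeo] at hc
  have h1 := hN p _ hc (N * B.l) (by
    have := B.hl
    exact_mod_cast Nat.le_mul_of_pos_right _ this)
  rw [iterZ_symm, iterZ_symm, gu, iterZ_neg_cancel, ← neg_mul, iterZ_period f B.hp] at h1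
  have h2 := (h _ h1).2
  rw [B.e.right_inv (B.mem_tgt (by simpa using B.hρ.le) hu.le), Prod.norm_def] at h2
  have := (le_max_right _ _).trans_lt h2
  simp only at this
  linarith

lemma arc [CompactSpace M] (B : HypBox f E₁ E₂ p) {α ε ν η : ℝ} {x : M} (hεα : ε ≤ α) {K : ℕ}
    (hK : ∀ u : E₂, ‖u‖ = B.ρ → B.gu K u ∉ WuLoc f α p)
    (hU : UpSet f x ν p ⊆ WuLoc f ε p) (hη : 0 < η) (hb : closedBall p η ⊆ ball x ν)
    {v : E₂} (hv : ‖v‖ = 1) : ∃ t ∈ Ioc 0 B.ρ,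
      (∀ s ∈ Icc 0 t, B.gu K (s • v) ∈ WuLoc f ε p ∧ dist (B.gu K (s • v)) p ≤ η) ∧
      dist (B.gu K (t • v)) p = η := by
  have hρ := B.hρ
  have hmaps : ∀ s ∈ Icc 0 B.ρ, s • v ∈ closedBall (0 : E₂) B.ρ := by
    intro s hs
    rw [mem_closedBall_zero_iff, norm_smul, hv, mul_one, Real.norm_of_nonneg hs.1]
    exact hs.2
  have hcont : ContinuousOn (fun s : ℝ => B.gu K (s • v)) (Icc 0 B.ρ) :=
    (B.gu_cont K).comp (by fun_prop) hmaps
  have hWu : ∀ s ∈ Icc 0 B.ρ, B.gu K (s • v) ∈ Wu f p := fun s hs =>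
    B.gu_mem K (by simpa using hmaps s hs)
  -- connected piece of the arc in the ball is in the local unstable set
  have hconn : ∀ t ∈ Icc 0 B.ρ, (∀ s ∈ Icc 0 t, dist (B.gu K (s • v)) p ≤ η) →
      ∀ s ∈ Icc 0 t, B.gu K (s • v) ∈ WuLoc f ε p := by
    intro t ht h s hs
    apply hU
    have hpre : IsPreconnected ((fun s : ℝ => B.gu K (s • v)) '' Icc 0 t) :=
      isPreconnected_Icc.image _ (hcont.mono (Icc_subset_Icc_right ht.2))
    refine hpre.subset_connectedComponentIn ⟨0, ⟨le_rfl, ht.1⟩, by simp [B.gu_zero]⟩ ?_ ⟨s, hs, rfl⟩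
    rintro _ ⟨s', hs', rfl⟩
    exact ⟨hWu s' ⟨hs'.1, hs'.2.trans ht.2⟩, hb (h s' hs')⟩
  have hex : ∃ s ∈ Icc 0 B.ρ, η ≤ dist (B.gu K (s • v)) p := by
    by_contra hcon
    push Not at hcon
    have h1 := hconn B.ρ ⟨hρ.le, le_rfl⟩ (fun s hs => (hcon s hs).le) B.ρ ⟨hρ.le, le_rfl⟩
    exact hK (B.ρ • v) (by rw [norm_smul, hv, mul_one, Real.norm_of_nonneg hρ.le]) (WuLoc_mono hεα _ h1)
  have hdc : ContinuousOn (fun s : ℝ => dist (B.gu K (s • v)) p) (Icc 0 B.ρ) :=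
    continuous_dist.comp_continuousOn (ContinuousOn.prodMk hcont continuousOn_const)
  have hcomp : IsCompact (Icc 0 B.ρ ∩ (fun s : ℝ => dist (B.gu K (s • v)) p) ⁻¹' Ici η) := by
    refine isCompact_Icc.of_isClosed_subset ?_ inter_subset_left
    exact hdc.preimage_isClosed_of_isClosed isClosed_Icc isClosed_Ici
  obtain ⟨s0, hs0, hs0'⟩ := hex
  obtain ⟨t, ⟨ht, hηt⟩, hmin⟩ := hcomp.exists_isLeast ⟨s0, hs0, hs0'⟩
  have hlt : ∀ s ∈ Icc 0 B.ρ, s < t → dist (B.gu K (s • v)) p < η := by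
    intro s hs hst
    by_contra hc
    exact absurd (hmin ⟨hs, not_lt.1 hc⟩) (not_le.2 hst)
  have ht0 : 0 < t := by
    rcases ht.1.lt_or_eq with h | h
    · exact h
    · exfalso
      rw [← h] at hηt
      simp [B.gu_zero] at hηt
      linarith
  have hle : dist (B.gu K (t • v)) p ≤ η := by
    have h1 : t ∈ closure (Ico 0 t) := by
      rw [closure_Ico ht0.ne]; exact ⟨ht0.le, le_rfl⟩
    have hsub : Ico 0 t ⊆ Icc 0 B.ρ := fun s hs => ⟨hs.1, hs.2.le.trans ht.2⟩
    have h2 : ContinuousWithinAt (fun s : ℝ => dist (B.gu K (s • v)) p) (Ico 0 t) t :=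
      (hdc t ht).mono hsub
    have h3 := h2.mem_closure_image h1
    refine (isClosed_Iic (a := η)).closure_subset_iff.2 ?_ h3
    rintro _ ⟨s, hs, rfl⟩
    exact (hlt s (hsub hs) hs.2).le
  have hall : ∀ s ∈ Icc 0 t, dist (B.gu K (s • v)) p ≤ η := by
    intro s hs
    rcases hs.2.lt_or_eq with h | h
    · exact (hlt s ⟨hs.1, hs.2.trans ht.2⟩ h).le
    · rw [h]; exact hle
  exact ⟨t, ⟨ht0, ht.2⟩, fun s hs => ⟨hconn t ht hall s hs, hall s hs⟩, le_antisymm hle hηt⟩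

/-- core flat chart lemma -/
lemma flat_core [CompactSpace M] (B : HypBox f E₁ E₂ p) {ν : ℝ} {x : M} (J : ℕ) {w : M}
    (hw : w ∈ SpSet f x ν p) (hws : iterZ f (J * B.l) w ∈ B.e.source)
    (hwn : ‖B.e (iterZ f (J * B.l) w)‖ ≤ B.ρ / 2) (hw2 : (B.e (iterZ f (J * B.l) w)).2 = 0)
    {N : Set M} (hN : N ∈ nhds w)
    (hNS : ∀ y ∈ SpSet f x ν p, y ∈ N → (B.e (iterZ f (J * B.l) y)).2 = 0) :
    let E := (itH f (J * B.l)).toOpenPartialHomeomorph.trans B.e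
    w ∈ E.source ∧ (E w).2 = 0 ∧ ∀ U : Set M, IsOpen U → w ∈ U → ∃ ρ' > 0,
      ball (E w) ρ' ⊆ E.target ∧ ∀ y ∈ ball (E w) ρ', E.symm y ∈ U ∩ ball x ν ∧
        (E.symm y ∈ SpSet f x ν p ↔ y.2 = 0) := by
  intro E
  have hEa : ∀ z, E z = B.e (iterZ f (J * B.l) z) := fun z => by
    rw [← itH_apply]; rfl
  have hEsymm : ∀ y, E.symm y = iterZ f (-(J * B.l)) (B.e.symm y) := fun y => by
    have h1 : E.symm y = (itH f (J * B.l)).symm (B.e.symm y) := rfl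
    rw [h1, Homeomorph.symm_apply_eq, itH_apply, iterZ_cancel_neg]
  have hEs : ∀ z, z ∈ E.source ↔ iterZ f (J * B.l) z ∈ B.e.source := fun z => by
    simp [E, itH_apply]
  have hwE : w ∈ E.source := (hEs w).2 hws
  refine ⟨hwE, by rw [hEa]; exact hw2, fun U hU hwU => ?_⟩
  have hwball : w ∈ ball x ν := (connectedComponentIn_subset _ _ hw).2
  have hmem : E.target ∩ E.symm ⁻¹' (N ∩ (U ∩ ball x ν)) ∈ nhds (E w) := by
    have h0t := E.map_source hwE
    refine Filter.inter_mem (E.open_target.mem_nhds h0t) ?_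
    refine (E.symm.continuousAt h0t).preimage_mem_nhds ?_
    rw [E.left_inv hwE]
    exact Filter.inter_mem hN ((hU.inter isOpen_ball).mem_nhds ⟨hwU, hwball⟩)
  obtain ⟨ρ1, hρ1, hρ1b⟩ := Metric.mem_nhds_iff.1 hmem
  have hρ := B.hρ
  refine ⟨min ρ1 (B.ρ / 2), lt_min hρ1 (by linarith), fun y hy => (hρ1b (ball_subset_ball (min_le_left _ _) hy)).1, ?_⟩
  intro y hy
  have hy1 := hρ1b (ball_subset_ball (min_le_left _ _) hy)
  refine ⟨hy1.2.2, fun h => ?_, fun h => ?_⟩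
  · have := hNS _ h hy1.2.1
    rwa [← hEa, E.right_inv hy1.1] at this
  · -- connected plaque
    have hsub : ∀ a ∈ ball (E w).1 (min ρ1 (B.ρ/2)), (a, (0 : E₂)) ∈ ball (E w) (min ρ1 (B.ρ/2)) := by
      intro a ha
      rw [mem_ball, Prod.dist_eq]
      refine max_lt ha ?_
      simp only
      rw [hEa w, hw2, dist_self]
      exact lt_min hρ1 (by linarith)
    set D := (fun a : E₁ => E.symm (a, 0)) '' ball (E w).1 (min ρ1 (B.ρ/2))
    have hD : IsPreconnected D := by
      refine (convex_ball (E w).1 _).isPreconnected.image _ ?_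
      refine E.symm.continuousOn.comp (f := fun a : E₁ => (a, (0 : E₂))) (by fun_prop) ?_
      intro a ha
      exact (hρ1b (ball_subset_ball (min_le_left _ _) (hsub a ha))).1
    have hDs : D ⊆ Ws f p ∩ ball x ν := by
      rintro _ ⟨a, ha, rfl⟩
      refine ⟨?_, (hρ1b (ball_subset_ball (min_le_left _ _) (hsub a ha))).2.2.2⟩
      simp only
      rw [hEsymm, ← neg_mul]
      refine Ws_iter B.hp (B.mem_Ws ?_) _
      have h1 : dist a (E w).1 < B.ρ / 2 := lt_of_lt_of_le ha (min_le_right _ _)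
      have h2 : ‖(E w).1‖ ≤ B.ρ / 2 := (norm_fst_le _).trans (by rw [hEa]; exact hwn)
      have h3 : ‖a‖ ≤ ‖a - (E w).1‖ + ‖(E w).1‖ := norm_le_norm_sub_add _ _
      rw [dist_eq_norm] at h1
      linarith
    have hwD : w ∈ D := by
      refine ⟨(E w).1, mem_ball_self (lt_min hρ1 (by linarith)), ?_⟩
      have : ((E w).1, (0 : E₂)) = E w := by
        have h1 : (0 : E₂) = (E w).2 := by rw [hEa w, hw2]
        rw [h1]
      simp only [this]
      exact E.left_inv hwE
    have h2 := hD.subset_connectedComponentIn hwD hDs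
    have h3 : connectedComponentIn (Ws f p ∩ ball x ν) w = SpSet f x ν p :=
      (connectedComponentIn_eq hw).symm
    rw [h3] at h2
    refine h2 ⟨y.1, ?_, ?_⟩
    · rw [mem_ball, Prod.dist_eq] at hy
      exact (le_max_left _ _).trans_lt hy
    · simp only
      rw [← h]

/-- flat charts along `S_p` -/
lemma flat [CompactSpace M] (B : HypBox f E₁ E₂ p) {α ν ε : ℝ} {x : M} (hexp : IsExpansive f α)
    (hεα : ε ≤ α) (hS : SpSet f x ν p ⊆ WsLoc f ε p) :
    ∃ E : OpenPartialHomeomorph M (E₁ × E₂), ∀ w ∈ SpSet f x ν p,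
      w ∈ E.source ∧ (E w).2 = 0 ∧ ∀ U : Set M, IsOpen U → w ∈ U → ∃ ρ' > 0,
      ball (E w) ρ' ⊆ E.target ∧ ∀ y ∈ ball (E w) ρ', E.symm y ∈ U ∩ ball x ν ∧
        (E.symm y ∈ SpSet f x ν p ↔ y.2 = 0) := by
  obtain ⟨J, hJ⟩ := B.exists_uniform hexp
  refine ⟨(itH f (J * B.l)).toOpenPartialHomeomorph.trans B.e, fun w hw => ?_⟩
  have h1 := fun y hy => hJ y (WsLoc_mono hεα _ (hS hy))
  exact B.flat_core J hw (h1 w hw).1 (h1 w hw).2.1 (h1 w hw).2.2 Filter.univ_mem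
    (fun y hy _ => (h1 y hy).2.2)

/-- flat chart at `p` itself -/
lemma flat_zero [CompactSpace M] (B : HypBox f E₁ E₂ p) {α ν ε : ℝ} {x : M} (hexp : IsExpansive f α)
    (hεα : ε ≤ α) (hS : SpSet f x ν p ⊆ WsLoc f ε p) (hp : p ∈ SpSet f x ν p) :
    ∃ ρ' > 0, ρ' ≤ B.ρ ∧ ∀ y ∈ ball (0 : E₁ × E₂) ρ', B.e.symm y ∈ ball x ν ∧
        (B.e.symm y ∈ SpSet f x ν p ↔ y.2 = 0) := by
  obtain ⟨γ, hγ, h⟩ := B.local_flat hexp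
  have h0 : ∀ y, iterZ f (((0 : ℕ) : ℤ) * B.l) y = y := fun y => by simp [iterZ_zero]
  have := B.flat_core 0 hp (by rw [h0]; exact B.hsrc) (by rw [h0, B.e0, norm_zero]; linarith [B.hρ])
    (by rw [h0, B.e0]; rfl) (ball_mem_nhds p hγ)
    (fun y hy hy' => by
      rw [h0]
      exact (h y (WsLoc_mono hεα _ (hS hy)) (mem_ball'.1 hy')).2)
  obtain ⟨-, -, h3⟩ := this
  obtain ⟨ρ', hρ', -, h4⟩ := h3 univ isOpen_univ (mem_univ _)
  refine ⟨min ρ' B.ρ, lt_min hρ' B.hρ, min_le_right _ _, fun y hy => ?_⟩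
  have hEa : ((itH f (((0 : ℕ) : ℤ) * B.l)).toOpenPartialHomeomorph.trans B.e) p = 0 := by
    change B.e (itH f _ p) = 0
    rw [itH_apply, h0, B.e0]
  have hEs : ((itH f (((0 : ℕ) : ℤ) * B.l)).toOpenPartialHomeomorph.trans B.e).symm y = B.e.symm y := by
    change (itH f _).symm (B.e.symm y) = _
    rw [Homeomorph.symm_apply_eq, itH_apply, h0]
  have h5 := h4 y (by rw [hEa]; exact ball_subset_ball (min_le_left _ _) hy)
  rw [hEs] at h5
  exact ⟨h5.1.2, h5.2⟩

end HypBox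

lemma SpSet_closed {M : Type*} [MetricSpace M] [CompactSpace M] {f : M ≃ₜ M} {α ν ε : ℝ} {x p : M}
    (hexp : IsExpansive f α) (hεα : ε ≤ α) (hS : SpSet f x ν p ⊆ WsLoc f ε p) (hp : p ∈ SpSet f x ν p) :
    closure (SpSet f x ν p) ∩ ball x ν ⊆ SpSet f x ν p := by
  have hpre : IsPreconnected (SpSet f x ν p) := isPreconnected_connectedComponentIn
  have hsub : SpSet f x ν p ⊆ closure (SpSet f x ν p) ∩ ball x ν := fun y hy =>
    ⟨subset_closure hy, (connectedComponentIn_subset _ _ hy).2⟩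
  have h1 : IsPreconnected (closure (SpSet f x ν p) ∩ ball x ν) :=
    hpre.subset_closure hsub inter_subset_left
  refine h1.subset_connectedComponentIn (hsub hp) (inter_subset_inter_left _ ?_)
  intro y hy
  have hcl : IsClosed (WsLoc f ε p) :=
    (isClosed_WsLoc f ε).preimage (f := fun y : M => (p, y)) (by fun_prop)
  exact hexp.WsLoc_subset p (WsLoc_mono hεα _ (closure_minimal hS hcl hy))

lemma mem_SpSet_self {M : Type*} [MetricSpace M] (f : M ≃ₜ M) {ν : ℝ} {x p : M} (hp : p ∈ ball x ν) :
    p ∈ SpSet f x ν p := mem_connectedComponentIn ⟨Ws_refl f p, hp⟩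

lemma index_bounds {M : Type*} [MetricSpace M] [CompactSpace M] {f : M ≃ₜ M} {n r : ℕ} {p : M}
    (hn : 1 ≤ n) (hd : closure (PerH f n) = univ) (hr : r ≤ n) (hp : p ∈ PerHr f n r) :
    0 < r ∧ r < n := by
  have main : ∀ U : Set M, IsOpen U → p ∈ U →
      (∀ y ∈ U, ∀ m : ℕ, 1 ≤ m → iterZ f m y = y → y = p) → IsOpen ({p} : Set M) := by
    intro U hU hpU h
    have : U = {p} := by
      refine Subset.antisymm (fun y hy => ?_) (singleton_subset_iff.2 hpU)
      by_contra hne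
      have hV : IsOpen (U ∩ {p}ᶜ) := hU.inter isOpen_compl_singleton
      have hy' : y ∈ closure (PerH f n) := hd ▸ mem_univ y
      obtain ⟨z, hz, hzP⟩ := mem_closure_iff.1 hy' _ hV ⟨hy, hne⟩
      obtain ⟨m, hm, hm'⟩ := PerH.periodic hzP
      exact hz.2 (h z hz.1 m hm hm')
    rw [← this]; exact hU
  obtain ⟨B⟩ := PerHr.hypBox hp (ContinuousLinearEquiv.refl ℝ _) (ContinuousLinearEquiv.refl ℝ _)
  have hnt : Nontrivial ((Fin r → ℝ) × (Fin (n - r) → ℝ)) := by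
    rcases Nat.eq_zero_or_pos r with h | h
    · have : Nonempty (Fin (n - r)) := ⟨⟨0, by omega⟩⟩
      infer_instance
    · have : Nonempty (Fin r) := ⟨⟨0, h⟩⟩
      infer_instance
  constructor
  · by_contra h
    have : IsEmpty (Fin r) := ⟨fun i => by have := i.2; omega⟩
    obtain ⟨U, hU, hpU, h1⟩ := B.flip.sink_isolated
    refine B.not_isolated (main U hU hpU fun y hy m hm hym => h1 y hy m hm ?_)
    rw [iterZ_symm]
    simpa using iterZ_period f hym (-1)
  · by_contra h
    have : IsEmpty (Fin (n - r)) := ⟨fun i => by have := i.2; omega⟩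
    obtain ⟨U, hU, hpU, h1⟩ := B.sink_isolated
    exact B.not_isolated (main U hU hpU h1)

open Metric Set

/-- points reachable from `0` while staying inside the closed box -/
def Reach {M E T : Type*} [MetricSpace M] [NormedAddCommGroup E] [NormedAddCommGroup T]
    (e : OpenPartialHomeomorph M T) (ρ : ℝ) (g : E → M) (c : ℝ) : Set E :=
  {u | ∃ D : Set E, IsPreconnected D ∧ D ⊆ closedBall 0 c ∧ 0 ∈ D ∧ u ∈ D ∧
    ∀ u' ∈ D, g u' ∈ e.source ∧ ‖e (g u')‖ ≤ ρ}

lemma reach_prop {M E T : Type*} [MetricSpace M] [NormedAddCommGroup E] [NormedAddCommGroup T]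
    {e : OpenPartialHomeomorph M T} {ρ : ℝ} {g : E → M} {c : ℝ} {u : E} (h : u ∈ Reach e ρ g c) :
    ‖u‖ ≤ c ∧ g u ∈ e.source ∧ ‖e (g u)‖ ≤ ρ := by
  obtain ⟨D, -, h1, -, h2, h3⟩ := h
  exact ⟨by simpa using h1 h2, h3 u h2⟩

lemma reach_struct {M E T : Type*} [MetricSpace M] [NormedAddCommGroup E] [NormedSpace ℝ E]
    [NormedAddCommGroup T] [NormedSpace ℝ T] [FiniteDimensional ℝ T]
    {e : OpenPartialHomeomorph M T} {ρ : ℝ} {g : E → M} {c : ℝ} (hc : 0 < c)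
    (ht : closedBall 0 ρ ⊆ e.target) (hg : ContinuousOn g (closedBall 0 c))
    (h0 : g 0 ∈ e.source) (h0' : ‖e (g 0)‖ < ρ) (hR : ∀ u ∈ Reach e ρ g c, ‖u‖ < c) :
    ∃ A : Set E, IsOpen A ∧ IsPreconnected A ∧ 0 ∈ A ∧ closure A ⊆ Reach e ρ g c ∧
      (∀ u ∈ frontier A, ‖e (g u)‖ = ρ) ∧
      ContinuousOn (fun u => e (g u)) (closure A) := by
  set Q : Set M := e.source ∩ e ⁻¹' ball 0 ρ
  have hQ : IsOpen Q := e.isOpen_inter_preimage isOpen_ball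
  have hV : IsOpen (ball (0 : E) c ∩ g ⁻¹' Q) :=
    (hg.mono ball_subset_closedBall).isOpen_inter_preimage isOpen_ball hQ
  set V := ball (0 : E) c ∩ g ⁻¹' Q
  have h0V : (0 : E) ∈ V := ⟨mem_ball_self hc, h0, by simpa using h0'⟩
  set A := connectedComponentIn V 0
  have hAo : IsOpen A := hV.connectedComponentIn
  have hAp : IsPreconnected A := isPreconnected_connectedComponentIn
  have h0A : (0 : E) ∈ A := mem_connectedComponentIn h0V
  have hAV : A ⊆ V := connectedComponentIn_subset _ _
  have hclb : closure A ⊆ closedBall 0 c :=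
    closure_minimal (fun u hu => ball_subset_closedBall (hAV hu).1) isClosed_closedBall
  have hcb : IsClosed (e.symm '' closedBall 0 ρ) := by
    refine (IsCompact.image_of_continuousOn (isCompact_closedBall _ _) ?_).isClosed
    exact e.symm.continuousOn.mono ht
  have hclos : ∀ u ∈ closure A, g u ∈ e.source ∧ ‖e (g u)‖ ≤ ρ := by
    intro u hu
    have h1 : g u ∈ closure (g '' A) :=
      ((hg u (hclb hu)).mono (subset_closure.trans hclb)).mem_closure_image hu
    have h2 : g '' A ⊆ e.symm '' closedBall 0 ρ := by
      rintro _ ⟨a, ha, rfl⟩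
      refine ⟨e (g a), ball_subset_closedBall (hAV ha).2.2, e.left_inv (hAV ha).2.1⟩
    obtain ⟨y, hy, hyu⟩ := hcb.closure_subset_iff.2 h2 h1
    rw [← hyu, e.right_inv (ht hy)]
    exact ⟨e.map_target (ht hy), by simpa using hy⟩
  have hRe : closure A ⊆ Reach e ρ g c := fun u hu =>
    ⟨closure A, hAp.closure, hclb, subset_closure h0A, hu, hclos⟩
  refine ⟨A, hAo, hAp, h0A, hRe, ?_, ?_⟩
  · intro u hu
    rw [hAo.frontier_eq] at hu
    have h1 := hclos u hu.1
    refine le_antisymm h1.2 (not_lt.1 fun hlt => hu.2 ?_)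
    have huV : u ∈ V := ⟨by simpa using hR u (hRe hu.1), h1.1, by simpa using hlt⟩
    have h2 : IsOpen (connectedComponentIn V u) := hV.connectedComponentIn
    obtain ⟨a, ha1, ha2⟩ := mem_closure_iff.1 hu.1 _ h2 (mem_connectedComponentIn huV)
    have h3 := connectedComponentIn_eq ha1
    have h4 := connectedComponentIn_eq ha2
    change u ∈ connectedComponentIn V 0
    rw [h4, ← h3]
    exact mem_connectedComponentIn huV
  · exact e.continuousOn.comp (hg.mono hclb) (fun u hu => (hclos u hu).1)

lemma ball_diff_preconn {E : Type*} [NormedAddCommGroup E] [NormedSpace ℝ E] [FiniteDimensional ℝ E]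
    (hE : 1 < Module.finrank ℝ E) (a : E) {s : ℝ} (hs : 0 < s) :
    IsPreconnected (ball a s \ {a}) := by
  have hE' : 1 < Module.rank ℝ E := by
    rw [← Module.finrank_eq_rank]; exact_mod_cast hE
  have hc := (isConnected_compl_singleton_of_one_lt_rank hE' (0 : E)).isPreconnected
  -- radial homeomorphism of the space onto the ball
  let φ : E → E := fun y => a + (s / (1 + ‖y‖)) • y
  have hφ : Continuous φ := by
    have : ∀ y : E, 1 + ‖y‖ ≠ 0 := fun y => by positivity
    fun_prop (disch := exact this _)
  convert hc.image φ hφ.continuousOn using 1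
  ext w
  constructor
  · rintro ⟨hw, hwa⟩
    rw [mem_ball, dist_eq_norm] at hw
    have hwa' : w - a ≠ 0 := sub_ne_zero.2 hwa
    set b := w - a with hb
    have hpos : 0 < s - ‖b‖ := by linarith
    have hbp : 0 < ‖b‖ := norm_pos_iff.2 hwa'
    refine ⟨(1 / (s - ‖b‖)) • b, by simp [hwa', hpos.ne'], ?_⟩
    change a + _ = w
    have hn : ‖(1 / (s - ‖b‖)) • b‖ = ‖b‖ / (s - ‖b‖) := by
      rw [norm_smul, Real.norm_of_nonneg (by positivity)]; field_simp
    rw [hn, smul_smul]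
    have : s / (1 + ‖b‖ / (s - ‖b‖)) * (1 / (s - ‖b‖)) = 1 := by
      have : 1 + ‖b‖ / (s - ‖b‖) = s / (s - ‖b‖) := by field_simp; ring
      rw [this]; field_simp
    rw [this, one_smul, hb]; abel
  · rintro ⟨y, hy, rfl⟩
    have hy0 : y ≠ 0 := hy
    have hyp : 0 < ‖y‖ := norm_pos_iff.2 hy0
    refine ⟨?_, ?_⟩
    · rw [mem_ball, dist_eq_norm]
      change ‖a + (s / (1 + ‖y‖)) • y - a‖ < s
      rw [add_sub_cancel_left, norm_smul, Real.norm_of_nonneg (by positivity), div_mul_eq_mul_div,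
        div_lt_iff₀ (by positivity)]
      nlinarith
    · change ¬ (a + (s / (1 + ‖y‖)) • y = a)
      intro h
      have h1 : (s / (1 + ‖y‖)) • y = 0 := by simpa using h
      rcases smul_eq_zero.1 h1 with h2 | h2
      · have : 0 < s / (1 + ‖y‖) := by positivity
        linarith
      · exact hy0 h2

/-- a function with at most one zero on an open connected set of dimension at least two has a
constant sign -/
lemma sign_const {E : Type*} [NormedAddCommGroup E] [NormedSpace ℝ E] [FiniteDimensional ℝ E]
    (hE : 1 < Module.finrank ℝ E) {A : Set E} (hA : IsOpen A) (hAp : IsPreconnected A) {b : E → ℝ}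
    (hb : ContinuousOn b A) (hu : ∀ u ∈ A, ∀ u' ∈ A, b u = 0 → b u' = 0 → u = u') :
    ∃ σ : ℝ, (σ = 1 ∨ σ = -1) ∧ ∀ u ∈ A, 0 ≤ σ * b u := by
  have nz : ∀ S ⊆ A, IsPreconnected S → (∀ u ∈ S, b u ≠ 0) →
      ∃ σ : ℝ, (σ = 1 ∨ σ = -1) ∧ ∀ u ∈ S, 0 < σ * b u := by
    intro S hS hSp hS0
    by_cases h : ∃ u ∈ S, 0 < b u
    · obtain ⟨u, huS, hu⟩ := h
      refine ⟨1, Or.inl rfl, fun v hv => ?_⟩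
      by_contra hc
      have hc' : b v ≤ 0 := by linarith
      obtain ⟨w, hw, hw0⟩ := hSp.intermediate_value hv huS (hb.mono hS) ⟨hc', hu.le⟩
      exact hS0 w hw hw0
    · push Not at h
      refine ⟨-1, Or.inr rfl, fun v hv => ?_⟩
      have := lt_of_le_of_ne (h v hv) (hS0 v hv)
      linarith
  by_cases hz : ∃ u ∈ A, b u = 0
  · obtain ⟨u0, hu0, hb0⟩ := hz
    obtain ⟨s, hs, hsA⟩ := Metric.isOpen_iff.1 hA u0 hu0
    obtain ⟨σ, hσ, hpos⟩ := nz (ball u0 s \ {u0}) (diff_subset.trans hsA) (ball_diff_preconn hE u0 hs)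
      (fun u hu' h => hu'.2 (hu u (hsA hu'.1) u0 hu0 h hb0))
    refine ⟨σ, hσ, ?_⟩
    have hσb : ContinuousOn (fun u => σ * b u) A := continuousOn_const.mul hb
    have ho1 : IsOpen (A ∩ (fun u => σ * b u) ⁻¹' Ioi 0) := hσb.isOpen_inter_preimage hA isOpen_Ioi
    have ho2 : IsOpen (A ∩ (fun u => σ * b u) ⁻¹' Iio 0) := hσb.isOpen_inter_preimage hA isOpen_Iio
    by_contra hcon
    push Not at hcon
    obtain ⟨v, hvA, hv⟩ := hcon
    have hσ0 : σ ≠ 0 := by rcases hσ with h | h <;> rw [h] <;> norm_num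
    obtain ⟨w, hwA, hw1, hw2⟩ := hAp ((A ∩ (fun u => σ * b u) ⁻¹' Ioi 0) ∪ ball u0 s)
      (A ∩ (fun u => σ * b u) ⁻¹' Iio 0) (ho1.union isOpen_ball) ho2 (by
        intro u huA
        rcases lt_trichotomy (σ * b u) 0 with h | h | h
        · exact Or.inr ⟨huA, h⟩
        · have : u = u0 := hu u huA u0 hu0 ((mul_eq_zero.1 h).resolve_left hσ0) hb0
          exact Or.inl (Or.inr (this ▸ mem_ball_self hs))
        · exact Or.inl (Or.inl ⟨huA, h⟩))
      ⟨u0, hu0, Or.inr (mem_ball_self hs)⟩ ⟨v, hvA, hvA, hv⟩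
    have hw2' : σ * b w < 0 := hw2.2
    rcases hw1 with h | h
    · have : 0 < σ * b w := h.2
      linarith
    · by_cases hwu : w = u0
      · rw [hwu, hb0] at hw2'; simp at hw2'
      · have := hpos w ⟨h, hwu⟩
        linarith
  · push Not at hz
    obtain ⟨σ, hσ, h⟩ := nz A le_rfl hAp hz
    exact ⟨σ, hσ, fun u hu => (h u hu).le⟩

open Metric Set

/-- clamp to the unit interval -/
noncomputable def clamp01 (t : ℝ) : ℝ := max 0 (min 1 t)

lemma clamp01_cont : Continuous clamp01 := by unfold clamp01; fun_prop
lemma clamp01_nonneg (t : ℝ) : 0 ≤ clamp01 t := le_max_left _ _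
lemma clamp01_le (t : ℝ) : clamp01 t ≤ 1 := max_le zero_le_one (min_le_left _ _)
lemma clamp01_one {t : ℝ} (h : 1 ≤ t) : clamp01 t = 1 := by
  unfold clamp01; rw [min_eq_left h]; norm_num
lemma clamp01_zero {t : ℝ} (h : t ≤ 0) : clamp01 t = 0 := by
  unfold clamp01; rw [min_eq_right (h.trans zero_le_one), max_eq_left h]

lemma ext_u {M E A : Type*} [MetricSpace M] [NormedAddCommGroup E] [NormedSpace ℝ E]
    [FiniteDimensional ℝ E] (hE : 1 < Module.finrank ℝ E)
    [NormedAddCommGroup A] [NormedSpace ℝ A] [FiniteDimensional ℝ A]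
    {e : OpenPartialHomeomorph M (A × ℝ)} {ρ : ℝ} {g : E → M} {c : ℝ} (hρ : 0 < ρ) (hc : 0 < c)
    (ht : closedBall 0 ρ ⊆ e.target) (hg : ContinuousOn g (closedBall 0 c))
    (h0 : g 0 ∈ e.source) (h0' : ‖e (g 0)‖ < ρ) (h0β : |(e (g 0)).2| < ρ / 8)
    (hR : ∀ u ∈ Reach e ρ g c, ‖u‖ < c ∧ ‖(e (g u)).1‖ < ρ / 8)
    (hz : ∀ u ∈ Reach e ρ g c, ∀ u' ∈ Reach e ρ g c, (e (g u)).2 = 0 → (e (g u')).2 = 0 → u = u') :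
    ∃ (σ : ℝ) (au : E → A) (bu : E → ℝ), (σ = 1 ∨ σ = -1) ∧ Continuous au ∧ Continuous bu ∧
      (∀ u, 0 ≤ bu u) ∧ (∀ u, ‖u‖ = c → bu u = ρ) ∧ (∀ u, ‖au u‖ ≤ ρ / 8) ∧ bu 0 < ρ / 2 ∧
      (∀ u, bu u < ρ / 2 → u ∈ Reach e ρ g c ∧ e (g u) = (au u, σ * bu u)) := by
  classical
  obtain ⟨D, hDo, hDp, h0D, hDR, hDf, hDc⟩ := reach_struct hc ht hg h0 h0' (fun u hu => (hR u hu).1)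
  have hsub : D ⊆ Reach e ρ g c := subset_closure.trans hDR
  have hcβ : ContinuousOn (fun u => (e (g u)).2) (closure D) := continuous_snd.comp_continuousOn hDc
  have hca : ContinuousOn (fun u => (e (g u)).1) (closure D) := continuous_fst.comp_continuousOn hDc
  obtain ⟨σ, hσ, hpos⟩ := sign_const hE hDo hDp (hcβ.mono subset_closure)
    (fun u hu u' hu' => hz u (hsub hu) u' (hsub hu'))
  have hσσ : σ * σ = 1 := by rcases hσ with h | h <;> rw [h] <;> norm_num
  have hσabs : |σ| = 1 := by rcases hσ with h | h <;> rw [h] <;> norm_num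
  have hposcl : ∀ u ∈ closure D, 0 ≤ σ * (e (g u)).2 := by
    intro u hu
    have h1 : ContinuousWithinAt (fun u => σ * (e (g u)).2) D u :=
      ((continuousOn_const.mul hcβ) u hu).mono subset_closure
    have h2 := h1.mem_closure_image hu
    refine (isClosed_Ici (a := (0 : ℝ))).closure_subset_iff.2 ?_ h2
    rintro _ ⟨v, hv, rfl⟩
    exact hpos v hv
  have hfr : ∀ u ∈ frontier D, σ * (e (g u)).2 = ρ := by
    intro u hu
    have hucl : u ∈ closure D := frontier_subset_closure hu
    have h1 := hDf u hu
    rw [Prod.norm_def] at h1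
    have h2 := (hR u (hDR hucl)).2
    have h3 : ‖(e (g u)).2‖ = ρ := by
      rcases max_choice ‖(e (g u)).1‖ ‖(e (g u)).2‖ with h | h
      · rw [h] at h1; linarith
      · rw [h] at h1; exact h1
    rw [← abs_of_nonneg (hposcl u hucl), abs_mul, hσabs, one_mul]
    exact h3
  set bu : E → ℝ := D.piecewise (fun u => σ * (e (g u)).2) (fun _ => ρ) with hbu
  set au : E → A := D.piecewise (fun u => clamp01 (2 - 2 / ρ * (σ * (e (g u)).2)) • (e (g u)).1)
    (fun _ => 0) with hau
  have hcbu : Continuous bu := by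
    rw [← continuousOn_univ]
    refine ContinuousOn.piecewise (fun a ha => hfr a ha.2) ?_ continuousOn_const
    rw [univ_inter]
    exact continuousOn_const.mul hcβ
  have hcau : Continuous au := by
    rw [← continuousOn_univ]
    refine ContinuousOn.piecewise (fun a ha => ?_) ?_ continuousOn_const
    · rw [hfr a ha.2, clamp01_zero (by rw [div_mul_cancel₀ _ hρ.ne']; norm_num), zero_smul]
    rw [univ_inter]
    refine ContinuousOn.smul ?_ hca
    refine clamp01_cont.comp_continuousOn ?_
    exact continuousOn_const.sub (continuousOn_const.mul (continuousOn_const.mul hcβ))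
  have hbuD : ∀ u ∈ D, bu u = σ * (e (g u)).2 := fun u hu => piecewise_eq_of_mem _ _ _ hu
  have hbuN : ∀ u ∉ D, bu u = ρ := fun u hu => piecewise_eq_of_notMem _ _ _ hu
  have hauD : ∀ u ∈ D, au u = clamp01 (2 - 2 / ρ * (σ * (e (g u)).2)) • (e (g u)).1 :=
    fun u hu => piecewise_eq_of_mem _ _ _ hu
  have hauN : ∀ u ∉ D, au u = 0 := fun u hu => piecewise_eq_of_notMem _ _ _ hu
  refine ⟨σ, au, bu, hσ, hcau, hcbu, ?_, ?_, ?_, ?_, ?_⟩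
  · intro u
    by_cases hu : u ∈ D
    · rw [hbuD u hu]; exact hpos u hu
    · rw [hbuN u hu]; exact hρ.le
  · intro u hu
    apply hbuN
    intro huD
    exact absurd (hR u (hsub huD)).1 (by rw [hu]; exact lt_irrefl _)
  · intro u
    by_cases hu : u ∈ D
    · rw [hauD u hu, norm_smul, Real.norm_of_nonneg (clamp01_nonneg _)]
      refine (mul_le_of_le_one_left (norm_nonneg _) (clamp01_le _)).trans (hR u (hsub hu)).2.le
    · rw [hauN u hu, norm_zero]; positivity
  · rw [hbuD 0 h0D]
    refine (le_abs_self _).trans_lt ?_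
    rw [abs_mul, hσabs, one_mul]
    linarith
  · intro u hu
    have huD : u ∈ D := by
      by_contra h
      rw [hbuN u h] at hu; linarith
    refine ⟨hsub huD, ?_⟩
    rw [hbuD u huD] at hu
    rw [hbuD u huD, hauD u huD, clamp01_one, one_smul, ← mul_assoc, hσσ, one_mul]
    have : 2 / ρ * (σ * (e (g u)).2) ≤ 1 := by
      rw [div_mul_eq_mul_div, div_le_one hρ]; linarith
    linarith

lemma ext_s {M E : Type*} [MetricSpace M] [NormedAddCommGroup E] [NormedSpace ℝ E]
    [FiniteDimensional ℝ E] {m : ℕ} (hE : Module.finrank ℝ E < m)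
    {e : OpenPartialHomeomorph M ((Fin m → ℝ) × ℝ)} {ρ : ℝ} {g : E → M} {c : ℝ} (hρ : 0 < ρ) (hc : 0 < c)
    (ht : closedBall 0 ρ ⊆ e.target) (hg : ContinuousOn g (closedBall 0 c))
    (h0 : g 0 ∈ e.source) (h0' : ‖e (g 0)‖ < ρ) (h0a : ‖(e (g 0)).1‖ < ρ / 8)
    (hR : ∀ u ∈ Reach e ρ g c, ‖u‖ < c ∧ |(e (g u)).2| < ρ / 8) :
    ∃ (as : E → (Fin m → ℝ)) (bs μ : E → ℝ), Continuous as ∧ Continuous bs ∧ Continuous μ ∧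
      (∀ s, |bs s| ≤ ρ / 8) ∧
      (∀ s w, ‖w‖ ≤ ρ / 8 → as s = μ s • w → s ∈ Reach e ρ g c ∧ e (g s) = (as s, bs s) ∧ μ s = 1) ∧
      ∃ c1 > 0, ∀ s, ‖s‖ ≤ c1 → μ s = 1 ∧ e (g s) = (as s, bs s) := by
  classical
  obtain ⟨D, hDo, hDp, h0D, hDR, hDf, hDc⟩ := reach_struct hc ht hg h0 h0' (fun u hu => (hR u hu).1)
  have hsub : D ⊆ Reach e ρ g c := subset_closure.trans hDR
  have hcβ : ContinuousOn (fun u => (e (g u)).2) (closure D) := continuous_snd.comp_continuousOn hDc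
  have hca : ContinuousOn (fun u => (e (g u)).1) (closure D) := continuous_fst.comp_continuousOn hDc
  have hcn : ContinuousOn (fun u => ‖(e (g u)).1‖) (closure D) := continuous_norm.comp_continuousOn hca
  have hfr : ∀ u ∈ frontier D, ‖(e (g u)).1‖ = ρ := by
    intro u hu
    have hucl : u ∈ closure D := frontier_subset_closure hu
    have h1 := hDf u hu
    rw [Prod.norm_def] at h1
    have h2 : ‖(e (g u)).2‖ < ρ / 8 := (hR u (hDR hucl)).2
    rcases max_choice ‖(e (g u)).1‖ ‖(e (g u)).2‖ with h | h
    · rw [h] at h1; exact h1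
    · rw [h] at h1; linarith
  -- the nonvanishing perturbation
  obtain ⟨a2, ha2c, ha2n, ha2d⟩ : ∃ a2 : E → (Fin m → ℝ), Continuous a2 ∧ (∀ s, a2 s ≠ 0) ∧
      ∀ s ∈ closure D, ‖a2 s - (e (g s)).1‖ < ρ / 4 := by
    let fa : C(closure D, Fin m → ℝ) := ⟨fun s => (e (g s)).1, hca.restrict⟩
    obtain ⟨a1, ha1⟩ := ContinuousMap.exists_restrict_eq isClosed_closure fa
    obtain ⟨h, hh, hhd, -⟩ := a1.continuous.exists_contDiff_approx 1 (ε := fun _ => ρ / 8)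
      continuous_const (fun _ => by positivity)
    have hdense := ContDiff.dense_compl_range_of_finrank_lt_finrank hh (by simpa using hE)
    obtain ⟨v, hv, hvr⟩ := Metric.mem_closure_iff.1 (hdense 0) (ρ / 8) (by positivity)
    refine ⟨fun s => h s - v, hh.continuous.sub continuous_const, fun s hs => ?_, fun s hs => ?_⟩
    · exact hv ⟨s, sub_eq_zero.1 hs⟩
    · have h1 : a1 s = (e (g s)).1 := by
        have := DFunLike.congr_fun ha1 ⟨s, hs⟩
        exact this
      have h2 := hhd s
      rw [dist_eq_norm] at h2
      rw [dist_zero_left] at hvr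
      have h3 : h s - v - (e (g s)).1 = (h s - a1 s) - v := by rw [h1]; abel
      simp only
      rw [h3]
      have := norm_sub_le (h s - a1 s) v
      linarith
  set lam : E → ℝ := fun s => clamp01 (2 / ρ * ‖(e (g s)).1‖ - 1) with hlam
  have hclam : ContinuousOn lam (closure D) := clamp01_cont.comp_continuousOn
    ((continuousOn_const.mul hcn).sub continuousOn_const)
  have hlamfr : ∀ s ∈ frontier D, lam s = 1 := by
    intro s hs
    simp only [hlam]
    rw [hfr s hs, div_mul_cancel₀ _ hρ.ne']
    exact clamp01_one (by norm_num)
  set as : E → (Fin m → ℝ) := D.piecewise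
    (fun s => (e (g s)).1 + lam s • (a2 s - (e (g s)).1)) a2 with has
  set bs : E → ℝ := D.piecewise (fun s => clamp01 (2 - 2 / ρ * ‖(e (g s)).1‖) * (e (g s)).2)
    (fun _ => 0) with hbs
  set μ : E → ℝ := D.piecewise (fun s => 1 - lam s) (fun _ => 0) with hμ
  have hcas : Continuous as := by
    rw [← continuousOn_univ]
    refine ContinuousOn.piecewise (fun a ha => ?_) ?_ ha2c.continuousOn
    · rw [hlamfr a ha.2, one_smul]; abel
    rw [univ_inter]
    exact hca.add (hclam.smul (ha2c.continuousOn.sub hca))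
  have hcbs : Continuous bs := by
    rw [← continuousOn_univ]
    refine ContinuousOn.piecewise (fun a ha => ?_) ?_ continuousOn_const
    · rw [hfr a ha.2, clamp01_zero (by rw [div_mul_cancel₀ _ hρ.ne']; norm_num), zero_mul]
    rw [univ_inter]
    refine ContinuousOn.mul ?_ hcβ
    refine clamp01_cont.comp_continuousOn ?_
    exact continuousOn_const.sub (continuousOn_const.mul hcn)
  have hcμ : Continuous μ := by
    rw [← continuousOn_univ]
    refine ContinuousOn.piecewise (fun a ha => ?_) ?_ continuousOn_const
    · rw [hlamfr a ha.2, sub_self]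
    rw [univ_inter]
    exact continuousOn_const.sub hclam
  have hasD : ∀ s ∈ D, as s = (e (g s)).1 + lam s • (a2 s - (e (g s)).1) :=
    fun u hu => piecewise_eq_of_mem _ _ _ hu
  have hasN : ∀ s ∉ D, as s = a2 s := fun u hu => piecewise_eq_of_notMem _ _ _ hu
  have hbsD : ∀ s ∈ D, bs s = clamp01 (2 - 2 / ρ * ‖(e (g s)).1‖) * (e (g s)).2 :=
    fun u hu => piecewise_eq_of_mem _ _ _ hu
  have hbsN : ∀ s ∉ D, bs s = 0 := fun u hu => piecewise_eq_of_notMem _ _ _ hu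
  have hμD : ∀ s ∈ D, μ s = 1 - lam s := fun u hu => piecewise_eq_of_mem _ _ _ hu
  have hμN : ∀ s ∉ D, μ s = 0 := fun u hu => piecewise_eq_of_notMem _ _ _ hu
  have good : ∀ s ∈ D, ‖(e (g s)).1‖ ≤ ρ / 2 → μ s = 1 ∧ e (g s) = (as s, bs s) := by
    intro s hs hn
    have h2 : 2 / ρ * ‖(e (g s)).1‖ ≤ 1 := by
      rw [div_mul_eq_mul_div, div_le_one hρ]; linarith
    have h1 : lam s = 0 := clamp01_zero (by linarith)
    rw [hμD s hs, hasD s hs, hbsD s hs, h1, clamp01_one (by linarith), one_mul, zero_smul, add_zero]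
    exact ⟨by norm_num, rfl⟩
  refine ⟨as, bs, μ, hcas, hcbs, hcμ, ?_, ?_, ?_⟩
  · intro s
    by_cases hs : s ∈ D
    · rw [hbsD s hs, abs_mul, abs_of_nonneg (clamp01_nonneg _)]
      exact (mul_le_of_le_one_left (abs_nonneg _) (clamp01_le _)).trans (hR s (hsub hs)).2.le
    · rw [hbsN s hs, abs_zero]; positivity
  · intro s w hw heq
    have hs : s ∈ D := by
      by_contra hs
      rw [hasN s hs, hμN s hs, zero_smul] at heq
      exact ha2n s heq
    have hn : ‖(e (g s)).1‖ ≤ ρ / 2 := by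
      by_contra hcon
      push Not at hcon
      have h1 : ‖as s‖ ≤ ρ / 8 := by
        rw [heq, norm_smul, hμD s hs, Real.norm_of_nonneg (by linarith [clamp01_le (2 / ρ * ‖(e (g s)).1‖ - 1)])]
        refine (mul_le_of_le_one_left (norm_nonneg _) ?_).trans hw
        linarith [clamp01_nonneg (2 / ρ * ‖(e (g s)).1‖ - 1)]
      have h2 : ‖as s - (e (g s)).1‖ ≤ ρ / 4 := by
        rw [hasD s hs, add_sub_cancel_left, norm_smul, Real.norm_of_nonneg (clamp01_nonneg _)]
        exact (mul_le_of_le_one_left (norm_nonneg _) (clamp01_le _)).trans (ha2d s (subset_closure hs)).le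
      have h3 := norm_sub_norm_le (e (g s)).1 (as s)
      rw [norm_sub_rev] at h3
      linarith
    exact ⟨hsub hs, (good s hs hn).2, (good s hs hn).1⟩
  · have ho : IsOpen (D ∩ (fun s => ‖(e (g s)).1‖) ⁻¹' Iio (ρ / 2)) :=
      (hcn.mono subset_closure).isOpen_inter_preimage hDo isOpen_Iio
    have hmem : (0 : E) ∈ D ∩ (fun s => ‖(e (g s)).1‖) ⁻¹' Iio (ρ / 2) :=
      ⟨h0D, by simp only [mem_preimage, mem_Iio]; linarith⟩
    obtain ⟨c1, hc1, hsubc⟩ := Metric.nhds_basis_closedBall.mem_iff.1 (ho.mem_nhds hmem)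
    refine ⟨c1, hc1, fun s hs => ?_⟩
    have h1 := hsubc (mem_closedBall_zero_iff.2 hs)
    exact good s h1.1 (le_of_lt h1.2)

lemma no_crossing {M E₁ E₂ : Type*} [MetricSpace M] [NormedAddCommGroup E₁] [NormedSpace ℝ E₁]
    [FiniteDimensional ℝ E₁] [NormedAddCommGroup E₂] [NormedSpace ℝ E₂]
    [FiniteDimensional ℝ E₂] {m : ℕ} (hE₁ : Module.finrank ℝ E₁ < m) (hE₂ : 1 < Module.finrank ℝ E₂)
    {e : OpenPartialHomeomorph M ((Fin m → ℝ) × ℝ)} {ρ : ℝ} {gs : E₁ → M} {gu : E₂ → M} {c : ℝ}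
    (hρ : 0 < ρ) (hc : 0 < c)
    (ht : closedBall 0 ρ ⊆ e.target) (hgs : ContinuousOn gs (closedBall 0 c))
    (hgu : ContinuousOn gu (closedBall 0 c)) (h00 : gs 0 = gu 0)
    (h0 : gu 0 ∈ e.source) (h0' : ‖e (gu 0)‖ < ρ / 8)
    (hRu : ∀ u ∈ Reach e ρ gu c, ‖u‖ < c ∧ ‖(e (gu u)).1‖ < ρ / 8)
    (hRs : ∀ u ∈ Reach e ρ gs c, ‖u‖ < c ∧ |(e (gs u)).2| < ρ / 8)
    (hz : ∀ u ∈ Reach e ρ gu c, ∀ u' ∈ Reach e ρ gu c, (e (gu u)).2 = 0 → (e (gu u')).2 = 0 → u = u')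
    (hsu : ∀ s ∈ Reach e ρ gs c, ∀ u ∈ Reach e ρ gu c, gs s = gu u → s = 0 ∧ u = 0)
    (Ψ : OpenPartialHomeomorph (E₁ × E₂) M) (hΨ : 0 ∈ Ψ.source)
    (hloc : ∃ c1 > 0, ∀ s u, ‖s‖ ≤ c1 → ‖u‖ ≤ c1 → gs s = Ψ (s, 0) ∧ gu u = Ψ (0, u)) : False := by
  have hb : ∀ y : (Fin m → ℝ) × ℝ, ‖y‖ < ρ / 8 → ‖y.1‖ < ρ / 8 ∧ |y.2| < ρ / 8 := fun y hy =>
    ⟨(norm_fst_le y).trans_lt hy, (norm_snd_le y).trans_lt hy⟩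
  obtain ⟨σ, au, bu, hσ, hcau, hcbu, hbu0, hbuc, hau, hbu00, hU⟩ :=
    ext_u hE₂ hρ hc ht hgu h0 (by linarith) (hb _ h0').2 hRu hz
  obtain ⟨as, bs, μ, hcas, hcbs, hcμ, hbs, hS3, cs, hcs, hS4⟩ :=
    ext_s hE₁ hρ hc ht hgs (h00 ▸ h0) (by rw [h00]; linarith) (by rw [h00]; exact (hb _ h0').1) hRs
  obtain ⟨cl, hcl, hloc⟩ := hloc
  have hσabs : |σ| = 1 := by rcases hσ with h | h <;> rw [h] <;> norm_num
  let F : E₁ × E₂ → (Fin m → ℝ) × ℝ := fun y => (μ y.1 • au y.2 - as y.1, σ * bu y.2 - bs y.1)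
  have hF1 : ∀ y (t : ℝ), F y + t • ((0 : Fin m → ℝ), 2 * σ * ρ) = 0 →
      y.1 ∈ Reach e ρ gs c ∧ e (gs y.1) = (as y.1, bs y.1) ∧ μ y.1 = 1 ∧
        σ * (bu y.2 + 2 * t * ρ) = bs y.1 := by
    intro y t h
    have h1 := congrArg Prod.fst h
    have h2 := congrArg Prod.snd h
    simp only [F, Prod.fst_add, Prod.smul_fst, smul_zero, add_zero, Prod.fst_zero,
      Prod.snd_add, Prod.smul_snd, Prod.snd_zero, smul_eq_mul] at h1 h2
    obtain ⟨h3, h4, h5⟩ := hS3 y.1 (au y.2) (hau _) (sub_eq_zero.1 h1).symm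
    exact ⟨h3, h4, h5, by linarith⟩
  have hnn : ∀ y (t : ℝ), 0 ≤ t → F y + t • ((0 : Fin m → ℝ), 2 * σ * ρ) = 0 →
      bu y.2 + 2 * t * ρ ≤ ρ / 8 := by
    intro y t ht h
    have h1 := (hF1 y t h).2.2.2
    have h2 := hbs y.1
    rw [← h1, abs_mul, hσabs, one_mul, abs_of_nonneg (by have := hbu0 y.2; positivity)] at h2
    exact h2
  refine degree_lemma (Ψ.trans e) ?_ c hc F ?_ ?_ ?_ ((0 : Fin m → ℝ), 2 * σ * ρ) ?_ ?_
  · rw [OpenPartialHomeomorph.trans_source]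
    refine ⟨hΨ, ?_⟩
    have := (hloc 0 0 (by simpa using hcl.le) (by simpa using hcl.le)).2
    change Ψ (0, 0) ∈ e.source
    rw [← this]; exact h0
  · apply Continuous.continuousOn
    change Continuous fun y : E₁ × E₂ => (μ y.1 • au y.2 - as y.1, σ * bu y.2 - bs y.1)
    fun_prop
  · intro y hy hF
    have hF' : F y + (0 : ℝ) • ((0 : Fin m → ℝ), 2 * σ * ρ) = 0 := by rw [zero_smul, add_zero, hF]
    obtain ⟨h1, h2, h3, h4⟩ := hF1 y 0 hF'
    have h5 := hnn y 0 le_rfl hF'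
    obtain ⟨h6, h7⟩ := hU y.2 (by linarith)
    have h8 : μ y.1 • au y.2 - as y.1 = 0 := congrArg Prod.fst hF
    rw [h3, one_smul, sub_eq_zero] at h8
    have h9 : e (gs y.1) = e (gu y.2) := by
      rw [h2, h7, h8, ← h4]; simp
    have h10 := e.injOn (reach_prop h1).2.1 (reach_prop h6).2.1 h9
    obtain ⟨h11, h12⟩ := hsu _ h1 _ h6 h10
    exact Prod.ext h11 h12
  · have ho : IsOpen (bu ⁻¹' Iio (ρ / 2)) := isOpen_Iio.preimage hcbu
    obtain ⟨cu, hcu, hcu'⟩ := Metric.nhds_basis_closedBall.mem_iff.1 (ho.mem_nhds (x := 0) hbu00)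
    refine ⟨min cl (min cs cu), by positivity, fun y hy => ?_⟩
    have hy1 : ‖y.1‖ ≤ _ := (norm_fst_le y).trans hy
    have hy2 : ‖y.2‖ ≤ _ := (norm_snd_le y).trans hy
    have h1 := hloc y.1 y.2 (hy1.trans (min_le_left _ _)) (hy2.trans (min_le_left _ _))
    have h2 := hS4 y.1 (hy1.trans ((min_le_right _ _).trans (min_le_left _ _)))
    have h3 := hU y.2 (hcu' (mem_closedBall_zero_iff.2
      (hy2.trans ((min_le_right _ _).trans (min_le_right _ _)))))
    change (μ y.1 • au y.2 - as y.1, σ * bu y.2 - bs y.1) = e (Ψ (0, y.2)) - e (Ψ (y.1, 0))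
    rw [← h1.1, ← h1.2, h2.2, h3.2, h2.1, one_smul]
    rfl
  · intro y hy t ht' h
    have h1 := hF1 y t h
    have h2 := hnn y t ht'.1 h
    rw [Prod.norm_def] at hy
    rcases max_choice ‖y.1‖ ‖y.2‖ with h' | h'
    · rw [h'] at hy
      have := (hRs _ h1.1).1
      linarith
    · rw [h'] at hy
      rw [hbuc _ hy] at h2
      have := mul_nonneg ht'.1 hρ.le
      linarith
  · intro y hy h
    have h2 := hnn y 1 zero_le_one (by rw [one_smul]; exact h)
    have := hbu0 y.2
    linarith

open Metric Set

/-- the standing assumptions -/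
structure Setting {M : Type*} [MetricSpace M] (f : M ≃ₜ M) (n : ℕ) (x : M) (α ε ν : ℝ) : Prop where
  hexp : IsExpansive f α
  hε : 0 < ε
  hεα : 2 * ε < α
  hi : ∀ p ∈ PerH f n ∩ Metric.ball x ν,
      SpSet f x ν p ⊆ WsLoc f ε p ∧ UpSet f x ν p ⊆ WuLoc f ε p
  hii : ∀ p ∈ PerHr f n (n - 1) ∩ Metric.ball x ν,
      ∃ V₁ V₂ : Set M, TwoComponents (Metric.ball x ν \ SpSet f x ν p) V₁ V₂
  hdense : closure (PerH f n) = Set.univ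
  hn : 1 ≤ n

lemma UpSet_symm {M : Type*} [MetricSpace M] (f : M ≃ₜ M) (x : M) (ν : ℝ) (p : M) :
    UpSet f.symm x ν p = SpSet f x ν p := by
  unfold UpSet SpSet
  rw [← Ws_symm_homeo f.symm]
  rfl

lemma HypBox.reach_WuLoc {M : Type*} [MetricSpace M] [CompactSpace M] {f : M ≃ₜ M} {E₁ E₂ T : Type*}
    [NormedAddCommGroup E₁] [NormedSpace ℝ E₁] [NormedAddCommGroup E₂] [NormedSpace ℝ E₂]
    [NormedAddCommGroup T]
    {r x : M} (B : HypBox f E₁ E₂ r) (K : ℕ) {e : OpenPartialHomeomorph M T} {ρ ν ε : ℝ}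
    (hb : e.symm '' closedBall 0 ρ ⊆ ball x ν) (hU : UpSet f x ν r ⊆ WuLoc f ε r) {u : E₂}
    (hu : u ∈ Reach e ρ (B.gu K) B.ρ) : B.gu K u ∈ WuLoc f ε r := by
  obtain ⟨D, hD, hDb, h0, huD, h⟩ := hu
  apply hU
  have h1 : IsPreconnected (B.gu K '' D) := hD.image _ ((B.gu_cont K).mono hDb)
  refine h1.subset_connectedComponentIn ⟨0, h0, B.gu_zero K⟩ ?_ ⟨u, huD, rfl⟩
  rintro _ ⟨v, hvD, rfl⟩
  refine ⟨B.gu_mem K (by simpa using hDb hvD), hb ⟨e (B.gu K v), ?_, e.left_inv (h v hvD).1⟩⟩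
  simpa using (h v hvD).2

/-- uniform thinness of nearby local unstable sets -/
lemma thin {M T : Type*} [MetricSpace M] [CompactSpace M] [TopologicalSpace T] (R : Set (M × M)) (hR : IsClosed R)
    (g : T → M) (Y : Set T) (hY : IsCompact Y) (hg : ContinuousOn g Y) (q : M)
    (h : ∀ y ∈ Y, (q, g y) ∉ R) : ∃ θ > 0, ∀ r, dist q r < θ → ∀ y ∈ Y, (r, g y) ∉ R := by
  have h1 : IsClosed (Prod.fst '' (R ∩ univ ×ˢ (g '' Y))) :=
    isClosedMap_fst_of_compactSpace _ (hR.inter (isClosed_univ.prod (hY.image_of_continuousOn hg).isClosed))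
  have h2 : q ∈ (Prod.fst '' (R ∩ univ ×ˢ (g '' Y)))ᶜ := by
    rintro ⟨⟨a, b⟩, ⟨hab, -, y, hy, hyb⟩, rfl⟩
    simp only at hyb
    subst hyb
    exact h y hy hab
  obtain ⟨θ, hθ, h3⟩ := Metric.isOpen_iff.1 h1.isOpen_compl q h2
  refine ⟨θ, hθ, fun r hr y hy hc => h3 (mem_ball'.2 hr) ⟨(r, g y), ⟨hc, mem_univ _, y, hy, rfl⟩, rfl⟩⟩

lemma Setting.index_local {M : Type*} [MetricSpace M] [CompactSpace M] {f : M ≃ₜ M} {n : ℕ} {x : M}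
    {α ε ν : ℝ} (S : Setting f n x α ε ν) {q : M} (hq : q ∈ PerHr f n (n - 1)) (hqν : q ∈ ball x ν) :
    ∃ O : Set M, IsOpen O ∧ q ∈ O ∧ ∀ r ∈ PerH f n, r ∈ O → r ∈ PerHr f n (n - 1) := by
  have hε := S.hε
  have hεα := S.hεα
  have hεα1 : ε ≤ α := by linarith
  have hn := S.hn
  obtain ⟨B⟩ := PerHr.hypBox hq (ContinuousLinearEquiv.refl ℝ _)
    (E₂ := ℝ) (ContinuousLinearEquiv.ofFinrankEq (by simp; omega))
  have hqS := S.hi q ⟨PerHr.subset_PerH (by omega) hq, hqν⟩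
  obtain ⟨ρ1, hρ1, hρ1B, hflat⟩ := B.flat_zero S.hexp hεα1 hqS.1 (mem_SpSet_self f hqν)
  obtain ⟨γs, hγs, hs⟩ := B.local_flat S.hexp
  obtain ⟨γu, hγu, hu⟩ := B.flip.local_flat S.hexp.symm
  obtain ⟨ρ2, hρ2, hρ2b⟩ : ∃ ρ2 > 0, ∀ y ∈ ball (0 : (Fin (n - 1) → ℝ) × ℝ) ρ2,
      dist q (B.e.symm y) < min γs γu := by
    have h0 : (0 : (Fin (n - 1) → ℝ) × ℝ) ∈ B.e.target := B.htgt (by simpa using B.hρ.le)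
    have h1 : B.e.symm ⁻¹' ball q (min γs γu) ∈ nhds (0 : (Fin (n - 1) → ℝ) × ℝ) := by
      refine (B.e.symm.continuousAt h0).preimage_mem_nhds ?_
      have : B.e.symm 0 = q := B.symm0
      rw [this]; exact ball_mem_nhds _ (lt_min hγs hγu)
    obtain ⟨ρ2, hρ2, h2⟩ := Metric.mem_nhds_iff.1 h1
    exact ⟨ρ2, hρ2, fun y hy => mem_ball'.1 (h2 hy)⟩
  obtain ⟨ρ, hρ, hρ1', hρ2'⟩ : ∃ ρ > 0, ρ < ρ1 ∧ ρ < ρ2 :=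
    ⟨min ρ1 ρ2 / 2, by positivity, by have := min_le_left ρ1 ρ2; linarith [lt_min hρ1 hρ2],
      by have := min_le_right ρ1 ρ2; linarith [lt_min hρ1 hρ2]⟩
  have ht : closedBall 0 ρ ⊆ B.e.target :=
    (closedBall_subset_closedBall (by linarith)).trans B.htgt
  have hbox : B.e.symm '' closedBall 0 ρ ⊆ ball x ν := by
    rintro _ ⟨y, hy, rfl⟩
    exact (hflat y (closedBall_subset_ball hρ1' hy)).1
  have hcomp : ∀ g : (Fin (n - 1) → ℝ) × ℝ → ℝ, Continuous g →
      IsCompact (closedBall (0 : (Fin (n - 1) → ℝ) × ℝ) ρ ∩ {y | ρ / 8 ≤ g y}) := fun g hg =>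
    (isCompact_closedBall _ _).inter_right (isClosed_le continuous_const hg)
  have hcs : ContinuousOn B.e.symm (closedBall 0 ρ) := B.e.symm.continuousOn.mono ht
  obtain ⟨θu, hθu, thu⟩ := thin _ (isClosed_WuLoc f ε) B.e.symm _ (hcomp (fun y => ‖y.1‖) (by fun_prop))
    (hcs.mono inter_subset_left) q (by
      rintro y ⟨hy, hy'⟩ hyW
      have h1 := (hu (B.e.symm y) (by
        rw [WsLoc_symm_homeo]; exact WuLoc_mono hεα1 _ hyW)
        ((hρ2b y (closedBall_subset_ball hρ2' hy)).trans_le (min_le_right _ _))).2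
      change (B.e (B.e.symm y)).1 = 0 at h1
      rw [B.e.right_inv (ht hy)] at h1
      change ρ / 8 ≤ ‖y.1‖ at hy'
      rw [h1, norm_zero] at hy'
      linarith)
  obtain ⟨θs, hθs, ths⟩ := thin _ (isClosed_WsLoc f ε) B.e.symm _ (hcomp (fun y => |y.2|) (by fun_prop))
    (hcs.mono inter_subset_left) q (by
      rintro y ⟨hy, hy'⟩ hyW
      have h1 := (hs (B.e.symm y) (WsLoc_mono hεα1 _ hyW)
        ((hρ2b y (closedBall_subset_ball hρ2' hy)).trans_le (min_le_left _ _))).2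
      rw [B.e.right_inv (ht hy)] at h1
      change ρ / 8 ≤ |y.2| at hy'
      rw [h1, abs_zero] at hy'
      linarith)
  obtain ⟨θ, hθ, hball⟩ := B.exists_ball (s := ρ / 8) (by positivity)
  refine ⟨ball q (min θ (min θu θs)), isOpen_ball, mem_ball_self (by positivity), fun r hr hrO => ?_⟩
  have hrd := mem_ball'.1 hrO
  have hr1 := hball r (hrd.trans_le (min_le_left _ _))
  have hru := thu r (hrd.trans_le ((min_le_right _ _).trans (min_le_left _ _)))
  have hrs := ths r (hrd.trans_le ((min_le_right _ _).trans (min_le_right _ _)))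
  have hrν : r ∈ ball x ν := hbox ⟨B.e r, by
    rw [mem_closedBall_zero_iff]; linarith [hr1.2], B.e.left_inv hr1.1⟩
  have hri := S.hi r ⟨hr, hrν⟩
  have hrP := hr
  simp only [PerH, mem_iUnion] at hrP
  obtain ⟨k, hk, hrk⟩ := hrP
  have hkn : k ≤ n := by simpa [Nat.lt_succ_iff] using hk
  have hkb := index_bounds hn S.hdense hkn hrk
  by_contra hcon
  have hk1 : k < n - 1 := by
    rcases Nat.lt_or_ge k (n - 1) with h | h
    · exact h
    · exact absurd (by rwa [show k = n - 1 by omega] at hrk) hcon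
  obtain ⟨R⟩ := PerHr.hypBox hrk (ContinuousLinearEquiv.refl ℝ _) (ContinuousLinearEquiv.refl ℝ _)
  obtain ⟨Ku, hKu⟩ := R.gu_exit S.hexp
  obtain ⟨Ks, hKs⟩ := R.flip.gu_exit S.hexp.symm
  have hRρ : R.flip.ρ = R.ρ := rfl
  have hWu : ∀ u ∈ Reach B.e ρ (R.gu Ku) R.ρ, R.gu Ku u ∈ WuLoc f ε r := fun u hu =>
    R.reach_WuLoc Ku hbox hri.2 hu
  have hWs : ∀ s ∈ Reach B.e ρ (R.flip.gu Ks) R.ρ, R.flip.gu Ks s ∈ WsLoc f ε r := fun s hs => by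
    rw [← WuLoc_symm_homeo]
    refine R.flip.reach_WuLoc Ks hbox ?_ hs
    rw [UpSet_symm, WuLoc_symm_homeo]; exact hri.1
  have hue : ∀ u ∈ Reach B.e ρ (R.gu Ku) R.ρ, B.e (R.gu Ku u) ∈ closedBall 0 ρ ∧
      B.e.symm (B.e (R.gu Ku u)) = R.gu Ku u := fun u hu =>
    ⟨by simpa using (reach_prop hu).2.2, B.e.left_inv (reach_prop hu).2.1⟩
  have hse : ∀ s ∈ Reach B.e ρ (R.flip.gu Ks) R.ρ, B.e (R.flip.gu Ks s) ∈ closedBall 0 ρ ∧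
      B.e.symm (B.e (R.flip.gu Ks s)) = R.flip.gu Ks s := fun u hu =>
    ⟨by simpa using (reach_prop hu).2.2, B.e.left_inv (reach_prop hu).2.1⟩
  have hlt_u : ∀ u ∈ Reach B.e ρ (R.gu Ku) R.ρ, ‖u‖ < R.ρ := fun u hu =>
    lt_of_le_of_ne (reach_prop hu).1 fun h => hKu u h (WuLoc_mono hεα1 _ (hWu u hu))
  have hlt_s : ∀ u ∈ Reach B.e ρ (R.flip.gu Ks) R.ρ, ‖u‖ < R.ρ := fun u hu =>
    lt_of_le_of_ne (reach_prop hu).1 fun h => hKs u h (by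
      rw [WuLoc_symm_homeo]; exact WsLoc_mono hεα1 _ (hWs u hu))
  let scale : (Fin k → ℝ) × (Fin (n - k) → ℝ) ≃ₜ (Fin k → ℝ) × (Fin (n - k) → ℝ) :=
    (Homeomorph.smulOfNeZero ((2 : ℝ) ^ Ks) (by positivity)).prodCongr
      (Homeomorph.smulOfNeZero ((2 : ℝ) ^ Ku) (by positivity))
  have hscale : ∀ s u, scale (s, u) = ((2 : ℝ) ^ Ks • s, (2 : ℝ) ^ Ku • u) := fun s u => rfl
  refine no_crossing (m := n - 1) (c := R.ρ) (gs := R.flip.gu Ks) (gu := R.gu Ku) (e := B.e) (ρ := ρ)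
    ?_ ?_ hρ R.hρ ht (R.flip.gu_cont Ks) (R.gu_cont Ku) ?_ ?_ ?_ ?_ ?_ ?_ ?_
    (scale.toOpenPartialHomeomorph.trans R.e.symm) ?_ ?_
  · simpa using hk1
  · simp; omega
  · rw [R.gu_zero, R.flip.gu_zero]
  · rw [R.gu_zero]; exact hr1.1
  · rw [R.gu_zero]; exact hr1.2
  · intro u hu
    refine ⟨hlt_u u hu, ?_⟩
    by_contra hc
    refine hru _ ⟨(hue u hu).1, not_lt.1 hc⟩ ?_
    change B.e.symm _ ∈ WuLoc f ε r
    rw [(hue u hu).2]; exact hWu u hu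
  · intro u hu
    refine ⟨hlt_s u hu, ?_⟩
    by_contra hc
    refine hrs _ ⟨(hse u hu).1, not_lt.1 hc⟩ ?_
    change B.e.symm _ ∈ WsLoc f ε r
    rw [(hse u hu).2]; exact hWs u hu
  · have hst : ∀ u ∈ Reach B.e ρ (R.gu Ku) R.ρ, (B.e (R.gu Ku u)).2 = 0 → R.gu Ku u ∈ WsLoc f ε q := by
      intro u hu h0
      have h1 := (hflat _ (closedBall_subset_ball hρ1' (hue u hu).1)).2.2 h0
      rw [(hue u hu).2] at h1
      exact hqS.1 h1
    intro u hu u' hu' h0 h0'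
    refine R.gu_inj Ku (by simpa using (hlt_u u hu).le) (by simpa using (hlt_u u' hu').le) ?_
    refine S.hexp.eq (a := ε + ε) (b := ε + ε) (by linarith) (by linarith) ?_ ?_
    · exact WsLoc_tri (WsLoc_comm (hst u hu h0)) (hst u' hu' h0')
    · exact WuLoc_tri (WuLoc_comm (hWu u hu)) (hWu u' hu')
  · intro s hs u hu heq
    have h1 : r = R.gu Ku u := S.hexp.eq hεα1 hεα1 (heq ▸ hWs s hs) (hWu u hu)
    constructor
    · refine R.flip.gu_inj Ks (by simpa [hRρ] using (hlt_s s hs).le) (by simpa [hRρ] using R.hρ.le) ?_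
      rw [R.flip.gu_zero, heq, ← h1]
    · refine R.gu_inj Ku (by simpa using (hlt_u u hu).le) (by simpa using R.hρ.le) ?_
      rw [R.gu_zero, ← h1]
  · rw [OpenPartialHomeomorph.trans_source]
    refine ⟨trivial, ?_⟩
    change scale (0, 0) ∈ R.e.target
    rw [hscale, smul_zero, smul_zero]
    exact R.mem_tgt (by simpa using R.hρ.le) (by simpa using R.hρ.le)
  · have hRp := R.hρ
    refine ⟨min (R.ρ / 2 ^ Ks) (R.ρ / 2 ^ Ku), by positivity, fun s u hs hu => ?_⟩
    have hs' := hs.trans (min_le_left _ _)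
    have hu' := hu.trans (min_le_right _ _)
    rw [le_div_iff₀ (by positivity)] at hs' hu'
    constructor
    · rw [R.flip.gu_small Ks (by
        rw [norm_smul, norm_pow, Real.norm_of_nonneg zero_le_two, mul_comm]; exact hs')]
      change R.e.symm ((2 : ℝ) ^ Ks • s, 0) = R.e.symm (scale (s, 0))
      rw [hscale, smul_zero]
    · rw [R.gu_small Ku (by
        rw [norm_smul, norm_pow, Real.norm_of_nonneg zero_le_two, mul_comm]; exact hu')]
      change R.e.symm (0, (2 : ℝ) ^ Ku • u) = R.e.symm (scale (0, u))
      rw [hscale, smul_zero]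

lemma PerHr_iter {M : Type*} [MetricSpace M] {f : M ≃ₜ M} {n r : ℕ} {p : M} (hp : p ∈ PerHr f n r) (k : ℤ) :
    iterZ f k p ∈ PerHr f n r := by
  obtain ⟨l, hl, hlp, U, V, h, hU, hV, h0V, hpU, hp0, hconj⟩ := hp
  have hcomm : ∀ z, (f.toEquiv ^ l) (iterZ f k z) = iterZ f k ((f.toEquiv ^ l) z) := by
    intro z
    rw [← iterZ_natCast, ← iterZ_natCast, ← iterZ_add, ← iterZ_add, add_comm]
  have hg : ∀ z, itH f k z = iterZ f k z := itH_apply f k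
  refine ⟨l, hl, by rw [hcomm, hlp], itH f k '' U, V, ((itH f k).image U).symm.trans h,
    (itH f k).isOpenMap _ hU, hV, h0V, ⟨p, hpU, hg p⟩, ?_, ?_⟩
  · have : ((itH f k).image U).symm ⟨iterZ f k p, ⟨p, hpU, hg p⟩⟩ = ⟨p, hpU⟩ := by
      rw [Homeomorph.symm_apply_eq]
      exact Subtype.ext (hg p).symm
    rw [Homeomorph.trans_apply, this, hp0]
  · rintro z ⟨y, hy, rfl⟩ ⟨y', hy', hyy'⟩
    have hy'eq : y' = (f.toEquiv ^ l) y := by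
      apply (itH f k).injective
      rw [hyy', hg, hg, hcomm]
    subst hy'eq
    have e1 : ((itH f k).image U).symm ⟨itH f k y, ⟨y, hy, rfl⟩⟩ = ⟨y, hy⟩ := by
      rw [Homeomorph.symm_apply_eq]; rfl
    have e2 : ((itH f k).image U).symm ⟨(f.toEquiv ^ l) (itH f k y), ⟨_, hy', hyy'⟩⟩ =
        ⟨(f.toEquiv ^ l) y, hy'⟩ := by
      rw [Homeomorph.symm_apply_eq]; exact Subtype.ext hyy'.symm
    rw [Homeomorph.trans_apply, Homeomorph.trans_apply, e1, e2]
    exact hconj y hy hy'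

lemma PerH_iter {M : Type*} [MetricSpace M] {f : M ≃ₜ M} {n : ℕ} {p : M} (hp : p ∈ PerH f n) (k : ℤ) :
    iterZ f k p ∈ PerH f n := by
  simp only [PerH, mem_iUnion] at hp ⊢
  obtain ⟨r, hr, h⟩ := hp
  exact ⟨r, hr, PerHr_iter h k⟩

lemma Setting.index_local' {M : Type*} [MetricSpace M] [CompactSpace M] {f : M ≃ₜ M} {n : ℕ} {x : M}
    {α ε ν : ℝ} (S : Setting f n x α ε ν) {q : M} (hq : q ∈ PerHr f n (n - 1)) (hqν : q ∈ ball x ν)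
    {w : M} (hw : w ∈ Ws f q ∪ Wu f q) :
    ∃ O : Set M, IsOpen O ∧ w ∈ O ∧ ∀ r ∈ PerH f n, r ∈ O → r ∈ PerHr f n (n - 1) := by
  obtain ⟨O, hO, hqO, h⟩ := S.index_local hq hqν
  obtain ⟨l, hl, hlq⟩ := PerHr.periodic hq
  obtain ⟨k, hk⟩ : ∃ k : ℤ, iterZ f k w ∈ O := by
    obtain ⟨θ, hθ, hθO⟩ := Metric.isOpen_iff.1 hO q hqO
    rcases hw with hw | hw
    · obtain ⟨N, hN⟩ := Metric.tendsto_atTop.1 hw θ hθ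
      refine ⟨|N| * l, hθO ?_⟩
      have h1 := hN (|N| * l) (by
        have : |N| * 1 ≤ |N| * (l : ℤ) := mul_le_mul_of_nonneg_left (by exact_mod_cast hl) (abs_nonneg _)
        have := le_abs_self N
        linarith)
      rw [iterZ_period f hlq, Real.dist_0_eq_abs, abs_of_nonneg dist_nonneg] at h1
      exact mem_ball'.2 h1
    · rw [← Ws_symm_homeo] at hw
      obtain ⟨N, hN⟩ := Metric.tendsto_atTop.1 hw θ hθ
      refine ⟨-(|N| * l), hθO ?_⟩
      have h1 := hN (|N| * l) (by
        have : |N| * 1 ≤ |N| * (l : ℤ) := mul_le_mul_of_nonneg_left (by exact_mod_cast hl) (abs_nonneg _)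
        have := le_abs_self N
        linarith)
      rw [iterZ_symm, iterZ_symm, ← neg_mul, iterZ_period f hlq, Real.dist_0_eq_abs,
        abs_of_nonneg dist_nonneg] at h1
      rw [← neg_mul]
      exact mem_ball'.2 h1
  refine ⟨iterZ f k ⁻¹' O, iterZ_isOpen_image f k hO, hk, fun r hr hrO => ?_⟩
  have := PerHr_iter (h _ (PerH_iter hr k) hrO) (-k)
  rwa [iterZ_neg_cancel] at this

open Metric Set

/-- connected piece of local unstable set joining `r` to a point at distance `η` -/
def GoodArc {M : Type*} [MetricSpace M] (f : M ≃ₜ M) (ε : ℝ) (r : M) (η : ℝ) (T : Set M) (e : M) : Prop :=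
  IsPreconnected T ∧ r ∈ T ∧ e ∈ T ∧ dist e r = η ∧ T ⊆ WuLoc f ε r ∩ closedBall r η

lemma HypBox.goodArc {M : Type*} [MetricSpace M] {f : M ≃ₜ M} {E₁ E₂ : Type*}
    [NormedAddCommGroup E₁] [NormedSpace ℝ E₁] [NormedAddCommGroup E₂] [NormedSpace ℝ E₂]
    {p : M} (B : HypBox f E₁ E₂ p) {ε η : ℝ} {K : ℕ} {v : E₂} (hv : ‖v‖ = 1) {t : ℝ}
    (ht : t ∈ Ioc 0 B.ρ)
    (h : ∀ s ∈ Icc 0 t, B.gu K (s • v) ∈ WuLoc f ε p ∧ dist (B.gu K (s • v)) p ≤ η)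
    (h' : dist (B.gu K (t • v)) p = η) :
    GoodArc f ε p η ((fun s : ℝ => B.gu K (s • v)) '' Icc 0 t) (B.gu K (t • v)) := by
  refine ⟨isPreconnected_Icc.image _ ?_, ⟨0, ⟨le_rfl, ht.1.le⟩, ?_⟩, ⟨t, ⟨ht.1.le, le_rfl⟩, rfl⟩, h', ?_⟩
  · refine (B.gu_cont K).comp (by fun_prop) ?_
    intro s hs
    rw [mem_closedBall_zero_iff, norm_smul, hv, mul_one, Real.norm_eq_abs, abs_of_nonneg hs.1]
    exact hs.2.trans ht.2
  · simp [B.gu_zero]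
  · rintro _ ⟨s, hs, rfl⟩
    exact ⟨(h s hs).1, mem_closedBall.2 (h s hs).2⟩

lemma Setting.two_arcs {M : Type*} [MetricSpace M] [CompactSpace M] {f : M ≃ₜ M} {n : ℕ} {x : M}
    {α ε ν : ℝ} (S : Setting f n x α ε ν) {r : M} (hr : r ∈ PerH f n) {η : ℝ} (hη : 0 < η)
    (hb : closedBall r η ⊆ ball x ν) :
    ∃ T₁ e₁ T₂ e₂, GoodArc f ε r η T₁ e₁ ∧ GoodArc f ε r η T₂ e₂ ∧ T₁ ∩ T₂ ⊆ {r} := by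
  have hεα1 : ε ≤ α := by linarith [S.hε, S.hεα]
  have hr' := hr
  simp only [PerH, mem_iUnion, Finset.mem_range] at hr'
  obtain ⟨k, hk, hkr⟩ := hr'
  have hb' := index_bounds S.hn S.hdense (by omega) hkr
  obtain ⟨B⟩ := PerHr.hypBox hkr (ContinuousLinearEquiv.refl ℝ _) (ContinuousLinearEquiv.refl ℝ _)
  have hne : Nonempty (Fin (n - k)) := ⟨⟨0, by omega⟩⟩
  obtain ⟨v, hv⟩ := exists_norm_eq (Fin (n - k) → ℝ) (zero_le_one)
  obtain ⟨K, hK⟩ := B.gu_exit S.hexp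
  have hrν : r ∈ ball x ν := hb (mem_closedBall_self hη.le)
  have hU := (S.hi r ⟨hr, hrν⟩).2
  obtain ⟨t₁, ht₁, h₁, h₁'⟩ := B.arc hεα1 hK hU hη hb hv
  obtain ⟨t₂, ht₂, h₂, h₂'⟩ := B.arc hεα1 hK hU hη hb (v := -v) (by rwa [norm_neg])
  refine ⟨_, _, _, _, B.goodArc hv ht₁ h₁ h₁', B.goodArc (v := -v) (by rwa [norm_neg]) ht₂ h₂ h₂', ?_⟩
  rintro _ ⟨⟨s, hs, rfl⟩, s', hs', h⟩
  simp only at h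
  have h1 := B.gu_inj K (by
    rw [mem_closedBall_zero_iff, norm_smul, norm_neg, hv, mul_one, Real.norm_eq_abs, abs_of_nonneg hs'.1]
    exact hs'.2.trans ht₂.2) (by
    rw [mem_closedBall_zero_iff, norm_smul, hv, mul_one, Real.norm_eq_abs, abs_of_nonneg hs.1]
    exact hs.2.trans ht₁.2) h
  have h2 : (s + s') • v = 0 := by rw [add_smul, ← h1]; simp
  have hv0 : v ≠ 0 := by rintro rfl; simp at hv
  have h3 := (smul_eq_zero.1 h2).resolve_right hv0
  have h4 : s = 0 := by linarith [hs.1, hs'.1]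
  simp [h4, B.gu_zero]

lemma Setting.side_arc {M : Type*} [MetricSpace M] [CompactSpace M] {f : M ≃ₜ M} {n : ℕ} {x : M}
    {α ε ν : ℝ} (S : Setting f n x α ε ν) {r : M} (hr : r ∈ PerHr f n (n - 1)) {η : ℝ} (hη : 0 < η)
    (hb : closedBall r η ⊆ ball x ν) {G H : Set M} (hG : IsOpen G) (hH : IsOpen H) (hGH : Disjoint G H)
    (hu : G ∪ H = ball x ν \ SpSet f x ν r) (hrG : r ∈ closure G) :
    ∃ T e, GoodArc f ε r η T e ∧ e ∈ G := by
  have hεα1 : ε ≤ α := by linarith [S.hε, S.hεα]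
  have hn := S.hn
  obtain ⟨B⟩ := PerHr.hypBox hr (ContinuousLinearEquiv.refl ℝ _)
    (E₂ := ℝ) (ContinuousLinearEquiv.ofFinrankEq (by simp; omega))
  obtain ⟨K, hK⟩ := B.gu_exit S.hexp
  have hrν : r ∈ ball x ν := hb (mem_closedBall_self hη.le)
  have hSU := S.hi r ⟨PerHr.subset_PerH (by omega) hr, hrν⟩
  obtain ⟨ρ, hρ, hρB, hflat⟩ := B.flat_zero S.hexp hεα1 hSU.1 (mem_SpSet_self f hrν)
  obtain ⟨θ, hθ, hθb⟩ := B.exists_ball hρ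
  obtain ⟨g, hgG, hg⟩ := Metric.mem_closure_iff.1 hrG θ hθ
  obtain ⟨hgs, hgn⟩ := hθb g hg
  have hgS : g ∉ SpSet f x ν r := (hu ▸ (subset_union_left hgG : g ∈ G ∪ H)).2
  have hg2 : (B.e g).2 ≠ 0 := by
    intro h0
    have := ((hflat (B.e g) (by simpa using hgn)).2).2 h0
    rw [B.e.left_inv hgs] at this
    exact hgS this
  obtain ⟨κ, hκ, hκg⟩ : ∃ κ : ℝ, |κ| = 1 ∧ 0 < (B.e g).2 * κ := by
    rcases lt_or_gt_of_ne hg2 with h | h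
    · exact ⟨-1, by simp, by linarith⟩
    · exact ⟨1, by simp, by linarith⟩
  have hκ2 : κ * κ = 1 := by rw [← abs_mul_abs_self, hκ, one_mul]
  have hconv : Convex ℝ (ball (0 : (Fin (n - 1) → ℝ) × ℝ) ρ ∩ {y | 0 < y.2 * κ}) := by
    refine (convex_ball _ _).inter ?_
    intro a ha b hb s t hs ht hst
    simp only [mem_ofPred_eq, Prod.snd_add, Prod.smul_snd, smul_eq_mul] at *
    rcases hs.eq_or_lt with h | h
    · subst h; have : t = 1 := by linarith
      subst this; linarith
    · nlinarith [mul_pos h ha, mul_nonneg ht hb.le]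
  have hQ : B.e.symm '' (ball (0 : (Fin (n - 1) → ℝ) × ℝ) ρ ∩ {y | 0 < y.2 * κ}) ⊆ G := by
    refine IsPreconnected.subset_left_of_subset_union hG hH hGH ?_ ⟨g, ⟨B.e g, ⟨by simpa using hgn, hκg⟩, B.e.left_inv hgs⟩, hgG⟩ ?_
    · rw [hu]
      rintro _ ⟨y, ⟨hy, hy2⟩, rfl⟩
      refine ⟨(hflat y hy).1, fun hc => ?_⟩
      have := (hflat y hy).2.1 hc
      simp [this] at hy2
    · refine hconv.isPreconnected.image _ (B.e.symm.continuousOn.mono ?_)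
      exact (inter_subset_left.trans ball_subset_closedBall).trans
        ((closedBall_subset_closedBall hρB).trans B.htgt)
  obtain ⟨t, ht, h1, h1'⟩ := B.arc hεα1 hK hSU.2 hη hb (v := κ) hκ
  refine ⟨_, _, B.goodArc (v := κ) hκ ht h1 h1', ?_⟩
  have hmem : ∀ s ∈ Icc 0 t, s • κ ∈ closedBall (0 : ℝ) B.ρ := by
    intro s hs
    rw [mem_closedBall_zero_iff, norm_smul, Real.norm_eq_abs κ, hκ, mul_one, Real.norm_eq_abs, abs_of_nonneg hs.1]
    exact hs.2.trans ht.2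
  have hT : (fun s : ℝ => B.gu K (s • κ)) '' Ioc 0 t ⊆ G := by
    refine IsPreconnected.subset_left_of_subset_union hG hH hGH ?_ ?_ ?_
    · rw [hu]
      rintro _ ⟨s, hs, rfl⟩
      have h2 := h1 s ⟨hs.1.le, hs.2⟩
      refine ⟨hb (mem_closedBall.2 h2.2), fun hc => ?_⟩
      have h3 := S.hexp.eq hεα1 hεα1 (hSU.1 hc) h2.1
      have h4 := B.gu_inj K (mem_closedBall_self B.hρ.le) (hmem s ⟨hs.1.le, hs.2⟩) ((B.gu_zero K).trans h3)
      have h5 : s * κ = 0 := h4.symm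
      rcases mul_eq_zero.1 h5 with h | h
      · exact hs.1.ne' h
      · rw [h] at hκ; simp at hκ
    · have h2 : (0 : ℝ) < 2 ^ K := by positivity
      obtain ⟨s, hs0, hst, hsρ⟩ : ∃ s > 0, s ≤ t ∧ 2 ^ K * s < ρ := by
        refine ⟨min t (ρ / 2 ^ K / 2), lt_min ht.1 (by positivity), min_le_left _ _, ?_⟩
        calc 2 ^ K * min t (ρ / 2 ^ K / 2) ≤ 2 ^ K * (ρ / 2 ^ K / 2) := by gcongr; exact min_le_right _ _
          _ = ρ / 2 := by field_simp
          _ < ρ := by linarith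
      have hnorm : ‖(2 : ℝ) ^ K • (s • κ)‖ = 2 ^ K * s := by
        rw [norm_smul, norm_smul, Real.norm_eq_abs κ, hκ, mul_one, Real.norm_eq_abs, Real.norm_eq_abs, abs_of_pos h2, abs_of_pos hs0]
      have h3 := B.gu_small K (u := s • κ) (by rw [hnorm]; linarith)
      refine ⟨B.gu K (s • κ), ⟨s, ⟨hs0, hst⟩, rfl⟩, hQ ⟨_, ⟨?_, ?_⟩, h3.symm⟩⟩
      · rw [mem_ball_zero_iff, Prod.norm_def]
        simp only [norm_zero, hnorm]
        exact max_lt hρ hsρ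
      · change 0 < (2 ^ K * (s * κ)) * κ
        have : (2 ^ K * (s * κ)) * κ = 2 ^ K * s * (κ * κ) := by ring
        rw [this, hκ2]; positivity
    · refine isPreconnected_Ioc.image _ ((B.gu_cont K).comp (by fun_prop) ?_)
      intro s hs
      exact hmem s ⟨hs.1.le, hs.2⟩
  exact hT ⟨t, ⟨ht.1, le_rfl⟩, rfl⟩

open Metric Set

lemma half_convex {E : Type*} [NormedAddCommGroup E] [NormedSpace ℝ E] (c : E × ℝ) (ρ κ : ℝ) :
    Convex ℝ (ball c ρ ∩ {y | 0 < y.2 * κ}) := by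
  refine (convex_ball _ _).inter ?_
  intro a ha b hb s t hs ht hst
  simp only [mem_ofPred_eq, Prod.snd_add, Prod.smul_snd, smul_eq_mul] at *
  rcases hs.eq_or_lt with h | h
  · subst h; have : t = 1 := by linarith
    subst this; linarith
  · nlinarith [mul_pos h ha, mul_nonneg ht hb.le]

lemma half_closure {E : Type*} [NormedAddCommGroup E] [NormedSpace ℝ E] {c y : E × ℝ} {ρ κ : ℝ}
    (hκ : |κ| = 1) (hy : y ∈ ball c ρ) (hy0 : y.2 = 0) :
    y ∈ closure (ball c ρ ∩ {y | 0 < y.2 * κ}) := by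
  have hκ2 : κ * κ = 1 := by rw [← abs_mul_abs_self, hκ, one_mul]
  rw [mem_ball] at hy
  rw [Metric.mem_closure_iff]
  intro τ hτ
  obtain ⟨t, ht, ht1, ht2⟩ : ∃ t > 0, t < τ ∧ t < ρ - dist y c :=
    ⟨min τ (ρ - dist y c) / 2, half_pos (lt_min hτ (by linarith)), by
      have := min_le_left τ (ρ - dist y c); linarith [lt_min hτ (sub_pos.2 hy)], by
      have := min_le_right τ (ρ - dist y c); linarith [lt_min hτ (sub_pos.2 hy)]⟩
  have hd : dist (y + ((0 : E), t * κ)) y = t := by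
    rw [dist_eq_norm, add_sub_cancel_left, Prod.norm_def]
    simp [hκ, abs_of_pos ht, ht.le]
  refine ⟨y + (0, t * κ), ⟨?_, ?_⟩, by rw [dist_comm, hd]; exact ht1⟩
  · rw [mem_ball]
    have := dist_triangle (y + ((0 : E), t * κ)) y c
    linarith
  · change 0 < (y.2 + t * κ) * κ
    rw [hy0, zero_add, mul_assoc, hκ2]; linarith

lemma Setting.local_halves {M : Type*} [MetricSpace M] [CompactSpace M] {f : M ≃ₜ M} {n : ℕ} {x : M}
    {α ε ν : ℝ} (S : Setting f n x α ε ν) {r : M} (hr : r ∈ PerHr f n (n - 1)) (hrν : r ∈ ball x ν)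
    {w : M} (hw : w ∈ SpSet f x ν r) {U : Set M} (hU : IsOpen U) (hwU : w ∈ U) :
    ∃ N P₁ P₂ : Set M, IsOpen N ∧ w ∈ N ∧ N ⊆ U ∩ ball x ν ∧ IsPreconnected P₁ ∧ IsPreconnected P₂ ∧
      P₁ ∪ P₂ = N \ SpSet f x ν r ∧ N ∩ SpSet f x ν r ⊆ closure P₁ ∧ N ∩ SpSet f x ν r ⊆ closure P₂ := by
  have hεα1 : ε ≤ α := by linarith [S.hε, S.hεα]
  have hn := S.hn
  obtain ⟨B⟩ := PerHr.hypBox hr (ContinuousLinearEquiv.refl ℝ _)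
    (E₂ := ℝ) (ContinuousLinearEquiv.ofFinrankEq (by simp; omega))
  have hSU := S.hi r ⟨PerHr.subset_PerH (by omega) hr, hrν⟩
  obtain ⟨E, hE⟩ := B.flat S.hexp hεα1 hSU.1
  obtain ⟨hws, hw2, h⟩ := hE w hw
  obtain ⟨ρ, hρ, ht, hb⟩ := h U hU hwU
  have hpre : ∀ κ : ℝ, IsPreconnected (E.symm '' (ball (E w) ρ ∩ {y | 0 < y.2 * κ})) := fun κ =>
    (half_convex _ _ _).isPreconnected.image _ (E.symm.continuousOn.mono (inter_subset_left.trans ht))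
  have hcl : ∀ κ : ℝ, |κ| = 1 → E.symm '' ball (E w) ρ ∩ SpSet f x ν r ⊆
      closure (E.symm '' (ball (E w) ρ ∩ {y | 0 < y.2 * κ})) := by
    rintro κ hκ _ ⟨⟨y, hy, rfl⟩, hyS⟩
    exact (E.symm.continuousAt (ht hy)).continuousWithinAt.mem_closure_image
      (half_closure hκ hy ((hb y hy).2.1 hyS))
  refine ⟨E.symm '' ball (E w) ρ, _, _, ?_, ⟨E w, mem_ball_self hρ, E.left_inv hws⟩, ?_, hpre 1, hpre (-1), ?_,
    hcl 1 (by simp), hcl (-1) (by simp)⟩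
  · exact E.symm.isOpen_image_of_subset_source isOpen_ball ht
  · rintro _ ⟨y, hy, rfl⟩
    exact (hb y hy).1
  · ext z
    constructor
    · rintro (⟨y, ⟨hy, hy2⟩, rfl⟩ | ⟨y, ⟨hy, hy2⟩, rfl⟩) <;>
      · refine ⟨⟨y, hy, rfl⟩, fun hc => ?_⟩
        have := (hb y hy).2.1 hc
        simp [this] at hy2
    · rintro ⟨⟨y, hy, rfl⟩, hyS⟩
      have h0 : y.2 ≠ 0 := fun h0 => hyS ((hb y hy).2.2 h0)
      rcases lt_or_gt_of_ne h0 with h1 | h1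
      · exact Or.inr ⟨y, ⟨hy, by simpa using h1⟩, rfl⟩
      · exact Or.inl ⟨y, ⟨hy, by simpa using h1⟩, rfl⟩

/-- the side of `S_r` containing `x` -/
def Gs {M : Type*} [MetricSpace M] (f : M ≃ₜ M) (x : M) (ν : ℝ) (r : M) : Set M :=
  connectedComponentIn (ball x ν \ SpSet f x ν r) x

/-- the other side of `S_r` -/
def Hs {M : Type*} [MetricSpace M] (f : M ≃ₜ M) (x : M) (ν : ℝ) (r : M) : Set M :=
  (ball x ν \ SpSet f x ν r) \ Gs f x ν r

section sides
variable {M : Type*} [MetricSpace M] {f : M ≃ₜ M} {n : ℕ} {x : M} {α ε ν : ℝ} {r : M}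

lemma SpSet_sub_ball : SpSet f x ν r ⊆ ball x ν := fun _ hy => (connectedComponentIn_subset _ _ hy).2
lemma SpSet_preconn : IsPreconnected (SpSet f x ν r) := isPreconnected_connectedComponentIn
lemma Gs_sub : Gs f x ν r ⊆ ball x ν \ SpSet f x ν r := connectedComponentIn_subset _ _
lemma Gs_preconn : IsPreconnected (Gs f x ν r) := isPreconnected_connectedComponentIn
lemma Gs_union_Hs : Gs f x ν r ∪ Hs f x ν r = ball x ν \ SpSet f x ν r := union_sdiff_cancel Gs_sub
lemma Gs_disj_Hs : Disjoint (Gs f x ν r) (Hs f x ν r) := disjoint_sdiff_right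
lemma ShatSet_eq : ShatSet f x ν r = ball x ν \ Gs f x ν r := rfl
lemma ShatSet_eq' : ShatSet f x ν r = SpSet f x ν r ∪ Hs f x ν r := by
  ext y
  have h1 := @SpSet_sub_ball M _ f x ν r y
  have h2 := @Gs_sub M _ f x ν r y
  simp only [ShatSet_eq, Hs, mem_union, mem_sdiff] at *
  tauto
lemma side_cases {y : M} (hy : y ∈ ball x ν) : y ∈ SpSet f x ν r ∨ y ∈ Gs f x ν r ∨ y ∈ Hs f x ν r := by
  simp only [Hs, mem_sdiff]; tauto

lemma Setting.diff_open [CompactSpace M] (S : Setting f n x α ε ν) (hr : r ∈ PerHr f n (n - 1)) (hrν : r ∈ ball x ν) :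
    IsOpen (ball x ν \ SpSet f x ν r) := by
  have hεα1 : ε ≤ α := by linarith [S.hε, S.hεα]
  have hSU := S.hi r ⟨PerHr.subset_PerH (by omega) hr, hrν⟩
  have h := SpSet_closed S.hexp hεα1 hSU.1 (mem_SpSet_self f hrν)
  have : ball x ν \ SpSet f x ν r = ball x ν ∩ (closure (SpSet f x ν r))ᶜ := by
    ext y
    exact ⟨fun hy => ⟨hy.1, fun hc => hy.2 (h ⟨hc, hy.1⟩)⟩, fun hy => ⟨hy.1, fun hc => hy.2 (subset_closure hc)⟩⟩
  rw [this]
  exact isOpen_ball.inter isClosed_closure.isOpen_compl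

lemma Setting.Gs_open [CompactSpace M] [LocallyConnectedSpace M] (S : Setting f n x α ε ν)
    (hr : r ∈ PerHr f n (n - 1)) (hrν : r ∈ ball x ν) : IsOpen (Gs f x ν r) :=
  (S.diff_open hr hrν).connectedComponentIn

lemma Setting.Hs_props [CompactSpace M] [LocallyConnectedSpace M] (S : Setting f n x α ε ν)
    (hr : r ∈ PerHr f n (n - 1)) (hrν : r ∈ ball x ν) (hx : x ∈ ball x ν) (hxS : x ∉ SpSet f x ν r) :
    IsOpen (Hs f x ν r) ∧ IsPreconnected (Hs f x ν r) ∧ (Hs f x ν r).Nonempty ∧ x ∈ Gs f x ν r := by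
  have hxD : x ∈ ball x ν \ SpSet f x ν r := ⟨hx, hxS⟩
  have key : ∃ y ∈ ball x ν \ SpSet f x ν r, Hs f x ν r = connectedComponentIn (ball x ν \ SpSet f x ν r) y := by
    obtain ⟨V₁, V₂, hne, hall, ⟨y₁, hy₁, h₁⟩, ⟨y₂, hy₂, h₂⟩⟩ := S.hii r ⟨hr, hrν⟩
    have aux : ∀ y ∈ ball x ν \ SpSet f x ν r, Gs f x ν r ≠ connectedComponentIn (ball x ν \ SpSet f x ν r) y →
        (∀ z ∈ ball x ν \ SpSet f x ν r, connectedComponentIn (ball x ν \ SpSet f x ν r) z = Gs f x ν r ∨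
          connectedComponentIn (ball x ν \ SpSet f x ν r) z = connectedComponentIn (ball x ν \ SpSet f x ν r) y) →
        Hs f x ν r = connectedComponentIn (ball x ν \ SpSet f x ν r) y := by
      intro y hy hne' hz
      ext z
      constructor
      · rintro ⟨hzD, hzG⟩
        rcases hz z hzD with h | h
        · exact absurd (h ▸ mem_connectedComponentIn hzD) hzG
        · exact h ▸ mem_connectedComponentIn hzD
      · intro hzc
        refine ⟨connectedComponentIn_subset _ _ hzc, fun hzG => hne' ?_⟩
        rw [connectedComponentIn_eq hzc]
        exact connectedComponentIn_eq hzG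
    rcases hall x hxD with h | h
    · refine ⟨y₂, hy₂, aux y₂ hy₂ ?_ ?_⟩
      · rw [h₂]; unfold Gs; rw [h]; exact hne
      · unfold Gs; rw [h₂, h]; exact hall
    · refine ⟨y₁, hy₁, aux y₁ hy₁ ?_ ?_⟩
      · rw [h₁]; unfold Gs; rw [h]; exact hne.symm
      · unfold Gs; rw [h₁, h]; exact fun z hz => (hall z hz).symm
  obtain ⟨y, hy, hH⟩ := key
  rw [hH]
  exact ⟨(S.diff_open hr hrν).connectedComponentIn, isPreconnected_connectedComponentIn,
    ⟨y, mem_connectedComponentIn hy⟩, mem_connectedComponentIn hxD⟩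

lemma Setting.S_closure [CompactSpace M] [LocallyConnectedSpace M] (S : Setting f n x α ε ν)
    (hr : r ∈ PerHr f n (n - 1)) (hrν : r ∈ ball x ν) (hx : x ∈ ball x ν) (hxS : x ∉ SpSet f x ν r)
    (hconn : IsPreconnected (ball x ν)) :
    SpSet f x ν r ⊆ closure (Gs f x ν r) ∩ closure (Hs f x ν r) := by
  obtain ⟨hHo, hHp, hHn, hxG⟩ := S.Hs_props hr hrν hx hxS
  have hGo := S.Gs_open hr hrν
  have hGH : Disjoint (Gs f x ν r) (Hs f x ν r) := Gs_disj_Hs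
  -- local dichotomy
  have dich : ∀ w ∈ SpSet f x ν r, ∃ N : Set M, IsOpen N ∧ w ∈ N ∧ w ∈ closure (Gs f x ν r ∪ Hs f x ν r) ∧
      ((N ∩ SpSet f x ν r ⊆ closure (Gs f x ν r) ∩ closure (Hs f x ν r)) ∨
       (∀ y ∈ N, y ∉ closure (Gs f x ν r) ∩ closure (Hs f x ν r))) := by
    intro w hw
    obtain ⟨N, P₁, P₂, hN, hwN, hNs, hP₁, hP₂, hPu, hc₁, hc₂⟩ := S.local_halves hr hrν hw isOpen_univ (mem_univ w)
    have hPs : P₁ ∪ P₂ ⊆ Gs f x ν r ∪ Hs f x ν r := by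
      rw [hPu, Gs_union_Hs]
      exact fun y hy => ⟨(hNs hy.1).2, hy.2⟩
    have hor : ∀ P, IsPreconnected P → P ⊆ Gs f x ν r ∪ Hs f x ν r → P ⊆ Gs f x ν r ∨ P ⊆ Hs f x ν r := by
      intro P hP hPs
      rcases P.eq_empty_or_nonempty with h | ⟨y, hy⟩
      · left; rw [h]; exact empty_subset _
      · rcases hPs hy with h | h
        · exact Or.inl (hP.subset_left_of_subset_union hGo hHo hGH hPs ⟨y, hy, h⟩)
        · exact Or.inr (hP.subset_right_of_subset_union hGo hHo hGH hPs ⟨y, hy, h⟩)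
    have hor₁ := hor P₁ hP₁ (subset_union_left.trans hPs)
    have hor₂ := hor P₂ hP₂ (subset_union_right.trans hPs)
    have noboth : ∀ A : Set M, IsOpen A → Disjoint A (P₁ ∪ P₂) → A ∩ SpSet f x ν r = ∅ → ∀ y ∈ N, y ∉ closure A := by
      intro A hA hAP hAS y hy hyA
      obtain ⟨z, hzN, hzA⟩ := mem_closure_iff.1 hyA N hN hy
      have hzS : z ∉ SpSet f x ν r := fun h => by
        have : z ∈ A ∩ SpSet f x ν r := ⟨hzA, h⟩
        rw [hAS] at this; exact this
      have : z ∈ P₁ ∪ P₂ := by rw [hPu]; exact ⟨hzN, hzS⟩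
      exact disjoint_left.1 hAP hzA this
    refine ⟨N, hN, hwN, closure_mono (subset_union_left.trans hPs) (hc₁ ⟨hwN, hw⟩), ?_⟩
    have hHS : Hs f x ν r ∩ SpSet f x ν r = ∅ := by
      ext y; simp only [Hs, mem_inter_iff, mem_sdiff, mem_empty_iff_false]; tauto
    have hGS : Gs f x ν r ∩ SpSet f x ν r = ∅ := by
      ext y
      have := @Gs_sub M _ f x ν r y
      simp only [mem_inter_iff, mem_sdiff, mem_empty_iff_false] at *; tauto
    rcases hor₁ with h1 | h1 <;> rcases hor₂ with h2 | h2
    · right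
      intro y hy hc
      exact noboth _ hHo (hGH.symm.mono_right (union_subset h1 h2)) hHS y hy hc.2
    · left; exact fun y hy => ⟨closure_mono h1 (hc₁ hy), closure_mono h2 (hc₂ hy)⟩
    · left; exact fun y hy => ⟨closure_mono h2 (hc₂ hy), closure_mono h1 (hc₁ hy)⟩
    · right
      intro y hy hc
      exact noboth _ hGo (hGH.mono_right (union_subset h1 h2)) hGS y hy hc.1
  have hcover : ball x ν ⊆ closure (Gs f x ν r) ∪ closure (Hs f x ν r) := by
    intro y hy
    rcases side_cases (f := f) (r := r) hy with h | h | h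
    · obtain ⟨N, -, -, h1, -⟩ := dich y h
      rwa [closure_union] at h1
    · exact Or.inl (subset_closure h)
    · exact Or.inr (subset_closure h)
  obtain ⟨h0, hh0⟩ := hHn
  obtain ⟨z, hz, hzE⟩ := isPreconnected_closed_iff.1 hconn _ _ isClosed_closure isClosed_closure hcover
    ⟨x, hx, subset_closure hxG⟩ ⟨h0, hh0.1.1, subset_closure hh0⟩
  have hzS : z ∈ SpSet f x ν r := by
    rcases side_cases (f := f) (r := r) hz with h | h | h
    · exact h
    · exfalso
      obtain ⟨y, hy, hy'⟩ := mem_closure_iff.1 hzE.2 _ hGo h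
      exact disjoint_left.1 hGH hy hy'
    · exfalso
      obtain ⟨y, hy, hy'⟩ := mem_closure_iff.1 hzE.1 _ hHo h
      exact disjoint_left.1 hGH hy' hy
  choose! N hN using dich
  by_contra hcon
  obtain ⟨w, hwS, hwE⟩ := not_subset.1 hcon
  set E := closure (Gs f x ν r) ∩ closure (Hs f x ν r) with hE
  obtain ⟨y, hyS, hyu, hyv⟩ := (SpSet_preconn (f := f) (x := x) (ν := ν) (r := r))
    (⋃ w ∈ {w ∈ SpSet f x ν r | w ∈ E}, N w) (⋃ w ∈ {w ∈ SpSet f x ν r | w ∉ E}, N w)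
    (isOpen_biUnion fun w hw => (hN w hw.1).1) (isOpen_biUnion fun w hw => (hN w hw.1).1)
    (fun w hw => by
      by_cases h : w ∈ E
      · exact Or.inl (mem_biUnion (show w ∈ {w ∈ SpSet f x ν r | w ∈ E} from ⟨hw, h⟩) (hN w hw).2.1)
      · exact Or.inr (mem_biUnion (show w ∈ {w ∈ SpSet f x ν r | w ∉ E} from ⟨hw, h⟩) (hN w hw).2.1))
    ⟨z, hzS, mem_biUnion (show z ∈ {w ∈ SpSet f x ν r | w ∈ E} from ⟨hzS, hzE⟩) (hN z hzS).2.1⟩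
    ⟨w, hwS, mem_biUnion (show w ∈ {w ∈ SpSet f x ν r | w ∉ E} from ⟨hwS, hwE⟩) (hN w hwS).2.1⟩
  simp only [mem_iUnion] at hyu hyv
  obtain ⟨a, ⟨ha, haE⟩, hya⟩ := hyu
  obtain ⟨b, ⟨hb, hbE⟩, hyb⟩ := hyv
  have hyE : y ∈ E := by
    rcases (hN a ha).2.2.2 with h | h
    · exact h ⟨hya, hyS⟩
    · exact absurd haE (h a (hN a ha).2.1)
  rcases (hN b hb).2.2.2 with h | h
  · exact hbE (h ⟨(hN b hb).2.1, hb⟩)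
  · exact h y hyb hyE

end sides

open Metric Set

structure ChainSetting {M : Type*} [MetricSpace M] (f : M ≃ₜ M) (n : ℕ) (x : M) (α ε ν δ : ℝ) (C : Set M) : Prop where
  S : Setting f n x α ε ν
  hδ0 : 0 < δ
  hδν : δ < ν
  hC : IsMaxChainIn f n x ν δ C
  hdisj : ∀ C₁ C₂ : Set M, IsMaxChainIn f n x ν δ C₁ → IsMaxChainIn f n x ν δ C₂ →
      C₁ ≠ C₂ → Disjoint C₁ C₂
  hacc : x ∈ closure C
  hconn : IsPreconnected (ball x ν)
  hxS : ∀ r ∈ Xdelta f n x δ, x ∉ SpSet f x ν r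

set_option linter.unusedSectionVars false

section chain
variable {M : Type*} [MetricSpace M] [CompactSpace M] {f : M ≃ₜ M} {n : ℕ} {x : M} {α ε ν δ : ℝ} {C : Set M}

lemma Setting.S_disj (S : Setting f n x α ε ν) {r q w : M} (hr : r ∈ PerHr f n (n - 1)) (hrν : r ∈ ball x ν)
    (hq : q ∈ PerHr f n (n - 1)) (hqν : q ∈ ball x ν) (h : w ∈ SpSet f x ν r) (h' : w ∈ SpSet f x ν q) : r = q := by
  have h1 := (S.hi r ⟨PerHr.subset_PerH (by omega) hr, hrν⟩).1 h
  have h2 := (S.hi q ⟨PerHr.subset_PerH (by omega) hq, hqν⟩).1 h'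
  obtain ⟨l, hl, hl'⟩ := PerHr.periodic hr
  obtain ⟨m, hm, hm'⟩ := PerHr.periodic hq
  exact S.hexp.periodic_eq hl hm hl' hm' (WsLoc_mono (by linarith [S.hεα]) _ (WsLoc_tri h1 (WsLoc_comm h2)))

lemma Setting.chainSetting [LocallyConnectedSpace M] (S : Setting f n x α ε ν) (hδ0 : 0 < δ) (hδν : δ < ν)
    (hC : IsMaxChainIn f n x ν δ C)
    (hdisj : ∀ C₁ C₂ : Set M, IsMaxChainIn f n x ν δ C₁ → IsMaxChainIn f n x ν δ C₂ →
      C₁ ≠ C₂ → Disjoint C₁ C₂) (hacc : x ∈ closure C) (hxC : ∀ r ∈ C, x ∉ SpSet f x ν r) :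
    ChainSetting f n x α ε ν δ C := by
  have hx : x ∈ ball x ν := mem_ball_self (hδ0.trans hδν)
  have hsub : ball x δ ⊆ ball x ν := ball_subset_ball hδν.le
  have hCX := hC.1.1
  refine ⟨S, hδ0, hδν, hC, hdisj, hacc, ?_, ?_⟩
  · have hB1o : IsOpen (connectedComponentIn (ball x ν) x) := isOpen_ball.connectedComponentIn
    have hxB1 := mem_connectedComponentIn hx
    have hB1p : IsPreconnected (connectedComponentIn (ball x ν) x) := isPreconnected_connectedComponentIn
    suffices h : ball x ν ⊆ connectedComponentIn (ball x ν) x by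
      rw [Subset.antisymm h (connectedComponentIn_subset _ _)]; exact hB1p
    by_contra hcon
    obtain ⟨y, hy, hyB⟩ := not_subset.1 hcon
    have key : ∀ q ∈ C, q ∈ connectedComponentIn (ball x ν) x → ∀ q' ∈ C, q' ∈ connectedComponentIn (ball x ν) x →
        ShatSet f x ν q ⊆ ShatSet f x ν q' → q = q' := by
      intro q hq hqB q' hq' hqB' hle
      have hqν := hsub (hCX hq).2
      have hqν' := hsub (hCX hq').2
      obtain ⟨hHo, hHp, -, hxG⟩ := S.Hs_props (hCX hq').1 hqν' hx (hxC q' hq')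
      have hqS : q ∈ ShatSet f x ν q' := hle (by rw [ShatSet_eq']; exact Or.inl (mem_SpSet_self f hqν))
      rw [ShatSet_eq'] at hqS
      rcases hqS with h | h
      · exact S.S_disj (hCX hq).1 hqν (hCX hq').1 hqν' (mem_SpSet_self f hqν) h
      · exfalso
        have hyH : y ∈ Hs f x ν q' := by
          refine ⟨⟨hy, fun hyS => hyB ?_⟩, fun hyG => hyB ?_⟩
          · rw [connectedComponentIn_eq hqB']
            exact SpSet_preconn.subset_connectedComponentIn (mem_SpSet_self f hqν') SpSet_sub_ball hyS
          · exact Gs_preconn.subset_connectedComponentIn hxG (fun z hz => (Gs_sub hz).1) hyG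
        apply hyB
        rw [connectedComponentIn_eq hqB]
        exact hHp.subset_connectedComponentIn h (fun z hz => hz.1.1) hyH
    obtain ⟨q, hqB, hq⟩ := mem_closure_iff.1 hacc _ hB1o hxB1
    have hqx : x ≠ q := fun h => hxC q hq (by
      have := mem_SpSet_self f (hsub (hCX hq).2)
      rwa [← h] at this ⊢)
    obtain ⟨q', ⟨hqB', hne⟩, hq'⟩ := mem_closure_iff.1 hacc _ (hB1o.inter (isOpen_compl_singleton (x := q))) ⟨hxB1, hqx⟩
    rcases hC.1.2 q hq q' hq' with h | h
    · exact hne (key q hq hqB q' hq' hqB' h).symm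
    · exact hne (key q' hq' hqB' q hq hqB h)
  · intro r hr hxr
    have hfull : ShatSet f x ν r = ball x ν := by
      have : Gs f x ν r = ∅ := connectedComponentIn_eq_empty fun h => h.2 hxr
      rw [ShatSet_eq, this, sdiff_empty]
    have hsubf : ∀ q, ShatSet f x ν q ⊆ ShatSet f x ν r := fun q => by rw [hfull]; exact sdiff_subset
    have hch : IsChainIn f n x ν δ (insert r C) := by
      refine ⟨insert_subset hr hCX, ?_⟩
      rintro p (rfl | hp) q (rfl | hq)
      · exact Or.inl subset_rfl
      · exact Or.inr (hsubf q)
      · exact Or.inl (hsubf p)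
      · exact hC.1.2 p hp q hq
    have := hC.2 _ hch (subset_insert _ _)
    exact hxC r (this ▸ mem_insert r C) hxr

lemma Setting.cross [LocallyConnectedSpace M] (S : Setting f n x α ε ν) {r : M} (hr : r ∈ PerHr f n (n - 1)) (hrν : r ∈ ball x ν)
    (hx : x ∈ ball x ν) (hxS : x ∉ SpSet f x ν r)
    {W : Set M} (hW : IsPreconnected W) (hWb : W ⊆ ball x ν)
    {a b : M} (ha : a ∈ W) (haG : a ∈ Gs f x ν r) (hb : b ∈ W) (hbH : b ∈ Hs f x ν r) :
    ∃ s ∈ W, s ∈ SpSet f x ν r := by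
  by_contra hcon
  push Not at hcon
  obtain ⟨hHo, -, -, -⟩ := S.Hs_props hr hrν hx hxS
  have h := hW.subset_left_of_subset_union (S.Gs_open hr hrν) hHo Gs_disj_Hs
    (by rw [Gs_union_Hs]; exact fun s hs => ⟨hWb hs, hcon s hs⟩) ⟨a, ha, haG⟩
  exact disjoint_left.1 Gs_disj_Hs (h hb) hbH

namespace ChainSetting

lemma hx (A : ChainSetting f n x α ε ν δ C) : x ∈ ball x ν := mem_ball_self (A.hδ0.trans A.hδν)
lemma sub (A : ChainSetting f n x α ε ν δ C) : ball x δ ⊆ ball x ν := ball_subset_ball A.hδν.le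
lemma CX (A : ChainSetting f n x α ε ν δ C) : C ⊆ Xdelta f n x δ := A.hC.1.1
lemma Xν (A : ChainSetting f n x α ε ν δ C) {r : M} (hr : r ∈ Xdelta f n x δ) : r ∈ ball x ν := A.sub hr.2
lemma hεα1 (A : ChainSetting f n x α ε ν δ C) : ε ≤ α := by linarith [A.S.hε, A.S.hεα]
lemma Ssub (A : ChainSetting f n x α ε ν δ C) {r : M} (hr : r ∈ Xdelta f n x δ) : SpSet f x ν r ⊆ WsLoc f ε r :=
  (A.S.hi r ⟨PerHr.subset_PerH (by omega) hr.1, A.Xν hr⟩).1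

lemma self_mem (A : ChainSetting f n x α ε ν δ C) {r : M} (hr : r ∈ Xdelta f n x δ) : r ∈ SpSet f x ν r :=
  mem_SpSet_self f (A.Xν hr)

variable [LocallyConnectedSpace M]

lemma Hprops (A : ChainSetting f n x α ε ν δ C) {r : M} (hr : r ∈ Xdelta f n x δ) :
    IsOpen (Hs f x ν r) ∧ IsPreconnected (Hs f x ν r) ∧ (Hs f x ν r).Nonempty ∧ x ∈ Gs f x ν r :=
  A.S.Hs_props hr.1 (A.Xν hr) A.hx (A.hxS r hr)

lemma Gopen (A : ChainSetting f n x α ε ν δ C) {r : M} (hr : r ∈ Xdelta f n x δ) : IsOpen (Gs f x ν r) :=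
  A.S.Gs_open hr.1 (A.Xν hr)

lemma Scl (A : ChainSetting f n x α ε ν δ C) {r : M} (hr : r ∈ Xdelta f n x δ) :
    SpSet f x ν r ⊆ closure (Gs f x ν r) ∩ closure (Hs f x ν r) :=
  A.S.S_closure hr.1 (A.Xν hr) A.hx (A.hxS r hr) A.hconn

lemma S_eq (A : ChainSetting f n x α ε ν δ C) {r q w : M} (hr : r ∈ Xdelta f n x δ) (hq : q ∈ Xdelta f n x δ)
    (h : w ∈ SpSet f x ν r) (h' : w ∈ SpSet f x ν q) : r = q :=
  A.S.S_disj hr.1 (A.Xν hr) hq.1 (A.Xν hq) h h'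

lemma cross (A : ChainSetting f n x α ε ν δ C) {r : M} (hr : r ∈ Xdelta f n x δ)
    {W : Set M} (hW : IsPreconnected W) (hWb : W ⊆ ball x ν)
    {a b : M} (ha : a ∈ W) (haG : a ∈ Gs f x ν r) (hb : b ∈ W) (hbH : b ∈ Hs f x ν r) :
    ∃ s ∈ W, s ∈ SpSet f x ν r :=
  A.S.cross hr.1 (A.Xν hr) A.hx (A.hxS r hr) hW hWb ha haG hb hbH

lemma H_not_S {r y : M} (h : y ∈ Hs f x ν r) : y ∉ SpSet f x ν r := h.1.2
lemma G_not_S {r y : M} (h : y ∈ Gs f x ν r) : y ∉ SpSet f x ν r := (Gs_sub h).2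

lemma c1 (A : ChainSetting f n x α ε ν δ C) {r c : M} (hr : r ∈ Xdelta f n x δ) (hc : c ∈ Xdelta f n x δ)
    (h : c ∈ Hs f x ν r) : ShatSet f x ν c ⊆ Hs f x ν r ∧ Gs f x ν r ∪ SpSet f x ν r ⊆ Gs f x ν c := by
  have hdis : ∀ y ∈ SpSet f x ν c, y ∉ SpSet f x ν r := by
    intro y hy hy'
    have := A.S_eq hc hr hy hy'
    exact H_not_S h (this ▸ A.self_mem hc)
  obtain ⟨hHo, hHp, -, hxG⟩ := A.Hprops hr
  have h1 : SpSet f x ν c ⊆ Hs f x ν r := by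
    refine SpSet_preconn.subset_right_of_subset_union (A.Gopen hr) hHo Gs_disj_Hs ?_ ⟨c, A.self_mem hc, h⟩
    rw [Gs_union_Hs]
    exact fun y hy => ⟨SpSet_sub_ball hy, hdis y hy⟩
  have h2 : Gs f x ν r ∪ SpSet f x ν r ⊆ Gs f x ν c := by
    have hp : IsPreconnected (Gs f x ν r ∪ SpSet f x ν r) :=
      Gs_preconn.subset_closure subset_union_left
        (union_subset subset_closure fun y hy => (A.Scl hr hy).1)
    refine hp.subset_connectedComponentIn (Or.inl hxG) ?_
    rintro y (hy | hy)
    · exact ⟨(Gs_sub hy).1, fun hc' => disjoint_left.1 Gs_disj_Hs hy (h1 hc')⟩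
    · exact ⟨SpSet_sub_ball hy, fun hc' => hdis y hc' hy⟩
  refine ⟨fun y hy => ⟨⟨hy.1, fun hyS => hy.2 (h2 (Or.inr hyS))⟩, fun hyG => hy.2 (h2 (Or.inl hyG))⟩, h2⟩

lemma c2 (A : ChainSetting f n x α ε ν δ C) {r c : M} (hr : r ∈ C) (hc : c ∈ C)
    (h : c ∈ Gs f x ν r) : r ∈ Hs f x ν c := by
  have hcc : c ∈ ShatSet f x ν c := by rw [ShatSet_eq']; exact Or.inl (A.self_mem (A.CX hc))
  rcases A.hC.1.2 c hc r hr with h1 | h1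
  · exact absurd h (h1 hcc).2
  · have hrr : r ∈ ShatSet f x ν c := h1 (by rw [ShatSet_eq']; exact Or.inl (A.self_mem (A.CX hr)))
    rw [ShatSet_eq'] at hrr
    rcases hrr with h2 | h2
    · have := A.S_eq (A.CX hr) (A.CX hc) (A.self_mem (A.CX hr)) h2
      subst this
      exact absurd (A.self_mem (A.CX hr)) (G_not_S h)
    · exact h2

lemma c3 (A : ChainSetting f n x α ε ν δ C) {r c : M} (hr : r ∈ Xdelta f n x δ) (hc : c ∈ C)
    (h : r ∈ ShatSet f x ν c) : r ∈ C := by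
  rw [ShatSet_eq'] at h
  rcases h with h | h
  · have := A.S_eq hr (A.CX hc) (A.self_mem hr) h
    exact this ▸ hc
  · have hle : ShatSet f x ν r ⊆ ShatSet f x ν c := by
      rw [ShatSet_eq' (r := c)]
      exact (A.c1 (A.CX hc) hr h).1.trans subset_union_right
    have h0 : ({r, c} : Set M) ∈ {D | IsChainIn f n x ν δ D} := by
      refine ⟨insert_subset hr (singleton_subset_iff.2 (A.CX hc)), ?_⟩
      rintro p (rfl | rfl) q (rfl | rfl)
      · exact Or.inl subset_rfl
      · exact Or.inl hle
      · exact Or.inr hle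
      · exact Or.inl subset_rfl
    obtain ⟨D, hD, hDmax⟩ := zorn_subset_nonempty {D | IsChainIn f n x ν δ D} (by
      intro c hc hch _
      refine ⟨⋃₀ c, ⟨sUnion_subset fun s hs => (hc hs).1, ?_⟩, fun s hs => subset_sUnion_of_mem hs⟩
      rintro p ⟨s, hs, hps⟩ q ⟨t, ht, hqt⟩
      rcases hch.total hs ht with h | h
      · exact (hc ht).2 p (h hps) q hqt
      · exact (hc hs).2 p hps q (h hqt)) _ h0
    have hDM : IsMaxChainIn f n x ν δ D :=
      ⟨hDmax.1, fun C' hC' hsub => Subset.antisymm (hDmax.2 hC' hsub) hsub⟩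
    have : C = D := by
      by_contra hne
      exact disjoint_left.1 (A.hdisj C D A.hC hDM hne) hc (hD (by simp))
    rw [this]; exact hD (by simp)

lemma tri (A : ChainSetting f n x α ε ν δ C) {r c : M} (hr : r ∈ C) (hc : c ∈ C) :
    c ∈ Hs f x ν r ∨ c = r ∨ r ∈ Hs f x ν c := by
  rcases side_cases (f := f) (r := r) (A.Xν (A.CX hc)) with h | h | h
  · exact Or.inr (Or.inl (A.S_eq (A.CX hc) (A.CX hr) (A.self_mem (A.CX hc)) h))
  · exact Or.inr (Or.inr (A.c2 hr hc h))
  · exact Or.inl h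

lemma H_sub_hat {r : M} : Hs f x ν r ⊆ ShatSet f x ν r := by rw [ShatSet_eq']; exact subset_union_right

lemma H_dir (A : ChainSetting f n x α ε ν δ C) {r c : M} (hr : r ∈ C) (hc : c ∈ C) :
    Hs f x ν c ⊆ Hs f x ν r ∨ Hs f x ν r ⊆ Hs f x ν c := by
  rcases A.tri hr hc with h | h | h
  · exact Or.inl (H_sub_hat.trans (A.c1 (A.CX hr) (A.CX hc) h).1)
  · subst h; exact Or.inl subset_rfl
  · exact Or.inr (H_sub_hat.trans (A.c1 (A.CX hc) (A.CX hr) h).1)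

/-- going further up the chain, close to `x` -/
lemma c4 (A : ChainSetting f n x α ε ν δ C) {c : M} (hc : c ∈ C) {O : Set M} (hO : IsOpen O) (hxO : x ∈ O) :
    ∃ c' ∈ C, c' ∈ O ∧ ShatSet f x ν c ⊆ Hs f x ν c' := by
  obtain ⟨c', ⟨h1, h2⟩, h3⟩ := mem_closure_iff.1 A.hacc _ (hO.inter (A.Gopen (A.CX hc))) ⟨hxO, (A.Hprops (A.CX hc)).2.2.2⟩
  exact ⟨c', h3, h1, (A.c1 (A.CX h3) (A.CX hc) (A.c2 hc h3 h2)).1⟩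

lemma nonempty (A : ChainSetting f n x α ε ν δ C) : C.Nonempty := closure_nonempty_iff.1 ⟨x, A.hacc⟩

end ChainSetting

/-- the union of the chain -/
def Om {M : Type*} [MetricSpace M] (f : M ≃ₜ M) (x : M) (ν : ℝ) (C : Set M) : Set M := ⋃ q ∈ C, ShatSet f x ν q

namespace ChainSetting
variable [LocallyConnectedSpace M]

lemma mem_Om (A : ChainSetting f n x α ε ν δ C) {y : M} : y ∈ Om f x ν C ↔ ∃ c ∈ C, y ∈ Hs f x ν c := by
  constructor
  · intro h
    simp only [Om, mem_iUnion] at h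
    obtain ⟨q, hq, hy⟩ := h
    obtain ⟨c', hc', -, h⟩ := A.c4 hq isOpen_univ (mem_univ x)
    exact ⟨c', hc', h hy⟩
  · rintro ⟨c, hc, hy⟩
    exact mem_biUnion hc (H_sub_hat hy)

lemma Om_sub : Om f x ν C ⊆ ball x ν := iUnion₂_subset fun _ _ => sdiff_subset

lemma Om_open (A : ChainSetting f n x α ε ν δ C) : IsOpen (Om f x ν C) := by
  have : Om f x ν C = ⋃ c ∈ C, Hs f x ν c := by
    ext y; rw [A.mem_Om]; simp
  rw [this]
  exact isOpen_biUnion fun c hc => (A.Hprops (A.CX hc)).1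

lemma X_Om (A : ChainSetting f n x α ε ν δ C) {r : M} (hr : r ∈ Xdelta f n x δ) (h : r ∈ Om f x ν C) : r ∈ C := by
  simp only [Om, mem_iUnion] at h
  obtain ⟨q, hq, hy⟩ := h
  exact A.c3 hr hq hy

lemma not_Om {y q : M} (hy : y ∉ Om f x ν C) (hyν : y ∈ ball x ν) (hq : q ∈ C) : y ∈ Gs f x ν q := by
  by_contra h
  exact hy (mem_biUnion hq (show y ∈ ShatSet f x ν q from ⟨hyν, h⟩))

lemma compact_Om (A : ChainSetting f n x α ε ν δ C) {K : Set M} (hK : IsCompact K) (h : K ⊆ Om f x ν C) :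
    ∃ c ∈ C, K ⊆ Hs f x ν c := by
  have hne : Nonempty C := A.nonempty.to_subtype
  obtain ⟨⟨c, hc⟩, hcK⟩ := hK.elim_directed_cover (fun c : C => Hs f x ν c) (fun c => (A.Hprops (A.CX c.2)).1)
    (fun y hy => by
      obtain ⟨c, hc, hyc⟩ := A.mem_Om.1 (h hy)
      exact mem_iUnion.2 ⟨⟨c, hc⟩, hyc⟩)
    (fun a b => by
      rcases A.H_dir a.2 b.2 with h | h
      · exact ⟨a, subset_rfl, h⟩
      · exact ⟨b, h, subset_rfl⟩)
  exact ⟨c, hc, hcK⟩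

lemma bdry_Ws (A : ChainSetting f n x α ε ν δ C) {z : M} (hz : z ∈ closure (Om f x ν C)) (hzn : z ∉ Om f x ν C)
    (hzν : z ∈ ball x ν) : z ∈ WsLoc f ε x := by
  have : (x, z) ∈ closure {q : M × M | q.2 ∈ WsLoc f ε q.1} := by
    rw [Metric.mem_closure_iff]
    intro τ hτ
    have hWo : IsOpen (connectedComponentIn (ball z τ ∩ ball x ν) z) := (isOpen_ball.inter isOpen_ball).connectedComponentIn
    have hWs : connectedComponentIn (ball z τ ∩ ball x ν) z ⊆ ball z τ ∩ ball x ν := connectedComponentIn_subset _ _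
    have hzW : z ∈ connectedComponentIn (ball z τ ∩ ball x ν) z := mem_connectedComponentIn ⟨mem_ball_self hτ, hzν⟩
    obtain ⟨y, hyW, hyO⟩ := mem_closure_iff.1 hz _ hWo hzW
    simp only [Om, mem_iUnion] at hyO
    obtain ⟨q₁, hq₁, hy₁⟩ := hyO
    obtain ⟨q₂, hq₂, hq₂τ, hle⟩ := A.c4 hq₁ (isOpen_ball (x := x) (ε := τ)) (mem_ball_self hτ)
    obtain ⟨s, hsW, hsS⟩ := A.cross (A.CX hq₂) isPreconnected_connectedComponentIn (hWs.trans inter_subset_right)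
      hzW (not_Om hzn hzν hq₂) hyW (hle hy₁)
    refine ⟨(q₂, s), A.Ssub (A.CX hq₂) hsS, ?_⟩
    rw [Prod.dist_eq]
    exact max_lt (mem_ball'.1 hq₂τ) (mem_ball'.1 (hWs hsW).1)
  rwa [(isClosed_WsLoc f ε).closure_eq] at this

end ChainSetting
end chain

open Metric Set

lemma proj_closed {M : Type*} [MetricSpace M] [CompactSpace M] {F : Set (M × M)} (hF : IsClosed F) {y : M}
    (h : ∀ τ > 0, ∃ r e, (r, e) ∈ F ∧ dist y r < τ) : ∃ e, (y, e) ∈ F := by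
  have h1 : IsClosed (Prod.fst '' F) := isClosedMap_fst_of_compactSpace _ hF
  have h2 : y ∈ closure (Prod.fst '' F) := by
    rw [Metric.mem_closure_iff]
    intro τ hτ
    obtain ⟨r, e, hre, hd⟩ := h τ hτ
    exact ⟨r, ⟨(r, e), hre, rfl⟩, hd⟩
  rw [h1.closure_eq] at h2
  obtain ⟨⟨a, e⟩, h3, rfl⟩ := h2
  exact ⟨e, h3⟩

lemma frontier_cl_sub {X : Type*} [TopologicalSpace X] {O : Set X} (hO : IsOpen O) {y : X}
    (hy : y ∈ frontier (closure O)) : y ∈ closure O ∧ y ∉ O := by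
  rw [isClosed_closure.frontier_eq] at hy
  exact ⟨hy.1, fun h => hy.2 (interior_maximal subset_closure hO h)⟩

section chain
variable {M : Type*} [MetricSpace M] [CompactSpace M] {f : M ≃ₜ M} {n : ℕ} {x : M} {α ε ν δ : ℝ} {C : Set M}

namespace ChainSetting
variable [LocallyConnectedSpace M]

lemma bdry_eq (A : ChainSetting f n x α ε ν δ C) {y y' : M} (hy : y ∈ closure (Om f x ν C)) (hyn : y ∉ Om f x ν C)
    (hyν : y ∈ ball x ν) (hy' : y' ∈ closure (Om f x ν C)) (hyn' : y' ∉ Om f x ν C) (hyν' : y' ∈ ball x ν)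
    {b : ℝ} (hb : b ≤ α) (h : y' ∈ WuLoc f b y) : y = y' :=
  A.S.hexp.eq (by linarith [A.S.hεα]) hb
    (WsLoc_tri (WsLoc_comm (A.bdry_Ws hy hyn hyν)) (A.bdry_Ws hy' hyn' hyν')) h

lemma S_u_eq (A : ChainSetting f n x α ε ν δ C) {q w w' : M} (hq : q ∈ Xdelta f n x δ) (hw : w ∈ SpSet f x ν q)
    (hw' : w' ∈ SpSet f x ν q) {b : ℝ} (hb : b ≤ α) (h : w' ∈ WuLoc f b w) : w = w' :=
  A.S.hexp.eq (by linarith [A.S.hεα]) hb (WsLoc_tri (WsLoc_comm (A.Ssub hq hw)) (A.Ssub hq hw')) h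

lemma two_ends (A : ChainSetting f n x α ε ν δ C) {r : M} (hr : r ∈ PerH f n) (hrO : r ∈ Om f x ν C) {η : ℝ} (hη : 0 < η)
    (hb : closedBall r η ⊆ ball x ν) : ∃ T e, GoodArc f ε r η T e ∧ e ∈ Om f x ν C := by
  obtain ⟨T₁, e₁, T₂, e₂, h₁, h₂, h12⟩ := A.S.two_arcs hr hη hb
  by_cases he₁ : e₁ ∈ Om f x ν C
  · exact ⟨T₁, e₁, h₁, he₁⟩
  by_cases he₂ : e₂ ∈ Om f x ν C
  · exact ⟨T₂, e₂, h₂, he₂⟩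
  exfalso
  obtain ⟨c, hc, hrc⟩ := A.mem_Om.1 hrO
  have key : ∀ T e, GoodArc f ε r η T e → e ∉ Om f x ν C → ∃ s ∈ T, s ∈ SpSet f x ν c := by
    rintro T e ⟨hT, hrT, heT, -, hTs⟩ he
    have hTb : T ⊆ ball x ν := fun y hy => hb (hTs hy).2
    exact A.cross (A.CX hc) hT hTb heT (not_Om he (hTb heT) hc) hrT hrc
  obtain ⟨s₁, hs₁, hs₁S⟩ := key _ _ h₁ he₁
  obtain ⟨s₂, hs₂, hs₂S⟩ := key _ _ h₂ he₂
  have heq : s₁ = s₂ := A.S_u_eq (A.CX hc) hs₁S hs₂S (b := ε + ε) (by linarith [A.S.hεα])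
    (WuLoc_tri (WuLoc_comm (h₁.2.2.2.2 hs₁).1) (h₂.2.2.2.2 hs₂).1)
  subst heq
  have : s₁ = r := h12 ⟨hs₁, hs₂⟩
  subst this
  exact H_not_S hrc hs₁S

lemma stepA (A : ChainSetting f n x α ε ν δ C) {z : M} {η : ℝ} (hη : 0 < η) (hb : closedBall z (6 * η) ⊆ ball x δ) :
    ∃ q₀ ∈ C, ∀ q ∈ C, Hs f x ν q₀ ⊆ Hs f x ν q → ∀ y ∈ closure (Om f x ν C), y ∉ Om f x ν C → dist y z ≤ η →
      ∃ w ∈ SpSet f x ν q, w ∈ WuLoc f ε y ∧ dist w y ≤ η := by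
  have hbν : closedBall z (6 * η) ⊆ ball x ν := hb.trans A.sub
  have hin : ∀ y, dist y z ≤ 6 * η → y ∈ ball x ν := fun y hy => hbν (mem_closedBall.2 hy)
  set Z0 : Set (M × M) := {t | t.1 ∈ Om f x ν C ∧ t.2 ∈ Om f x ν C ∧ ∃ T, GoodArc f ε t.1 η T t.2} with hZ0
  have claim1 : ∀ y ∈ closure (Om f x ν C), dist y z ≤ η → ∀ τ > 0, ∃ r e, (r, e) ∈ Z0 ∧ dist y r < τ := by
    intro y hy hyz τ hτ
    obtain ⟨r0, hr0b, hr0⟩ := mem_closure_iff.1 hy _ (isOpen_ball (x := y) (ε := min τ η)) (mem_ball_self (lt_min hτ hη))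
    have hd : r0 ∈ closure (PerH f n) := A.S.hdense ▸ mem_univ r0
    obtain ⟨r, ⟨hrb, hrO⟩, hrP⟩ := mem_closure_iff.1 hd _ (isOpen_ball.inter A.Om_open) ⟨hr0b, hr0⟩
    have hry : dist y r < min τ η := mem_ball'.1 hrb
    have hry2 := hry.trans_le (min_le_right _ _)
    obtain ⟨T, e, hT, he⟩ := A.two_ends hrP hrO hη (fun u hu => hin u (by
      have h1 := mem_closedBall.1 hu
      have h2 := dist_triangle u r z
      have h3 := dist_triangle r y z
      rw [dist_comm r y] at h3
      linarith))
    exact ⟨r, e, ⟨hrO, he, T, hT⟩, hry.trans_le (min_le_left _ _)⟩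
  have claim2 : ∀ y e, (y, e) ∈ closure Z0 → y ∈ closure (Om f x ν C) → y ∉ Om f x ν C → dist y z ≤ η → e ∈ Om f x ν C := by
    intro y e hye hy hyn hyz
    have hcl : closure Z0 ⊆ {t : M × M | t.2 ∈ closure (Om f x ν C)} ∩ {t : M × M | t.2 ∈ WuLoc f ε t.1} ∩
        {t : M × M | dist t.2 t.1 = η} := by
      refine closure_minimal ?_ (((isClosed_closure.preimage continuous_snd).inter (isClosed_WuLoc f ε)).inter
        (isClosed_eq (by fun_prop) (by fun_prop)))
      rintro ⟨r, e⟩ ⟨-, he, T, hT⟩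
      exact ⟨⟨subset_closure he, (hT.2.2.2.2 hT.2.2.1).1⟩, hT.2.2.2.1⟩
    obtain ⟨⟨h1, h2⟩, h3⟩ := hcl hye
    simp only [mem_ofPred_eq] at h1 h2 h3
    by_contra hen
    have heq := A.bdry_eq hy hyn (hin y (by linarith)) h1 hen (hin e (by
      have := dist_triangle e y z; linarith)) A.hεα1 h2
    subst heq
    rw [dist_self] at h3
    linarith
  have hK : IsCompact (Prod.snd '' (closure Z0 ∩ ((closure (Om f x ν C) ∩ (Om f x ν C)ᶜ ∩ closedBall z η) ×ˢ univ))) := by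
    refine IsCompact.image (IsClosed.isCompact ?_) continuous_snd
    exact isClosed_closure.inter (((isClosed_closure.inter A.Om_open.isClosed_compl).inter isClosed_closedBall).prod isClosed_univ)
  obtain ⟨q₀, hq₀, hKq⟩ := A.compact_Om hK (by
    rintro _ ⟨⟨y, e⟩, ⟨h1, ⟨⟨h2, h3⟩, h4⟩, -⟩, rfl⟩
    exact claim2 y e h1 h2 h3 (mem_closedBall.1 h4))
  refine ⟨q₀, hq₀, fun q hq hle y hy hyn hyz => ?_⟩
  have hG : y ∈ Gs f x ν q := not_Om hyn (hin y (by linarith)) hq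
  obtain ⟨τG, hτG, hGb⟩ := Metric.isOpen_iff.1 (A.Gopen (A.CX hq)) y hG
  have claim3 : ∀ τ > 0, ∃ r e, (r, e) ∈ Z0 ∧ dist y r < τ ∧ e ∈ Hs f x ν q := by
    by_contra hcon
    push Not at hcon
    obtain ⟨τ, hτ, hno⟩ := hcon
    obtain ⟨e, he, heH⟩ := proj_closed (y := y) (F := closure Z0 ∩ {t : M × M | t.2 ∈ (Hs f x ν q)ᶜ})
      (isClosed_closure.inter ((A.Hprops (A.CX hq)).1.isClosed_compl.preimage continuous_snd)) (by
        intro τ' hτ'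
        obtain ⟨r, e, hre, hd⟩ := claim1 y hy hyz (min τ τ') (lt_min hτ hτ')
        exact ⟨r, e, ⟨subset_closure hre, hno r e hre (hd.trans_le (min_le_left _ _))⟩, hd.trans_le (min_le_right _ _)⟩)
    exact heH (hle (hKq ⟨(y, e), ⟨he, ⟨⟨hy, hyn⟩, mem_closedBall.2 hyz⟩, mem_univ _⟩, rfl⟩))
  obtain ⟨w, ⟨hw1, hw2⟩, hw3⟩ := proj_closed (y := y) (F := {t : M × M | t.2 ∈ closure (SpSet f x ν q)} ∩
      {t : M × M | t.2 ∈ WuLoc f ε t.1} ∩ {t : M × M | dist t.2 t.1 ≤ η})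
      (((isClosed_closure.preimage continuous_snd).inter (isClosed_WuLoc f ε)).inter
        (isClosed_le (by fun_prop) (by fun_prop))) (by
      intro τ hτ
      obtain ⟨r, e, ⟨hrO, heO, T, hT, hrT, heT, hd, hTs⟩, hyr, heH⟩ := claim3 (min (min τ τG) η) (lt_min (lt_min hτ hτG) hη)
      have h1 : dist y r < τ := hyr.trans_le ((min_le_left _ _).trans (min_le_left _ _))
      have h2 : dist y r < τG := hyr.trans_le ((min_le_left _ _).trans (min_le_right _ _))
      have h3 : dist y r < η := hyr.trans_le (min_le_right _ _)
      simp only at hrT hTs hT heT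
      have hTb : T ⊆ ball x ν := fun u hu => hin u (by
        have h4 := mem_closedBall.1 (hTs hu).2
        have h5 := dist_triangle u r z
        have h6 := dist_triangle r y z
        rw [dist_comm r y] at h6
        linarith)
      obtain ⟨s, hsT, hsS⟩ := A.cross (A.CX hq) hT hTb hrT (hGb (mem_ball'.2 h2)) heT heH
      exact ⟨r, s, ⟨⟨subset_closure hsS, (hTs hsT).1⟩, mem_closedBall.1 (hTs hsT).2⟩, h1⟩)
  simp only [mem_ofPred_eq] at hw1 hw2 hw3
  have hwν : w ∈ ball x ν := hin w (by have := dist_triangle w y z; linarith)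
  exact ⟨w, SpSet_closed A.S.hexp A.hεα1 (A.Ssub (A.CX hq)) (A.self_mem (A.CX hq)) ⟨hw1, hwν⟩, hw2, hw3⟩

lemma stepB (A : ChainSetting f n x α ε ν δ C) {z : M} {η : ℝ} (hη : 0 < η) (hb : closedBall z (6 * η) ⊆ ball x δ)
    (hloc : ∀ y y' : M, y' ∈ WuLoc f ε y → dist y y' ≤ 3 * η → y' ∈ WuLoc f (ε / 2) y)
    {q₀ : M} (hq₀ : q₀ ∈ C) (hA : ∀ q ∈ C, Hs f x ν q₀ ⊆ Hs f x ν q →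
      ∃ w ∈ SpSet f x ν q, w ∈ WuLoc f ε z ∧ dist w z ≤ η)
    {w₀ : M} (hw₀ : w₀ ∈ SpSet f x ν q₀) (hw₀u : w₀ ∈ WuLoc f ε z) (hw₀d : dist w₀ z ≤ η) :
    ∃ τ > 0, ∀ w ∈ SpSet f x ν q₀, dist w₀ w < τ →
      ∃ y ∈ frontier (closure (Om f x ν C)), y ∈ WuLoc f ε w ∧ dist y w ≤ 3 * η := by
  by_contra hcon
  push Not at hcon
  have hin : ∀ y, dist y z ≤ 6 * η → y ∈ ball x δ := fun y hy => hb (mem_closedBall.2 hy)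
  have hqX := A.CX hq₀
  -- approximate data
  have claim : ∀ τ > 0, ∃ r e c v k : M, dist w₀ r < τ ∧ e ∈ WuLoc f ε r ∧ dist e r = 3 * η ∧ dist e c < τ ∧
      v ∈ WsLoc f ε c ∧ dist v k < τ ∧ k ∈ WuLoc f ε z ∧ dist k z ≤ η := by
    intro τ hτ
    obtain ⟨w, hwS, hwd, hbad⟩ := hcon (min (τ / 2) (η / 2)) (lt_min (by linarith) (by linarith))
    have hwd1 : dist w₀ w < τ / 2 := hwd.trans_le (min_le_left _ _)
    have hwd2 : dist w₀ w < η / 2 := hwd.trans_le (min_le_right _ _)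
    obtain ⟨τ0, hτ0, hτ0b⟩ : ∃ τ0 > 0, ∀ r y, dist w r < τ0 → y ∈ frontier (closure (Om f x ν C)) →
        y ∈ WuLoc f ε r → ¬ dist y r ≤ 3 * η := by
      by_contra hc
      push Not at hc
      obtain ⟨y, ⟨hy1, hy2⟩, hy3⟩ := proj_closed (y := w) (F := {t : M × M | t.2 ∈ frontier (closure (Om f x ν C))} ∩
        {t : M × M | t.2 ∈ WuLoc f ε t.1} ∩ {t : M × M | dist t.2 t.1 ≤ 3 * η})
        (((isClosed_frontier.preimage continuous_snd).inter (isClosed_WuLoc f ε)).inter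
        (isClosed_le (by fun_prop) (by fun_prop))) (by
          intro τ hτ
          obtain ⟨r, y, h1, h2, h3, h4⟩ := hc τ hτ
          exact ⟨r, y, ⟨⟨h2, h3⟩, h4⟩, h1⟩)
      exact absurd hy3 (not_le.2 (hbad y hy1 hy2))
    obtain ⟨σ, hσ, hσ1, hσ2, hσ3⟩ : ∃ σ > 0, σ ≤ τ / 2 ∧ σ ≤ η / 2 ∧ σ ≤ τ0 :=
      ⟨min (min (τ / 2) (η / 2)) τ0, lt_min (lt_min (by linarith) (by linarith)) hτ0,
        (min_le_left _ _).trans (min_le_left _ _), (min_le_left _ _).trans (min_le_right _ _), min_le_right _ _⟩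
    have hwν : w ∈ ball x ν := SpSet_sub_ball hwS
    set W := connectedComponentIn (ball w σ ∩ ball x ν) w with hW
    have hWo : IsOpen W := (isOpen_ball.inter isOpen_ball).connectedComponentIn
    have hWs : W ⊆ ball w σ ∩ ball x ν := connectedComponentIn_subset _ _
    have hwW : w ∈ W := mem_connectedComponentIn ⟨mem_ball_self hσ, hwν⟩
    have hWp : IsPreconnected W := isPreconnected_connectedComponentIn
    have hwWs : w ∈ Ws f q₀ := (connectedComponentIn_subset _ _ hwS).1
    obtain ⟨O, hO, hwO, hOP⟩ := A.S.index_local' hqX.1 (A.Xν hqX) (w := w) (Or.inl hwWs)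
    have hHo := (A.Hprops hqX).1
    obtain ⟨r0, ⟨hr0W, hr0O⟩, hr0H⟩ := mem_closure_iff.1 (A.Scl hqX hwS).2 _ (hWo.inter hO) ⟨hwW, hwO⟩
    have hd : r0 ∈ closure (PerH f n) := A.S.hdense ▸ mem_univ r0
    obtain ⟨r, ⟨⟨hrW, hrO⟩, hrH⟩, hrP⟩ := mem_closure_iff.1 hd _ ((hWo.inter hO).inter hHo) ⟨⟨hr0W, hr0O⟩, hr0H⟩
    have hwr : dist w r < σ := mem_ball'.1 (hWs hrW).1
    have hrz : dist r z ≤ 2 * η := by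
      have h1 := dist_triangle r w z
      have h2 := dist_triangle w w₀ z
      rw [dist_comm r w] at h1
      rw [dist_comm w w₀] at h2
      linarith
    have hrX : r ∈ Xdelta f n x δ := ⟨hOP r hrP hrO, hin r (by linarith)⟩
    have hrOm : r ∈ Om f x ν C := A.mem_Om.2 ⟨q₀, hq₀, hrH⟩
    have hrC : r ∈ C := A.X_Om hrX hrOm
    have hballr : closedBall r (3 * η) ⊆ ball x δ := fun u hu => hin u (by
      have h1 := mem_closedBall.1 hu
      have h2 := dist_triangle u r z
      linarith)
    obtain ⟨T, e, ⟨hT, hrT, heT, hed, hTs⟩, heG⟩ := A.S.side_arc hrX.1 (by linarith : 0 < 3 * η) (hballr.trans A.sub)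
      (A.Gopen hrX) (A.Hprops hrX).1 Gs_disj_Hs Gs_union_Hs (A.Scl hrX (A.self_mem hrX)).1
    have hTint : T ⊆ interior (closure (Om f x ν C)) := by
      refine hT.subset_left_of_subset_union isOpen_interior isClosed_closure.isOpen_compl
        (disjoint_compl_right.mono_left interior_subset) ?_
        ⟨r, hrT, interior_maximal subset_closure A.Om_open hrOm⟩
      intro u hu
      by_contra hcu
      simp only [mem_union, mem_compl_iff, not_or, not_not] at hcu
      exact hτ0b r u (hwr.trans_le hσ3) (by rw [isClosed_closure.frontier_eq]; exact ⟨hcu.2, hcu.1⟩)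
        (hTs hu).1 (mem_closedBall.1 (hTs hu).2)
    have heu : e ∈ WuLoc f ε r := (hTs heT).1
    have heWu : e ∈ Wu f r := by
      rw [← Ws_symm_homeo]
      refine A.S.hexp.symm.WsLoc_subset r ?_
      rw [WsLoc_symm_homeo]
      exact WuLoc_mono A.hεα1 _ heu
    obtain ⟨O2, hO2, heO2, hO2P⟩ := A.S.index_local' hrX.1 (A.Xν hrX) (w := e) (Or.inr heWu)
    have hecl : e ∈ closure (Om f x ν C) := interior_subset (hTint heT)
    have hNo : IsOpen (O2 ∩ Gs f x ν r ∩ ball e (min τ η)) := (hO2.inter (A.Gopen hrX)).inter isOpen_ball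
    obtain ⟨c0, hc0N, hc0O⟩ := mem_closure_iff.1 hecl _ hNo ⟨⟨heO2, heG⟩, mem_ball_self (lt_min hτ hη)⟩
    have hd : c0 ∈ closure (PerH f n) := A.S.hdense ▸ mem_univ c0
    obtain ⟨c, ⟨⟨⟨hcO2, hcG⟩, hcb⟩, hcOm⟩, hcP⟩ := mem_closure_iff.1 hd _ (hNo.inter A.Om_open) ⟨hc0N, hc0O⟩
    have hec : dist e c < min τ η := mem_ball'.1 hcb
    have hec2 := hec.trans_le (min_le_right τ η)
    have hcX : c ∈ Xdelta f n x δ := ⟨hO2P c hcP hcO2, hin c (by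
      have h1 := dist_triangle c e z
      have h2 := dist_triangle e r z
      rw [dist_comm c e] at h1
      linarith)⟩
    have hcC : c ∈ C := A.X_Om hcX hcOm
    have hrHc : r ∈ Hs f x ν c := A.c2 hrC hcC hcG
    have hw0r : dist w₀ r < τ := by
      have := dist_triangle w₀ w r; linarith
    have near : ∀ s ∈ W, dist w₀ s < τ := fun s hs => by
      have h1 := dist_triangle w₀ w s
      have h2 : dist w s < σ := mem_ball'.1 (hWs hs).1
      linarith
    rcases A.tri hq₀ hcC with h | h | h
    · have hwG : w ∈ Gs f x ν c := (A.c1 hqX hcX h).2 (Or.inr hwS)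
      obtain ⟨s, hsW, hsS⟩ := A.cross hcX hWp (hWs.trans inter_subset_right) hwW hwG hrW hrHc
      exact ⟨r, e, c, s, w₀, hw0r, heu, hed, hec.trans_le (min_le_left _ _), A.Ssub hcX hsS,
        by rw [dist_comm]; exact near s hsW, hw₀u, hw₀d⟩
    · subst h
      exact ⟨r, e, c, w, w₀, hw0r, heu, hed, hec.trans_le (min_le_left _ _), A.Ssub hcX hwS,
        by rw [dist_comm]; exact near w hwW, hw₀u, hw₀d⟩
    · obtain ⟨v, hvS, hvu, hvd⟩ := hA c hcC (H_sub_hat.trans (A.c1 hcX hqX h).1)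
      exact ⟨r, e, c, v, v, hw0r, heu, hed, hec.trans_le (min_le_left _ _), A.Ssub hcX hvS,
        by rw [dist_self]; exact hτ, hvu, hvd⟩
  -- pass to the limit
  let F : Set (M × M × M × M × M) := {t | t.2.1 ∈ WuLoc f ε t.1} ∩ {t | dist t.2.1 t.1 = 3 * η} ∩
    {t | t.2.2.2.1 ∈ WsLoc f ε t.2.2.1} ∩ {t | t.2.2.2.2 ∈ WuLoc f ε z} ∩ {t | dist t.2.2.2.2 z ≤ η}
  have hF : IsClosed F := by
    refine (((IsClosed.inter ?_ ?_).inter ?_).inter ?_).inter ?_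
    · exact (isClosed_WuLoc f ε).preimage (f := fun t : M × M × M × M × M => (t.1, t.2.1)) (by fun_prop)
    · exact isClosed_eq (by fun_prop) (by fun_prop)
    · exact (isClosed_WsLoc f ε).preimage (f := fun t : M × M × M × M × M => (t.2.2.1, t.2.2.2.1)) (by fun_prop)
    · exact (isClosed_WuLoc f ε).preimage (f := fun t : M × M × M × M × M => (z, t.2.2.2.2)) (by fun_prop)
    · exact isClosed_le (by fun_prop) (by fun_prop)
  let g : M × M × M × M × M → ℝ := fun t => dist w₀ t.1 + dist t.2.1 t.2.2.1 + dist t.2.2.2.1 t.2.2.2.2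
  have hg : Continuous g := by fun_prop
  have happ : ∀ τ > 0, ∃ t ∈ F, g t < 3 * τ := by
    intro τ hτ
    obtain ⟨r, e, c, v, k, h1, h2, h3, h4, h5, h6, h7, h8⟩ := claim τ hτ
    refine ⟨(r, e, c, v, k), ⟨⟨⟨⟨h2, h3⟩, h5⟩, h7⟩, h8⟩, ?_⟩
    change dist w₀ r + dist e c + dist v k < 3 * τ
    linarith
  obtain ⟨t0, ht0, -⟩ := happ 1 one_pos
  obtain ⟨⟨r, e, c, v, k⟩, hF0, hmin⟩ := hF.isCompact.exists_isMinOn ⟨t0, ht0⟩ hg.continuousOn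
  have hg0 : g (r, e, c, v, k) ≤ 0 := by
    by_contra hpos
    push Not at hpos
    obtain ⟨t, ht, hlt⟩ := happ (g (r, e, c, v, k) / 3) (by linarith)
    have := isMinOn_iff.1 hmin t ht
    linarith
  change dist w₀ r + dist e c + dist v k ≤ 0 at hg0
  have e1 : w₀ = r := dist_le_zero.1 (by linarith [dist_nonneg (x := e) (y := c), dist_nonneg (x := v) (y := k)])
  have e2 : e = c := dist_le_zero.1 (by linarith [dist_nonneg (x := w₀) (y := r), dist_nonneg (x := v) (y := k)])
  have e3 : v = k := dist_le_zero.1 (by linarith [dist_nonneg (x := w₀) (y := r), dist_nonneg (x := e) (y := c)])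
  subst e1 e2 e3
  obtain ⟨⟨⟨⟨h2, h3⟩, h5⟩, h7⟩, h8⟩ := hF0
  simp only [mem_ofPred_eq] at h2 h3 h5 h7 h8
  have k1 : v ∈ WuLoc f (ε / 2) z := hloc _ _ h7 (by rw [dist_comm]; linarith)
  have k2 : w₀ ∈ WuLoc f (ε / 2) z := hloc _ _ hw₀u (by rw [dist_comm]; linarith)
  have k3 : e ∈ WuLoc f (ε / 2) w₀ := hloc _ _ h2 (by rw [dist_comm]; linarith)
  have k4 : e = v := A.S.hexp.eq A.hεα1 (b := ε / 2 + ε / 2 + ε / 2) (by linarith [A.S.hεα, A.S.hε]) h5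
    (WuLoc_comm (WuLoc_tri (WuLoc_tri (WuLoc_comm k1) k2) k3))
  subst k4
  have := dist_triangle e z w₀
  rw [dist_comm z w₀] at this
  linarith

end ChainSetting
end chain

open Metric Set

lemma closed_graph_contOn {X M : Type*} [TopologicalSpace X] [MetricSpace M] [CompactSpace M] {R : Set (X × M)}
    (hR : IsClosed R) {g : X → M} {s : Set X} (h1 : ∀ a ∈ s, (a, g a) ∈ R)
    (h2 : ∀ a ∈ s, ∀ m, (a, m) ∈ R → m = g a) : ContinuousOn g s := by
  rw [continuousOn_iff_isClosed]
  intro K hK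
  refine ⟨Prod.fst '' (R ∩ (univ ×ˢ K)),
    isClosedMap_fst_of_compactSpace _ (hR.inter (isClosed_univ.prod hK)), ?_⟩
  ext a
  constructor
  · rintro ⟨ha, has⟩
    exact ⟨⟨(a, g a), ⟨h1 a has, mem_univ _, ha⟩, rfl⟩, has⟩
  · rintro ⟨⟨⟨a', m⟩, ⟨hm, -, hmK⟩, rfl⟩, has⟩
    refine ⟨?_, has⟩
    have := h2 _ has m hm
    simp only [mem_preimage]
    exact this ▸ hmK

lemma mk_homeo {X Y : Type*} [TopologicalSpace X] [TopologicalSpace Y] {s : Set X} {t : Set Y} {h : X → Y} {g : Y → X}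
    (hst : MapsTo h s t) (hts : MapsTo g t s) (hl : ∀ y ∈ s, g (h y) = y) (hr : ∀ a ∈ t, h (g a) = a)
    (hc : ContinuousOn h s) (gc : ContinuousOn g t) : Nonempty (s ≃ₜ t) :=
  ⟨{ toFun := hst.restrict, invFun := hts.restrict
     left_inv := fun y => Subtype.ext (hl y y.2)
     right_inv := fun a => Subtype.ext (hr a a.2)
     continuous_toFun := hc.mapsToRestrict hst
     continuous_invFun := gc.mapsToRestrict hts }⟩

lemma ChainSetting.final {M : Type*} [MetricSpace M] [CompactSpace M] [LocallyConnectedSpace M]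
    {f : M ≃ₜ M} {n : ℕ} {x : M} {α ε ν δ : ℝ} {C : Set M} (A : ChainSetting f n x α ε ν δ C) {z : M}
    (hz : z ∈ frontier (closure (Om f x ν C)) ∩ ball x δ) :
    ∃ V : Set M, IsOpen V ∧ z ∈ V ∧
      ∃ O : Set (EuclideanSpace ℝ (Fin (n - 1))), IsOpen O ∧
        Nonempty (((frontier (closure (Om f x ν C)) ∩ ball x δ) ∩ V : Set M) ≃ₜ O) := by
  have hn := A.S.hn
  have hε := A.S.hε
  have hεα := A.S.hεα
  obtain ⟨γ, hγ, hloc⟩ := A.S.hexp.local_u (θ := ε / 2) (by linarith)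
  obtain ⟨η, hη, hηγ, hb⟩ : ∃ η > 0, 3 * η < γ ∧ closedBall z (6 * η) ⊆ ball x δ := by
    obtain ⟨s, hs, hsb⟩ := Metric.isOpen_iff.1 (isOpen_ball (x := x) (ε := δ)) z hz.2
    refine ⟨min (γ / 4) (s / 7), by positivity, ?_, ?_⟩
    · linarith [min_le_left (γ / 4) (s / 7)]
    · exact (closedBall_subset_ball (by linarith [min_le_right (γ / 4) (s / 7)])).trans hsb
  have hbν : ∀ y, dist y z ≤ 6 * η → y ∈ ball x ν := fun y hy => A.sub (hb hy)
  set B := frontier (closure (Om f x ν C)) with hB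
  have hBcl : IsClosed B := isClosed_frontier
  obtain ⟨q, hq, hA⟩ := A.stepA hη hb
  have hqX := A.CX hq
  set S := SpSet f x ν q with hS
  have hScl : ∀ w ∈ closure S, w ∈ ball x ν → w ∈ S := fun w hw hwν =>
    SpSet_closed A.S.hexp A.hεα1 (A.Ssub hqX) (A.self_mem hqX) ⟨hw, hwν⟩
  have hψ : ∀ y, ∃ w, y ∈ B → dist y z ≤ η → w ∈ S ∧ w ∈ WuLoc f ε y ∧ dist w y ≤ η := by
    intro y
    by_cases h : y ∈ B ∧ dist y z ≤ η
    · obtain ⟨h1, h2⟩ := frontier_cl_sub A.Om_open h.1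
      obtain ⟨w, hw⟩ := hA q hq subset_rfl y h1 h2 h.2
      exact ⟨w, fun _ _ => hw⟩
    · exact ⟨y, fun h1 h2 => absurd ⟨h1, h2⟩ h⟩
  choose ψ hψ using hψ
  have hzz : dist z z ≤ η := by rw [dist_self]; exact hη.le
  obtain ⟨hw₀S, hw₀u, hw₀d⟩ := hψ z hz.1 hzz
  set w₀ := ψ z with hw₀
  have hz12 := frontier_cl_sub A.Om_open hz.1
  obtain ⟨τ, hτ, hφ⟩ := A.stepB hη hb
    (fun y y' h h' => hloc y y' (WuLoc_mono A.hεα1 _ h) (by linarith)) hq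
    (fun q' hq' hqq => hA q' hq' hqq z hz12.1 hz12.2 hzz) hw₀S hw₀u hw₀d
  have hφ' : ∀ w, ∃ y, w ∈ S → dist w₀ w < τ → y ∈ B ∧ y ∈ WuLoc f ε w ∧ dist y w ≤ 3 * η := by
    intro w
    by_cases h : w ∈ S ∧ dist w₀ w < τ
    · obtain ⟨y, hy⟩ := hφ w h.1 h.2
      exact ⟨y, fun _ _ => hy⟩
    · exact ⟨w, fun h1 h2 => absurd ⟨h1, h2⟩ h⟩
  choose φ hφ using hφ'
  have U1 : ∀ {y w w'}, w ∈ S → w' ∈ S → w ∈ WuLoc f ε y → w' ∈ WuLoc f ε y → w = w' :=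
    fun h1 h2 h3 h4 => A.S_u_eq hqX h1 h2 (b := ε + ε) (by linarith) (WuLoc_tri (WuLoc_comm h3) h4)
  have U2 : ∀ {w y y'}, y ∈ B → y' ∈ B → dist y z ≤ 6 * η → dist y' z ≤ 6 * η →
      y ∈ WuLoc f ε w → y' ∈ WuLoc f ε w → y = y' := by
    intro w y y' h1 h2 h3 h4 h5 h6
    have a := frontier_cl_sub A.Om_open h1
    have b := frontier_cl_sub A.Om_open h2
    exact A.bdry_eq a.1 a.2 (hbν _ h3) b.1 b.2 (hbν _ h4) (b := ε + ε) (by linarith)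
      (WuLoc_tri (WuLoc_comm h5) h6)
  have ψc : ContinuousOn ψ (B ∩ ball z η) := by
    refine closed_graph_contOn (R := {r : M × M | r.2 ∈ WuLoc f ε r.1} ∩
      ({r | dist r.2 r.1 ≤ η} ∩ Prod.snd ⁻¹' closure S))
      ((isClosed_WuLoc f ε).inter ((isClosed_le (by fun_prop) (by fun_prop)).inter
        (isClosed_closure.preimage continuous_snd))) ?_ ?_
    · rintro y ⟨hy, hyz⟩
      obtain ⟨h1, h2, h3⟩ := hψ y hy (mem_ball.1 hyz).le
      exact ⟨h2, h3, subset_closure h1⟩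
    · rintro y ⟨hy, hyz⟩ w ⟨h4, h5, h6⟩
      obtain ⟨h1, h2, h3⟩ := hψ y hy (mem_ball.1 hyz).le
      refine U1 (hScl w h6 (hbν w ?_)) h1 h4 h2
      have h5' : dist w y ≤ η := h5
      linarith [dist_triangle w y z, mem_ball.1 hyz]
  have φd : ∀ w, dist w₀ w < min τ η → ∀ y, dist y w ≤ 3 * η → dist y z ≤ 6 * η := by
    intro w hw y hy
    have := hw.trans_le (min_le_right _ _)
    rw [dist_comm] at this
    linarith [dist_triangle y w z, dist_triangle w w₀ z]
  have φc : ContinuousOn φ (S ∩ {w | dist w₀ w < min τ η}) := by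
    refine closed_graph_contOn (R := {r : M × M | r.2 ∈ WuLoc f ε r.1} ∩
      ({r | dist r.2 r.1 ≤ 3 * η} ∩ Prod.snd ⁻¹' B))
      ((isClosed_WuLoc f ε).inter ((isClosed_le (by fun_prop) (by fun_prop)).inter
        (hBcl.preimage continuous_snd))) ?_ ?_
    · rintro w ⟨hw, hwd⟩
      obtain ⟨h1, h2, h3⟩ := hφ w hw (lt_of_lt_of_le hwd (min_le_left _ _))
      exact ⟨h2, h3, h1⟩
    · rintro w ⟨hw, hwd⟩ y ⟨h4, h5, h6⟩
      obtain ⟨h1, h2, h3⟩ := hφ w hw (lt_of_lt_of_le hwd (min_le_left _ _))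
      exact U2 h6 h1 (φd w hwd _ h5) (φd w hwd _ h3) h4 h2
  -- flat chart
  obtain ⟨HB⟩ := PerHr.hypBox hqX.1
    (E₁ := EuclideanSpace ℝ (Fin (n - 1))) (EuclideanSpace.equiv (Fin (n - 1)) ℝ).symm
    (E₂ := ℝ) (ContinuousLinearEquiv.ofFinrankEq (by simp; omega))
  obtain ⟨E, hE⟩ := HB.flat A.S.hexp A.hεα1 (A.Ssub hqX)
  obtain ⟨hEs, hE2, hE3⟩ := hE w₀ hw₀S
  obtain ⟨ρ', hρ', hEt, hE4⟩ := hE3 {w | dist w₀ w < min τ η}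
    (isOpen_lt (by fun_prop) (by fun_prop)) (by simp [hτ, hη])
  set N := E.source ∩ E ⁻¹' ball (E w₀) ρ' with hN
  have hNo : IsOpen N := E.isOpen_inter_preimage isOpen_ball
  obtain ⟨V', hV'o, hV'⟩ := (_root_.continuousOn_iff'.1 ψc) N hNo
  set Da : Set (EuclideanSpace ℝ (Fin (n - 1))) := {a | (a, (0 : ℝ)) ∈ ball (E w₀) ρ'} with hDa
  have hDao : IsOpen Da := isOpen_ball.preimage (by fun_prop : Continuous fun a => (a, (0 : ℝ)))
  set e : EuclideanSpace ℝ (Fin (n - 1)) → M := fun a => E.symm (a, 0) with he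
  have hec : ContinuousOn e Da :=
    E.continuousOn_symm.comp (by fun_prop) (fun a ha => hEt ha)
  have heS : MapsTo e Da (S ∩ {w | dist w₀ w < min τ η}) := fun a ha =>
    ⟨(hE4 _ ha).2.2 rfl, (hE4 _ ha).1.1⟩
  set g := fun a => φ (e a) with hg
  have hgc : ContinuousOn g Da := φc.comp hec heS
  have hOo : IsOpen (Da ∩ g ⁻¹' ball z η) := hgc.isOpen_inter_preimage hDao isOpen_ball
  have hset : (B ∩ ball x δ) ∩ (V' ∩ ball z η) = (B ∩ ball z η) ∩ ψ ⁻¹' N := by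
    ext y
    have hiff := Set.ext_iff.1 hV' y
    simp only [mem_inter_iff] at hiff ⊢
    have : y ∈ ball z η → y ∈ ball x δ := fun h =>
      hb (mem_closedBall.2 (by linarith [mem_ball.1 h]))
    tauto
  have hzN : z ∈ ψ ⁻¹' N := ⟨hEs, mem_ball_self hρ'⟩
  have hzV : z ∈ (B ∩ ball x δ) ∩ (V' ∩ ball z η) := by
    rw [hset]; exact ⟨⟨hz.1, mem_ball_self hη⟩, hzN⟩
  refine ⟨V' ∩ ball z η, hV'o.inter isOpen_ball, hzV.2, Da ∩ g ⁻¹' ball z η, hOo, ?_⟩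
  rw [hset]
  -- key facts
  have K1 : ∀ y ∈ (B ∩ ball z η) ∩ ψ ⁻¹' N, ((E (ψ y)).1, (0 : ℝ)) = E (ψ y) ∧ φ (ψ y) = y := by
    rintro y ⟨⟨hy, hyz⟩, hys, hyb⟩
    obtain ⟨h1, h2, h3⟩ := hψ y hy (mem_ball.1 hyz).le
    have h4 := hE4 _ hyb
    rw [E.left_inv hys] at h4
    refine ⟨Prod.ext rfl (h4.2.1 h1).symm, ?_⟩
    obtain ⟨h5, h6, h7⟩ := hφ (ψ y) h1 (lt_of_lt_of_le h4.1.1 (min_le_left _ _))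
    exact U2 h5 hy (φd _ h4.1.1 _ h7) (by linarith [mem_ball.1 hyz]) h6 (WuLoc_comm h2)
  have K2 : ∀ a ∈ Da ∩ g ⁻¹' ball z η, g a ∈ B ∧ ψ (g a) = e a := by
    rintro a ⟨ha, hag⟩
    obtain ⟨h0, h0'⟩ := heS ha
    obtain ⟨h1, h2, h3⟩ := hφ (e a) h0 (lt_of_lt_of_le h0' (min_le_left _ _))
    obtain ⟨h4, h5, h6⟩ := hψ (g a) h1 (mem_ball.1 hag).le
    exact ⟨h1, U1 h4 h0 h5 (WuLoc_comm h2)⟩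
  have hgh : ∀ y ∈ (B ∩ ball z η) ∩ ψ ⁻¹' N, g ((E (ψ y)).1) = y := by
    intro y hy
    obtain ⟨h1, h2⟩ := K1 y hy
    simp only [hg, he]
    rw [h1, E.left_inv hy.2.1, h2]
  refine mk_homeo (h := fun y => (E (ψ y)).1) (g := g) ?_ ?_ hgh ?_ ?_ (hgc.mono inter_subset_left)
  · intro y hy
    refine ⟨?_, ?_⟩
    · change ((E (ψ y)).1, (0 : ℝ)) ∈ ball (E w₀) ρ'
      rw [(K1 y hy).1]; exact hy.2.2
    · change g ((E (ψ y)).1) ∈ ball z η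
      rw [hgh y hy]; exact hy.1.2
  · intro a ha
    obtain ⟨h1, h2⟩ := K2 a ha
    refine ⟨⟨h1, ha.2⟩, ?_⟩
    change ψ (g a) ∈ N
    rw [h2]
    refine ⟨E.map_target (hEt ha.1), ?_⟩
    change E (E.symm (a, 0)) ∈ ball (E w₀) ρ'
    rw [E.right_inv (hEt ha.1)]; exact ha.1
  · intro a ha
    obtain ⟨h1, h2⟩ := K2 a ha
    change (E (ψ (g a))).1 = a
    rw [h2]
    change (E (E.symm (a, 0))).1 = a
    rw [E.right_inv (hEt ha.1)]
  · have h1 : ContinuousOn (fun y => E (ψ y)) ((B ∩ ball z η) ∩ ψ ⁻¹' N) :=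
      E.continuousOn.comp (ψc.mono inter_subset_left) (fun y hy => hy.2.1)
    exact continuous_fst.comp_continuousOn h1

/-- **Proposition.** `∂S_{[p]} ∩ B_δ(x)` is a topological manifold of dimension `n-1`:
every point has a relatively open neighborhood homeomorphic to an open subset of `ℝ^{n-1}`. -/
theorem stmt17
    {M : Type*} [MetricSpace M] [CompactSpace M] [ConnectedSpace M]
    (n : ℕ) [ChartedSpace (EuclideanSpace ℝ (Fin n)) M]
    (f : M ≃ₜ M) (α : ℝ) (hα : 0 < α) (hexp : IsExpansive f α)
    (x : M) (hx : ¬ AdmitsLPS f n x)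
    (ε : ℝ) (hε : 0 < ε) (hεα : 2 * ε < α) (ν : ℝ) (hν : 0 < ν)
    (hi : ∀ p ∈ PerH f n ∩ Metric.ball x ν,
      SpSet f x ν p ⊆ WsLoc f ε p ∧ UpSet f x ν p ⊆ WuLoc f ε p)
    (hii : ∀ p ∈ PerHr f n (n - 1) ∩ Metric.ball x ν,
      ∃ V₁ V₂ : Set M, TwoComponents (Metric.ball x ν \ SpSet f x ν p) V₁ V₂)
    (hdense : closure (PerH f n) = Set.univ)
    (δ : ℝ) (hδ : δ ∈ Set.Ioo (0 : ℝ) ν)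
    (hfin : {C : Set M | IsMaxChainIn f n x ν δ C}.Finite)
    (hdisj : ∀ C₁ C₂ : Set M, IsMaxChainIn f n x ν δ C₁ → IsMaxChainIn f n x ν δ C₂ →
      C₁ ≠ C₂ → Disjoint C₁ C₂)
    (hacc : ∀ C : Set M, IsMaxChainIn f n x ν δ C → x ∈ closure C)
    :
    ∀ p ∈ Xdelta f n x δ, ∀ C : Set M, IsMaxChainIn f n x ν δ C → p ∈ C →
      ∀ z ∈ frontier (closure (⋃ q ∈ C, ShatSet f x ν q)) ∩ Metric.ball x δ,
        ∃ V : Set M, IsOpen V ∧ z ∈ V ∧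
          ∃ O : Set (EuclideanSpace ℝ (Fin (n - 1))), IsOpen O ∧
            Nonempty
              (((frontier (closure (⋃ q ∈ C, ShatSet f x ν q)) ∩ Metric.ball x δ) ∩ V : Set M)
                ≃ₜ O) := by
  intro p hp C hC hpC z hz
  have : LocallyConnectedSpace M := ChartedSpace.locallyConnectedSpace (EuclideanSpace ℝ (Fin n)) M
  by_cases hn : n = 0
  · exfalso
    subst hn
    have hsub : ∀ w : M, IsOpen ({w} : Set M) := by
      intro w
      have h1 := (chartAt (EuclideanSpace ℝ (Fin 0)) w).open_source
      have h2 : (chartAt (EuclideanSpace ℝ (Fin 0)) w).source = {w} := by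
        ext y
        constructor
        · intro hy
          exact (chartAt (EuclideanSpace ℝ (Fin 0)) w).injOn hy
            (mem_chart_source (EuclideanSpace ℝ (Fin 0)) w) (Subsingleton.elim _ _)
        · rintro rfl
          exact mem_chart_source (EuclideanSpace ℝ (Fin 0)) _
      rwa [h2] at h1
    have : DiscreteTopology M := discreteTopology_iff_isOpen_singleton.2 hsub
    have h3 := hz.1
    rw [(isClopen_discrete _).frontier_eq] at h3
    exact h3
  have S : Setting f n x α ε ν := ⟨hexp, hε, hεα, hi, hii, hdense, by omega⟩
  by_cases hx' : ∃ q ∈ C, x ∈ SpSet f x ν q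
  · exfalso
    obtain ⟨q, hq, hxq⟩ := hx'
    have h1 : ShatSet f x ν q = ball x ν := by
      unfold ShatSet
      rw [connectedComponentIn_eq_empty (fun h => h.2 hxq), sdiff_empty]
    have h2 : ball x ν ⊆ ⋃ q ∈ C, ShatSet f x ν q := by
      rw [← h1]; exact subset_biUnion_of_mem (u := fun q => ShatSet f x ν q) hq
    have h3 := hz.1
    rw [isClosed_closure.frontier_eq] at h3
    exact h3.2 (interior_maximal (h2.trans subset_closure) isOpen_ball
      (ball_subset_ball hδ.2.le hz.2))
  · push Not at hx'
    have A := S.chainSetting hδ.1 hδ.2 hC hdisj (hacc C hC) hx'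
    exact A.final hz
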